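/- arXiv:math/0502559 — 2 statements merged into one kernel-verified Lean document; each statement's English description precedes it below -/
import Mathlib

section
/- Fix β ∈ (−1,1) and let g_μ(x;α,β) = −g′(x;α,β)/g(x;α,β). For every ε > 0 there exist Δ₀ > 0 and x₀ > 0 such that for all α = 2−Δ with 0 < Δ < Δ₀ and all |x| > x₀: |(−f′(x;α,β)/f(x;α,β))/g_μ(x;α,β) − 1| < ε. Moreover, for every δ > 0 there is a function r(Δ) ≥ 0 with r(Δ)/Δ^{δ/2} → 0 as Δ → 0⁺ such that for all such α and |x| > x₀: |g_μ(x;α,β)/((x−ζ)/2) − 1| ≤ r(Δ) whenever |x−ζ| ≤ (2−δ)(log(1/Δ))^{1/2}, and |g_μ(x;α,β)/(3/(x−ζ)) − 1| ≤ r(Δ) whenever |x−ζ| ≥ (2+δ)(log(1/Δ))^{1/2}; and there is a constant c̄ > 0 with |g_μ(x;α,β)| ≤ c̄·|x| whenever (2−δ)(log(1/Δ))^{1/2} ≤ |x−ζ| ≤ (2+δ)(log(1/Δ))^{1/2} and |x| > x₀. -/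
open MeasureTheory Filter Set Topology Real

/-- Shift parameter ζ = −β·tan(πα/2) in Zolotarev's (M) parameterization. -/
noncomputable def zetaPar (α β : ℝ) : ℝ := -β * Real.tan (Real.pi * α / 2)

/-- Standard stable density in Zolotarev's (M) parameterization, via the inversion formula. -/
noncomputable def stableDensity (α β x : ℝ) : ℝ :=
  (1 / Real.pi) *
    (∫ t in Set.Ioi (0 : ℝ),
      Complex.exp (-(Complex.I * (t : ℂ) * (x : ℂ))) *
        Complex.exp (-(((t ^ α : ℝ) : ℂ)) *
          (1 + Complex.I * (β : ℂ) * ((Real.tan (Real.pi * α / 2) : ℝ) : ℂ) *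
            (((t ^ (1 - α) : ℝ) : ℂ) - 1)))).re

/-- The N(0,2) density f(y;2). -/
noncomputable def normalDensity (y : ℝ) : ℝ :=
  (1 / (2 * Real.sqrt Real.pi)) * Real.exp (-(y ^ 2) / 4)

/-- F₁(x;α,β) = f(x−ζ;2). -/
noncomputable def F1 (α β x : ℝ) : ℝ := normalDensity (x - zetaPar α β)

/-- F₂(x;α,β) = (1+β*)·Δ·|x−ζ|^{Δ−3} with Δ = 2−α and β* = β·sgn(x−ζ). -/
noncomputable def F2 (α β x : ℝ) : ℝ :=
  (1 + β * Real.sign (x - zetaPar α β)) * (2 - α) * |x - zetaPar α β| ^ ((2 - α) - 3)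

/-- g = F₁ + F₂. -/
noncomputable def gApprox (α β x : ℝ) : ℝ := F1 α β x + F2 α β x

/-- F₁′(x;α,β) = −((x−ζ)/2)·f(x−ζ;2). -/
noncomputable def F1' (α β x : ℝ) : ℝ :=
  -((x - zetaPar α β) / 2) * normalDensity (x - zetaPar α β)

/-- F₂′(x;α,β) = −3(1+β*)·Δ·sgn(x−ζ)·|x−ζ|^{Δ−4}. -/
noncomputable def F2' (α β x : ℝ) : ℝ :=
  -3 * (1 + β * Real.sign (x - zetaPar α β)) * (2 - α) * Real.sign (x - zetaPar α β) *
    |x - zetaPar α β| ^ ((2 - α) - 4)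

/-- g′ = F₁′ + F₂′. -/
noncomputable def gApprox' (α β x : ℝ) : ℝ := F1' α β x + F2' α β x

/-- The location score approximation g_μ = −g′/g. -/
noncomputable def gMu (α β x : ℝ) : ℝ := -gApprox' α β x / gApprox α β x


open MeasureTheory Filter Set Topology Real

/-- The complex coefficient. -/
noncomputable def cPar (β Δ : ℝ) : ℂ := 1 + ((β * Real.tan (Real.pi * Δ / 2) : ℝ) : ℂ) * Complex.I

/-- The exponential factor of the integrand after recentering. -/
noncomputable def EE (β Δ y : ℝ) (z : ℂ) : ℂ :=
  Complex.exp (-(Complex.I * z * (y : ℂ)) - cPar β Δ * z ^ (((2 - Δ : ℝ)) : ℂ))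

/-- Integrand with weight. -/
noncomputable def WW (k : ℕ) (β Δ y : ℝ) (z : ℂ) : ℂ := (-(Complex.I * z)) ^ k * EE β Δ y z

/-- The half line integral. -/
noncomputable def JJ (k : ℕ) (β Δ y : ℝ) : ℂ := ∫ t in Set.Ioi (0 : ℝ), WW k β Δ y (t : ℂ)

lemma zetaPar_eq (β Δ : ℝ) : zetaPar (2 - Δ) β = β * Real.tan (Real.pi * Δ / 2) := by
  unfold zetaPar
  have : Real.pi * (2 - Δ) / 2 = Real.pi - Real.pi * Δ / 2 := by ring
  rw [this, Real.tan_pi_sub]; ring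

lemma tan_eq' (Δ : ℝ) : Real.tan (Real.pi * (2 - Δ) / 2) = - Real.tan (Real.pi * Δ / 2) := by
  have : Real.pi * (2 - Δ) / 2 = Real.pi - Real.pi * Δ / 2 := by ring
  rw [this, Real.tan_pi_sub]

lemma stableDensity_eq (β Δ x : ℝ) :
    stableDensity (2 - Δ) β x = (1 / Real.pi) * (JJ 0 β Δ (x - zetaPar (2 - Δ) β)).re := by
  unfold stableDensity JJ
  congr 2
  apply setIntegral_congr_fun measurableSet_Ioi
  intro t ht
  have ht : 0 < t := ht
  simp only [WW, EE, pow_zero, one_mul]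
  rw [← Complex.exp_add]
  congr 1
  rw [tan_eq', zetaPar_eq, ← Complex.ofReal_cpow ht.le, cPar]
  have h1 : ((t ^ (1 - (2 - Δ)) : ℝ) : ℂ) * ((t ^ (2 - Δ) : ℝ) : ℂ) = (t : ℂ) := by
    rw [← Complex.ofReal_mul, ← Real.rpow_add ht]; norm_num
  push_cast at h1 ⊢
  linear_combination (-(Complex.I * β * -Complex.tan (Real.pi * Δ / 2))) * h1

lemma norm_EE_real (β Δ y t : ℝ) (ht : 0 ≤ t) :
    ‖EE β Δ y (t : ℂ)‖ = Real.exp (-(t ^ (2 - Δ))) := by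
  rw [EE, Complex.norm_exp, ← Complex.ofReal_cpow ht, cPar]
  congr 1
  simp [-Complex.ofReal_tan]

lemma norm_WW_real (k : ℕ) (β Δ y t : ℝ) (ht : 0 ≤ t) :
    ‖WW k β Δ y (t : ℂ)‖ = t ^ k * Real.exp (-(t ^ (2 - Δ))) := by
  rw [WW, norm_mul, norm_EE_real _ _ _ _ ht]
  simp [abs_of_nonneg ht]

lemma slit_or {z : ℂ} (h : 0 ≤ z.re) : z ∈ Complex.slitPlane ∨ (z = 0) ∨ (z.re = 0) := by
  rcases h.lt_or_eq with h | h
  · left; left; exact h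
  · right; right; exact h.symm

lemma continuousAt_cpow_half (Δ : ℝ) (hΔ : Δ < 2) (z : ℂ) (h : 0 ≤ z.re) :
    ContinuousAt (fun z : ℂ => z ^ (((2 - Δ : ℝ)) : ℂ)) z := by
  by_cases hz : z = 0
  · subst hz
    apply Complex.continuousAt_cpow_const_of_re_pos
    · left; simp
    · simp; linarith
  · apply continuousAt_cpow_const
    rw [Complex.mem_slitPlane_iff]
    rcases h.lt_or_eq with h | h
    · left; exact h
    · right; intro h2; apply hz; apply Complex.ext <;> simp [h.symm, h2]

lemma continuousAt_WW (k : ℕ) (β Δ y : ℝ) (hΔ : Δ < 2) (z : ℂ) (h : 0 ≤ z.re) :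
    ContinuousAt (WW k β Δ y) z := by
  unfold WW EE
  have := continuousAt_cpow_half Δ hΔ z h
  fun_prop

lemma integrable_dom (k : ℕ) (Δ : ℝ) (hΔ : Δ < 1) :
    IntegrableOn (fun t : ℝ => t ^ k * Real.exp (-(t ^ (2 - Δ)))) (Ioi 0) := by
  have := integrableOn_rpow_mul_exp_neg_rpow (p := 2 - Δ) (s := (k : ℝ))
    (by have : (0:ℝ) ≤ k := Nat.cast_nonneg k
        linarith) (by linarith)
  refine this.congr_fun ?_ measurableSet_Ioi
  intro t ht
  simp

lemma aesm_WW (k : ℕ) (β Δ y : ℝ) (hΔ : Δ < 2) :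
    AEStronglyMeasurable (fun t : ℝ => WW k β Δ y (t : ℂ)) (volume.restrict (Ioi 0)) := by
  apply ContinuousOn.aestronglyMeasurable _ measurableSet_Ioi
  intro t ht
  apply ContinuousAt.continuousWithinAt
  have ht : 0 < t := ht
  exact ContinuousAt.comp (f := fun t : ℝ => (t : ℂ))
    (continuousAt_WW k β Δ y hΔ (t : ℂ) (by simpa using ht.le)) (by fun_prop)

lemma integrable_WW (k : ℕ) (β Δ y : ℝ) (hΔ : Δ < 1) :
    IntegrableOn (fun t : ℝ => WW k β Δ y (t : ℂ)) (Ioi 0) := by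
  refine Integrable.mono' (integrable_dom k Δ hΔ) (aesm_WW k β Δ y (by linarith)) ?_
  filter_upwards [ae_restrict_mem measurableSet_Ioi] with t ht
  exact (norm_WW_real k β Δ y t (le_of_lt ht)).le

lemma hasDerivAt_JJ (k : ℕ) (β Δ y : ℝ) (hΔ : Δ < 1) :
    HasDerivAt (fun y : ℝ => JJ k β Δ y) (JJ (k + 1) β Δ y) y := by
  unfold JJ
  refine (hasDerivAt_integral_of_dominated_loc_of_deriv_le (s := univ)
    (F := fun (y : ℝ) (t : ℝ) => WW k β Δ y (t : ℂ))
    (F' := fun (y : ℝ) (t : ℝ) => WW (k+1) β Δ y (t : ℂ)) (x₀ := y)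
    (bound := fun t : ℝ => t ^ (k+1) * Real.exp (-(t ^ (2 - Δ)))) (μ := volume.restrict (Ioi 0))
    univ_mem ?_ ?_ ?_ ?_ ?_ ?_).2
  · exact Eventually.of_forall fun y => aesm_WW k β Δ y (by linarith)
  · exact integrable_WW k β Δ y hΔ
  · exact aesm_WW (k+1) β Δ y (by linarith)
  · filter_upwards [ae_restrict_mem measurableSet_Ioi] with t ht y _
    exact (norm_WW_real (k+1) β Δ y t (le_of_lt ht)).le
  · exact integrable_dom (k+1) Δ hΔ
  · filter_upwards with t y _
    unfold WW EE
    have h1 : HasDerivAt (fun y : ℝ => -(Complex.I * (t : ℂ) * (y : ℂ)) -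
        cPar β Δ * (t : ℂ) ^ (((2 - Δ : ℝ)) : ℂ)) (-(Complex.I * (t : ℂ) * 1)) y := by
      exact (((Complex.ofRealCLM.hasDerivAt (x := y)).const_mul (Complex.I * (t : ℂ))).neg).sub_const _
    have h2 := (h1.cexp).const_mul ((-(Complex.I * (t : ℂ))) ^ k)
    refine h2.congr_deriv ?_
    ring

lemma deriv_stableDensity (β Δ x : ℝ) (hΔ : Δ < 1) :
    deriv (stableDensity (2 - Δ) β) x
      = (1 / Real.pi) * (JJ 1 β Δ (x - zetaPar (2 - Δ) β)).re := by
  have h : stableDensity (2 - Δ) β =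
      fun x => (1 / Real.pi) * (JJ 0 β Δ (x - zetaPar (2 - Δ) β)).re := by
    funext x; exact stableDensity_eq β Δ x
  rw [h]
  apply HasDerivAt.deriv
  apply HasDerivAt.const_mul
  have h1 := hasDerivAt_JJ 0 β Δ (x - zetaPar (2 - Δ) β) hΔ
  have h2 := h1.comp_sub_const x (zetaPar (2 - Δ) β)
  exact (Complex.reCLM.hasFDerivAt.comp_hasDerivAt x h2)

lemma JJ_neg_re (k : ℕ) (β Δ y : ℝ) :
    (JJ k β Δ (-y)).re = (-1) ^ k * (JJ k (-β) Δ y).re := by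
  have h : JJ k β Δ (-y) = (starRingEnd ℂ) ((-1) ^ k * JJ k (-β) Δ y) := by
    unfold JJ
    rw [← integral_const_mul, ← integral_conj]
    apply setIntegral_congr_fun measurableSet_Ioi
    intro t ht
    have ht : 0 < t := ht
    simp only [WW, EE, cPar]
    rw [← Complex.ofReal_cpow ht.le]
    simp only [map_mul, map_pow, map_neg, map_sub, map_add, map_one, ← Complex.exp_conj,
      Complex.conj_I, Complex.conj_ofReal]
    rw [← mul_assoc, ← mul_pow]
    congr 1
    · congr 1; ring
    · congr 1; push_cast; ring
  rw [h, Complex.conj_re]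
  have : ((-1 : ℂ)) ^ k = (((-1 : ℝ) ^ k : ℝ) : ℂ) := by push_cast; rfl
  rw [this, Complex.re_ofReal_mul]

open MeasureTheory Filter Set Topology Real

lemma re_bound (β Δ : ℝ) (hΔ0 : 0 ≤ Δ) (hΔ : Δ < 2) (z : ℂ) (hz : z ≠ 0) (hre : 0 ≤ z.re) :
    ‖z‖ ^ (-Δ) * ((z.re ^ 2 - z.im ^ 2) - |β * Real.tan (Real.pi * Δ / 2)| * (z.re ^ 2 + z.im ^ 2))
      ≤ (cPar β Δ * z ^ (((2 - Δ : ℝ)) : ℂ)).re := by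
  set ζ := β * Real.tan (Real.pi * Δ / 2) with hζ
  have hn : 0 < ‖z‖ := norm_pos_iff.mpr hz
  have hsq : ‖z‖ ^ 2 = z.re ^ 2 + z.im ^ 2 := by
    rw [Complex.sq_norm, Complex.normSq_apply]; ring
  have hpow : z ^ (((2 - Δ : ℝ)) : ℂ) = ((‖z‖ ^ (2 - Δ) : ℝ) : ℂ) *
      (((Real.cos ((2 - Δ) * z.arg) : ℝ) : ℂ) + ((Real.sin ((2 - Δ) * z.arg) : ℝ) : ℂ) * Complex.I) := by
    rw [Complex.cpow_def_of_ne_zero hz, Complex.log, Real.rpow_def_of_pos hn]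
    rw [Complex.ofReal_exp, Complex.ofReal_cos, Complex.ofReal_sin, ← Complex.exp_mul_I,
      ← Complex.exp_add]
    congr 1; push_cast; ring
  have hval : (cPar β Δ * z ^ (((2 - Δ : ℝ)) : ℂ)).re =
      ‖z‖ ^ (2 - Δ) * (Real.cos ((2 - Δ) * z.arg) - ζ * Real.sin ((2 - Δ) * z.arg)) := by
    rw [hpow, cPar, ← hζ]
    simp only [Complex.mul_re, Complex.add_re, Complex.add_im, Complex.one_re, Complex.one_im,
      Complex.mul_im, Complex.ofReal_re, Complex.ofReal_im, Complex.I_re, Complex.I_im]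
    ring
  have harg : |z.arg| ≤ Real.pi / 2 := Complex.abs_arg_le_pi_div_two_iff.mpr hre
  have hcos : Real.cos (2 * z.arg) ≤ Real.cos ((2 - Δ) * z.arg) := by
    rw [← Real.cos_abs (2 * z.arg), ← Real.cos_abs ((2 - Δ) * z.arg)]
    apply Real.cos_le_cos_of_nonneg_of_le_pi (abs_nonneg _)
    · rw [abs_mul]; norm_num; linarith
    · rw [abs_mul, abs_mul]
      apply mul_le_mul_of_nonneg_right _ (abs_nonneg _)
      rw [abs_of_nonneg (by linarith : 0 ≤ 2 - Δ)]; norm_num; exact hΔ0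
  have hsin : ζ * Real.sin ((2 - Δ) * z.arg) ≤ |ζ| := by
    calc _ ≤ |ζ * Real.sin ((2 - Δ) * z.arg)| := le_abs_self _
      _ = |ζ| * |Real.sin ((2 - Δ) * z.arg)| := abs_mul _ _
      _ ≤ |ζ| * 1 := mul_le_mul_of_nonneg_left (Real.abs_sin_le_one _) (abs_nonneg _)
      _ = |ζ| := mul_one _
  have hcos2 : ‖z‖ ^ 2 * Real.cos (2 * z.arg) = z.re ^ 2 - z.im ^ 2 := by
    rw [Real.cos_two_mul, Complex.cos_arg hz]
    field_simp
    rw [hsq]; ring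
  have hsplit : ‖z‖ ^ (2 - Δ) = ‖z‖ ^ (-Δ) * ‖z‖ ^ 2 := by
    rw [← Real.rpow_natCast, ← Real.rpow_add hn]; congr 1; push_cast; ring
  rw [hval, hsplit, mul_assoc]
  apply mul_le_mul_of_nonneg_left _ (Real.rpow_nonneg hn.le _)
  rw [← hcos2, ← hsq]
  nlinarith [sq_nonneg ‖z‖]

lemma norm_EE (β Δ y : ℝ) (z : ℂ) :
    ‖EE β Δ y z‖ = Real.exp (y * z.im - (cPar β Δ * z ^ (((2 - Δ : ℝ)) : ℂ)).re) := by
  rw [EE, Complex.norm_exp]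
  congr 1
  rw [Complex.sub_re]
  simp [mul_comm]

lemma norm_le_aux (u v : ℝ) (hu : 0 ≤ u) (hv : 0 ≤ v) : ‖(u : ℂ) + ((-v : ℝ) : ℂ) * Complex.I‖ ≤ u + v := by
  refine (norm_add_le _ _).trans ?_
  simp [abs_of_nonneg hu, abs_of_nonneg hv]

lemma norm_ray (k : ℕ) (β Δ y u : ℝ) (hΔ0 : 0 ≤ Δ) (hΔ : Δ ≤ 1) (hy : 2 ≤ y) (hu : 0 ≤ u)
    (hτ : |β * Real.tan (Real.pi * Δ / 2)| ≤ 1 / 2) :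
    ‖WW k β Δ y ((u : ℂ) + ((-(y / 2) : ℝ) : ℂ) * Complex.I)‖ ≤
      (y / 2) ^ k * Real.exp (-(y ^ 2) / 4 + |β * Real.tan (Real.pi * Δ / 2)| * y ^ 2 / 4) *
        ((k.factorial : ℝ) * Real.exp 1 * ((y ^ (-Δ) / 4)⁻¹) ^ k * Real.exp (-(y ^ (-Δ) / 4 * u))) := by
  set τ := |β * Real.tan (Real.pi * Δ / 2)| with hτd
  have hτ0 : 0 ≤ τ := abs_nonneg _
  set z : ℂ := (u : ℂ) + ((-(y / 2) : ℝ) : ℂ) * Complex.I with hz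
  have hzre : z.re = u := by simp [hz]
  have hzim : z.im = -(y / 2) := by simp [hz]
  have hz1 : 1 ≤ ‖z‖ := by
    have := Complex.abs_im_le_norm z
    rw [hzim, abs_neg, abs_of_nonneg (by linarith)] at this
    linarith
  have hz0 : z ≠ 0 := by
    intro h; rw [h] at hz1; simp at hz1; linarith
  have hzle : ‖z‖ ≤ u + y / 2 := norm_le_aux u (y / 2) hu (by linarith)
  have hzle2 : ‖z‖ ≤ (1 + u) * y := by nlinarith
  have hb := re_bound β Δ hΔ0 (by linarith) z hz0 (by rw [hzre]; exact hu)
  rw [hzre, hzim, ← hτd] at hb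
  set κ := y ^ (-Δ) / 4 with hκ
  have hy0 : 0 < y := by linarith
  have hκ0 : 0 < κ := by positivity
  have hyle : y ^ (-Δ) ≤ 1 := Real.rpow_le_one_of_one_le_of_nonpos (by linarith) (by linarith)
  have hz2 : ‖z‖ ^ (-Δ) ≤ 1 := Real.rpow_le_one_of_one_le_of_nonpos hz1 (by linarith)
  have hz20 : 0 < ‖z‖ ^ (-Δ) := Real.rpow_pos_of_pos (by linarith) _
  have hz3 : y ^ (-Δ) * (u - 1) ≤ ‖z‖ ^ (-Δ) * u ^ 2 := by
    have h1 : (1 + u) ^ (-Δ) * y ^ (-Δ) ≤ ‖z‖ ^ (-Δ) := by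
      rw [← Real.mul_rpow (by linarith) hy0.le]
      exact Real.rpow_le_rpow_of_nonpos (by linarith) hzle2 (by linarith)
    have h2 : (1 + u) ^ (-1 : ℝ) ≤ (1 + u) ^ (-Δ) :=
      Real.rpow_le_rpow_of_exponent_le (by linarith) (by linarith)
    have h3 : u - 1 ≤ (1 + u) ^ (-1 : ℝ) * u ^ 2 := by
      rw [Real.rpow_neg_one, inv_mul_eq_div, le_div_iff₀ (by linarith)]; nlinarith
    calc y ^ (-Δ) * (u - 1) ≤ y ^ (-Δ) * ((1 + u) ^ (-1 : ℝ) * u ^ 2) := by gcongr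
      _ ≤ y ^ (-Δ) * ((1 + u) ^ (-Δ) * u ^ 2) := by gcongr
      _ = (1 + u) ^ (-Δ) * y ^ (-Δ) * u ^ 2 := by ring
      _ ≤ _ := by gcongr
  have hEE : ‖EE β Δ y z‖ ≤ Real.exp (-(y ^ 2) / 4 + τ * y ^ 2 / 4) * Real.exp (2 * κ * (1 - u)) := by
    rw [norm_EE, ← Real.exp_add, hzim]
    apply Real.exp_le_exp.mpr
    have h4 : ‖z‖ ^ (-Δ) * u ^ 2 / 2 - (1 + τ) * (y / 2) ^ 2 ≤
        ‖z‖ ^ (-Δ) * (u ^ 2 - (-(y / 2)) ^ 2 - τ * (u ^ 2 + (-(y / 2)) ^ 2)) := by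
      have h5 : ‖z‖ ^ (-Δ) * ((1 + τ) * (y / 2) ^ 2) ≤ 1 * ((1 + τ) * (y / 2) ^ 2) := by gcongr
      have h6 : ‖z‖ ^ (-Δ) * u ^ 2 * τ ≤ ‖z‖ ^ (-Δ) * u ^ 2 * (1 / 2) := by gcongr
      nlinarith
    have h7 : 2 * κ * (1 - u) = - (y ^ (-Δ) * (u - 1)) / 2 := by rw [hκ]; ring
    rw [h7]
    nlinarith
  have hw : ‖(-(Complex.I * z)) ^ k‖ ≤ (y / 2) ^ k * (1 + u) ^ k := by
    rw [norm_pow, norm_neg, norm_mul, Complex.norm_I, one_mul, ← mul_pow]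
    apply pow_le_pow_left₀ (norm_nonneg _)
    nlinarith
  have hf : (1 + u) ^ k ≤ (k.factorial : ℝ) * (κ⁻¹) ^ k * Real.exp (κ * (1 + u)) := by
    have h := Real.pow_div_factorial_le_exp (κ * (1 + u)) (by positivity) k
    rw [div_le_iff₀ (by positivity), mul_pow] at h
    rw [inv_pow, mul_right_comm, ← div_eq_mul_inv, le_div_iff₀ (by positivity)]
    linarith
  rw [WW, norm_mul]
  calc _ ≤ ((y / 2) ^ k * (1 + u) ^ k) *
        (Real.exp (-(y ^ 2) / 4 + τ * y ^ 2 / 4) * Real.exp (2 * κ * (1 - u))) := by gcongr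
    _ ≤ ((y / 2) ^ k * ((k.factorial : ℝ) * (κ⁻¹) ^ k * Real.exp (κ * (1 + u)))) *
        (Real.exp (-(y ^ 2) / 4 + τ * y ^ 2 / 4) * Real.exp (2 * κ * (1 - u))) := by gcongr
    _ = (y / 2) ^ k * Real.exp (-(y ^ 2) / 4 + τ * y ^ 2 / 4) * ((k.factorial : ℝ) * (κ⁻¹) ^ k *
        Real.exp (3 * κ - κ * u)) := by
          have : Real.exp (3 * κ - κ * u) = Real.exp (κ * (1 + u)) * Real.exp (2 * κ * (1 - u)) := by
            rw [← Real.exp_add]; congr 1; ring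
          rw [this]; ring
    _ ≤ (y / 2) ^ k * Real.exp (-(y ^ 2) / 4 + τ * y ^ 2 / 4) * ((k.factorial : ℝ) * (κ⁻¹) ^ k *
        (Real.exp 1 * Real.exp (-(κ * u)))) := by
          have : Real.exp (3 * κ - κ * u) ≤ Real.exp 1 * Real.exp (-(κ * u)) := by
            rw [← Real.exp_add]; apply Real.exp_le_exp.mpr; linarith
          gcongr
    _ = _ := by ring

/-- The integral along the horizontal ray. -/
noncomputable def Ray (k : ℕ) (β Δ y : ℝ) : ℂ :=
  ∫ u in Ioi (0 : ℝ), WW k β Δ y ((u : ℂ) + ((-(y / 2) : ℝ) : ℂ) * Complex.I)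

lemma aesm_ray (k : ℕ) (β Δ y : ℝ) (hΔ : Δ ≤ 1) :
    AEStronglyMeasurable (fun u : ℝ => WW k β Δ y ((u : ℂ) + ((-(y / 2) : ℝ) : ℂ) * Complex.I))
      (volume.restrict (Ioi 0)) := by
  apply ContinuousOn.aestronglyMeasurable _ measurableSet_Ioi
  intro t ht
  apply ContinuousAt.continuousWithinAt
  have ht : 0 < t := ht
  exact ContinuousAt.comp (f := fun u : ℝ => ((u : ℂ) + ((-(y / 2) : ℝ) : ℂ) * Complex.I))
    (continuousAt_WW k β Δ y (by linarith) _ (by simpa using ht.le)) (by fun_prop)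

lemma integrable_ray (k : ℕ) (β Δ y : ℝ) (hΔ0 : 0 ≤ Δ) (hΔ : Δ ≤ 1) (hy : 2 ≤ y)
    (hτ : |β * Real.tan (Real.pi * Δ / 2)| ≤ 1 / 2) :
    IntegrableOn (fun u : ℝ => WW k β Δ y ((u : ℂ) + ((-(y / 2) : ℝ) : ℂ) * Complex.I)) (Ioi 0) := by
  have hκ : 0 < y ^ (-Δ) / 4 := by
    have : 0 < y ^ (-Δ) := Real.rpow_pos_of_pos (by linarith) _
    linarith
  refine Integrable.mono' (g := fun u : ℝ => (y / 2) ^ k * Real.exp (-(y ^ 2) / 4 + |β * Real.tan (Real.pi * Δ / 2)| * y ^ 2 / 4) *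
        ((k.factorial : ℝ) * Real.exp 1 * ((y ^ (-Δ) / 4)⁻¹) ^ k * Real.exp (-(y ^ (-Δ) / 4 * u))))
    ?_ (aesm_ray k β Δ y hΔ) ?_
  · apply Integrable.const_mul
    apply Integrable.const_mul
    have := exp_neg_integrableOn_Ioi 0 hκ
    simp only [neg_mul] at this
    exact this
  · filter_upwards [ae_restrict_mem measurableSet_Ioi] with u hu
    exact norm_ray k β Δ y u hΔ0 hΔ hy (le_of_lt hu) hτ

lemma norm_Ray (k : ℕ) (β Δ y : ℝ) (hΔ0 : 0 ≤ Δ) (hΔ : Δ ≤ 1) (hy : 2 ≤ y)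
    (hτ : |β * Real.tan (Real.pi * Δ / 2)| ≤ 1 / 2) :
    ‖Ray k β Δ y‖ ≤ (y / 2) ^ k * Real.exp (-(y ^ 2) / 4 + |β * Real.tan (Real.pi * Δ / 2)| * y ^ 2 / 4) *
        ((k.factorial : ℝ) * Real.exp 1 * ((y ^ (-Δ) / 4)⁻¹) ^ (k + 1)) := by
  have hκ : 0 < y ^ (-Δ) / 4 := by
    have : 0 < y ^ (-Δ) := Real.rpow_pos_of_pos (by linarith) _
    linarith
  have hIntg : IntegrableOn (fun u : ℝ => Real.exp (-(y ^ (-Δ) / 4 * u))) (Ioi 0) := by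
    have := exp_neg_integrableOn_Ioi 0 hκ
    simpa [neg_mul] using this
  have hval : ∫ u in Ioi (0 : ℝ), Real.exp (-(y ^ (-Δ) / 4 * u)) = (y ^ (-Δ) / 4)⁻¹ := by
    have := integral_exp_mul_Ioi (a := -(y ^ (-Δ) / 4)) (by linarith) 0
    simp only [neg_mul] at this
    rw [this]; simp [neg_div_neg_eq]
  refine (norm_integral_le_of_norm_le (g := fun u : ℝ => (y / 2) ^ k * Real.exp (-(y ^ 2) / 4 + |β * Real.tan (Real.pi * Δ / 2)| * y ^ 2 / 4) *
        ((k.factorial : ℝ) * Real.exp 1 * ((y ^ (-Δ) / 4)⁻¹) ^ k * Real.exp (-(y ^ (-Δ) / 4 * u))))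
    ((hIntg.const_mul _).const_mul _) ?_).trans ?_
  · filter_upwards [ae_restrict_mem measurableSet_Ioi] with u hu
    exact norm_ray k β Δ y u hΔ0 hΔ hy (le_of_lt hu) hτ
  · rw [integral_const_mul, integral_const_mul, hval, pow_succ]
    apply le_of_eq; ring

lemma vert_bound (k : ℕ) (β Δ y N v : ℝ) (hΔ0 : 0 ≤ Δ) (hΔ : Δ ≤ 1) (hy : 2 ≤ y)
    (hτ : |β * Real.tan (Real.pi * Δ / 2)| ≤ 1 / 2) (hN : 2 * y ≤ N) (hv0 : 0 ≤ v) (hv : v ≤ y / 2) :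
    ‖WW k β Δ y ((N : ℂ) + ((-v : ℝ) : ℂ) * Complex.I)‖ ≤ (2 * N) ^ k * Real.exp (-(1 / 8 * N)) := by
  set τ := |β * Real.tan (Real.pi * Δ / 2)| with hτd
  have hτ0 : 0 ≤ τ := abs_nonneg _
  set z : ℂ := (N : ℂ) + ((-v : ℝ) : ℂ) * Complex.I with hz
  have hzre : z.re = N := by simp [hz]
  have hzim : z.im = -v := by simp [hz]
  have hz1 : N ≤ ‖z‖ := by
    have := Complex.abs_re_le_norm z
    rw [hzre, abs_of_nonneg (by linarith)] at this
    linarith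
  have hz0 : z ≠ 0 := by
    intro h; rw [h] at hz1; simp at hz1; linarith
  have hzle : ‖z‖ ≤ 2 * N := (norm_le_aux N v (by linarith) hv0).trans (by linarith)
  have hb := re_bound β Δ hΔ0 (by linarith) z hz0 (by rw [hzre]; linarith)
  rw [hzre, hzim, ← hτd] at hb
  have h1 : (2 * N)⁻¹ ≤ ‖z‖ ^ (-Δ) := by
    calc (2 * N)⁻¹ ≤ ‖z‖⁻¹ := by
          apply inv_anti₀ (by linarith) hzle
      _ = ‖z‖ ^ (-1 : ℝ) := (Real.rpow_neg_one _).symm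
      _ ≤ _ := Real.rpow_le_rpow_of_exponent_le (by linarith) (by linarith)
  have h2 : N ^ 2 / 4 ≤ N ^ 2 - (-v) ^ 2 - τ * (N ^ 2 + (-v) ^ 2) := by
    have : τ * (N ^ 2 + (-v) ^ 2) ≤ 1 / 2 * (N ^ 2 + (-v) ^ 2) := by gcongr
    nlinarith
  have h3 : N / 8 ≤ (cPar β Δ * z ^ (((2 - Δ : ℝ)) : ℂ)).re := by
    calc N / 8 = (2 * N)⁻¹ * (N ^ 2 / 4) := by
          have : N ≠ 0 := by linarith
          field_simp; norm_num
      _ ≤ ‖z‖ ^ (-Δ) * (N ^ 2 / 4) := by gcongr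
      _ ≤ _ := le_trans (by gcongr) hb
  rw [WW, norm_mul, norm_EE]
  have hw : ‖(-(Complex.I * z)) ^ k‖ ≤ (2 * N) ^ k := by
    rw [norm_pow, norm_neg, norm_mul, Complex.norm_I, one_mul]
    exact pow_le_pow_left₀ (norm_nonneg _) hzle _
  have hN0 : 0 ≤ 2 * N := by linarith
  have he : Real.exp (y * z.im - (cPar β Δ * z ^ (((2 - Δ : ℝ)) : ℂ)).re) ≤ Real.exp (-(1 / 8 * N)) := by
    apply Real.exp_le_exp.mpr
    rw [hzim]; nlinarith
  exact mul_le_mul hw he (Real.exp_pos _).le (pow_nonneg hN0 _)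

lemma contour (k : ℕ) (β Δ y : ℝ) (hΔ0 : 0 ≤ Δ) (hΔ : Δ < 1) (hy : 2 ≤ y)
    (hτ : |β * Real.tan (Real.pi * Δ / 2)| ≤ 1 / 2) :
    JJ k β Δ y = Ray k β Δ y +
      Complex.I * ∫ v in (0 : ℝ)..(-(y / 2)), WW k β Δ y ((v : ℂ) * Complex.I) := by
  have hrect : ∀ N : ℝ, 0 < N →
      (∫ x in (0 : ℝ)..N, WW k β Δ y (x : ℂ)) -
        (∫ x in (0 : ℝ)..N, WW k β Δ y ((x : ℂ) + ((-(y / 2) : ℝ) : ℂ) * Complex.I)) +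
        Complex.I * (∫ v in (0 : ℝ)..(-(y / 2)), WW k β Δ y ((N : ℂ) + (v : ℂ) * Complex.I)) -
        Complex.I * (∫ v in (0 : ℝ)..(-(y / 2)), WW k β Δ y ((v : ℂ) * Complex.I)) = 0 := by
    intro N hN
    have h := Complex.integral_boundary_rect_eq_zero_of_continuousOn_of_differentiableOn
      (WW k β Δ y) 0 ((N : ℂ) + ((-(y / 2) : ℝ) : ℂ) * Complex.I) ?_ ?_
    · simpa only [Complex.zero_re, Complex.zero_im, Complex.add_re, Complex.add_im, Complex.ofReal_re,
        Complex.ofReal_im, Complex.mul_re, Complex.mul_im, Complex.I_re, Complex.I_im, mul_zero,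
        mul_one, zero_mul, sub_zero, add_zero, zero_add, Complex.ofReal_zero, smul_eq_mul] using h
    · intro z hz
      apply ContinuousAt.continuousWithinAt
      apply continuousAt_WW k β Δ y (by linarith)
      have := hz.1
      simp only [Complex.zero_re, Complex.add_re, Complex.ofReal_re, Complex.mul_re, Complex.I_re,
        mul_zero, Complex.ofReal_im, Complex.I_im, mul_one, sub_zero, add_zero, zero_mul] at this
      rw [mem_preimage, uIcc_of_le hN.le] at this
      exact this.1
    · intro z hz
      apply DifferentiableAt.differentiableWithinAt
      have := hz.1
      simp only [Complex.zero_re, Complex.add_re, Complex.ofReal_re, Complex.mul_re, Complex.I_re,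
        mul_zero, Complex.ofReal_im, Complex.I_im, mul_one, sub_zero, add_zero, zero_mul] at this
      rw [mem_preimage, min_eq_left hN.le] at this
      have hs : z ∈ Complex.slitPlane := Or.inl this.1
      unfold WW EE
      have h1 : DifferentiableAt ℂ (fun z : ℂ => z ^ (((2 - Δ : ℝ)) : ℂ)) z :=
        differentiableAt_id.cpow_const hs
      fun_prop
  have h1 := intervalIntegral_tendsto_integral_Ioi 0 (integrable_WW k β Δ y hΔ) tendsto_id
  have h2 := intervalIntegral_tendsto_integral_Ioi 0 (integrable_ray k β Δ y hΔ0 hΔ.le hy hτ) tendsto_id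
  have h3 : Tendsto (fun N : ℝ => ∫ v in (0 : ℝ)..(-(y / 2)), WW k β Δ y ((N : ℂ) + (v : ℂ) * Complex.I))
      atTop (𝓝 0) := by
    have hlim : Tendsto (fun N : ℝ => ((2 * N) ^ k * Real.exp (-(1 / 8 * N))) * |(-(y / 2)) - 0|) atTop (𝓝 0) := by
      have := Real.tendsto_pow_mul_exp_neg_atTop_nhds_zero k
      have hc : Tendsto (fun N : ℝ => 1 / 8 * N) atTop atTop :=
        tendsto_id.const_mul_atTop (by norm_num)
      have h4 := ((this.comp hc).const_mul (16 ^ k)).mul_const |(-(y / 2)) - 0|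
      simp only [mul_zero, zero_mul] at h4
      refine h4.congr ?_
      intro N
      simp only [Function.comp]
      rw [← mul_assoc, ← mul_pow]; ring_nf
    refine squeeze_zero_norm' ?_ hlim
    filter_upwards [eventually_ge_atTop (2 * y)] with N hN
    apply intervalIntegral.norm_integral_le_of_norm_le_const
    intro v hv
    rw [uIoc_of_ge (by linarith)] at hv
    have := vert_bound k β Δ y N (-v) hΔ0 hΔ.le hy hτ hN (by linarith [hv.2]) (by linarith [hv.1])
    simpa using this
  have h5 := ((h1.sub h2).add (h3.const_mul Complex.I)).sub_const
    (Complex.I * (∫ v in (0 : ℝ)..(-(y / 2)), WW k β Δ y ((v : ℂ) * Complex.I)))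
  have h6 := tendsto_nhds_unique (h5.congr' (by
    filter_upwards [eventually_gt_atTop 0] with N hN
    exact hrect N hN)) tendsto_const_nhds
  unfold JJ Ray
  linear_combination h6

open MeasureTheory Filter Set Topology Real

/-- The joint filter: the parameter tends to zero from the right, the point tends to infinity. -/
noncomputable abbrev LL : Filter (ℝ × ℝ) := (𝓝[>] (0 : ℝ)) ×ˢ (atTop : Filter ℝ)

lemma LL_pos : ∀ᶠ p : ℝ × ℝ in LL, 0 < p.1 :=
  (tendsto_fst (f := 𝓝[>] (0 : ℝ)) (g := (atTop : Filter ℝ))).eventually self_mem_nhdsWithin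

lemma LL_fst : Tendsto (fun p : ℝ × ℝ => p.1) LL (𝓝 0) :=
  (tendsto_fst (f := 𝓝[>] (0 : ℝ)) (g := (atTop : Filter ℝ))).mono_right nhdsWithin_le_nhds

lemma LL_snd : Tendsto (fun p : ℝ × ℝ => p.2) LL atTop := tendsto_snd

lemma LL_lt {η : ℝ} (hη : 0 < η) : ∀ᶠ p : ℝ × ℝ in LL, p.1 < η := LL_fst.eventually_lt_const hη

lemma LL_gt (Y : ℝ) : ∀ᶠ p : ℝ × ℝ in LL, Y < p.2 := LL_snd.eventually_gt_atTop Y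

/-- real coefficient on the imaginary axis -/
noncomputable def aPar (β Δ : ℝ) : ℝ :=
  Real.cos (Real.pi * Δ / 2) - β * Real.tan (Real.pi * Δ / 2) * Real.sin (Real.pi * Δ / 2)

/-- imaginary coefficient on the imaginary axis -/
noncomputable def bPar (β Δ : ℝ) : ℝ := (1 + β) * Real.sin (Real.pi * Δ / 2)

/-- Contribution of the vertical segment. -/
noncomputable def Seg (k : ℕ) (β Δ y : ℝ) : ℝ :=
  (Complex.I * ∫ v in (0 : ℝ)..(-(y / 2)), WW k β Δ y ((v : ℂ) * Complex.I)).re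

lemma cos_pos' {Δ : ℝ} (h0 : 0 < Δ) (h1 : Δ < 1) : 0 < Real.cos (Real.pi * Δ / 2) := by
  apply Real.cos_pos_of_mem_Ioo
  constructor <;> nlinarith [Real.pi_pos]

lemma WW_axis (k : ℕ) (β Δ y s : ℝ) (h0 : 0 < Δ) (h1 : Δ < 1) (hs : 0 < s) :
    (-(Complex.I * WW k β Δ y (((-s : ℝ) : ℂ) * Complex.I))).re =
      (-1) ^ k * (s ^ k * Real.exp (-(y * s) + aPar β Δ * s ^ (2 - Δ)) *
        Real.sin (bPar β Δ * s ^ (2 - Δ))) := by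
  have hc := (cos_pos' h0 h1).ne'
  have hz : (((-s : ℝ) : ℂ) * Complex.I) = (s : ℂ) * (-Complex.I) := by push_cast; ring
  have hI : -Complex.I ≠ 0 := neg_ne_zero.mpr Complex.I_ne_zero
  have hz0 : (s : ℂ) * (-Complex.I) ≠ 0 :=
    mul_ne_zero (by exact_mod_cast hs.ne') hI
  have hpow : ((s : ℂ) * (-Complex.I)) ^ (((2 - Δ : ℝ)) : ℂ) = ((s ^ (2 - Δ) : ℝ) : ℂ) *
      (-((Real.cos (Real.pi * Δ / 2) : ℝ) : ℂ) - ((Real.sin (Real.pi * Δ / 2) : ℝ) : ℂ) * Complex.I) := by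
    have e1 : Real.cos (Real.pi * Δ / 2) = - Real.cos (-(Real.pi - Real.pi * Δ / 2)) := by
      rw [Real.cos_neg, Real.cos_pi_sub]; ring
    have e2 : Real.sin (Real.pi * Δ / 2) = - Real.sin (-(Real.pi - Real.pi * Δ / 2)) := by
      rw [Real.sin_neg, Real.sin_pi_sub]; ring
    have e3 : (-((Real.cos (Real.pi * Δ / 2) : ℝ) : ℂ) - ((Real.sin (Real.pi * Δ / 2) : ℝ) : ℂ) * Complex.I)
        = Complex.exp (((-(Real.pi - Real.pi * Δ / 2) : ℝ) : ℂ) * Complex.I) := by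
      rw [Complex.exp_mul_I, ← Complex.ofReal_cos, ← Complex.ofReal_sin, e1, e2]; push_cast; ring
    rw [e3, Complex.cpow_def_of_ne_zero hz0, Complex.log_ofReal_mul hs hI, Complex.log_neg_I,
      Real.rpow_def_of_pos hs, Complex.ofReal_exp, ← Complex.exp_add]
    congr 1; push_cast; ring
  have hexp : EE β Δ y ((s : ℂ) * (-Complex.I)) =
      Complex.exp (((-(y * s) + aPar β Δ * s ^ (2 - Δ) : ℝ) : ℂ) +
        ((bPar β Δ * s ^ (2 - Δ) : ℝ) : ℂ) * Complex.I) := by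
    rw [EE, hpow]
    congr 1
    have ht : Real.tan (Real.pi * Δ / 2) * Real.cos (Real.pi * Δ / 2) = Real.sin (Real.pi * Δ / 2) :=
      Real.tan_mul_cos hc
    have ht' : ((Real.tan (Real.pi * Δ / 2) : ℝ) : ℂ) * ((Real.cos (Real.pi * Δ / 2) : ℝ) : ℂ) =
        ((Real.sin (Real.pi * Δ / 2) : ℝ) : ℂ) := by exact_mod_cast ht
    simp only [cPar, aPar, bPar, Complex.ofReal_add, Complex.ofReal_mul, Complex.ofReal_sub,
      Complex.ofReal_neg, Complex.ofReal_one]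
    linear_combination ((s : ℂ) * y + (β : ℂ) * ((Real.tan (Real.pi * Δ / 2) : ℝ) : ℂ) *
      ((s ^ (2 - Δ) : ℝ) : ℂ) * ((Real.sin (Real.pi * Δ / 2) : ℝ) : ℂ)) * Complex.I_sq +
      ((β : ℂ) * ((s ^ (2 - Δ) : ℝ) : ℂ) * Complex.I) * ht'
  rw [hz, WW, hexp]
  have hw : -(Complex.I * ((s : ℂ) * (-Complex.I))) = ((-s : ℝ) : ℂ) := by
    push_cast; linear_combination (s : ℂ) * Complex.I_sq
  rw [hw, Complex.exp_add, Complex.exp_mul_I, ← Complex.ofReal_exp, ← Complex.ofReal_cos,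
    ← Complex.ofReal_sin, ← Complex.ofReal_pow, neg_pow s k]
  simp only [Complex.neg_re, Complex.mul_re, Complex.mul_im, Complex.I_re, Complex.I_im,
    Complex.ofReal_re, Complex.ofReal_im, Complex.add_re, Complex.add_im]
  ring

/-- normalized segment integrand -/
noncomputable def segF (k : ℕ) (β : ℝ) (p : ℝ × ℝ) (u : ℝ) : ℝ :=
  (Iic (p.2 ^ 2 / 2)).indicator (fun u : ℝ => u ^ k * Real.exp (-u + aPar β p.1 * (u / p.2) ^ (2 - p.1)) *
    Real.sinc (bPar β p.1 * (u / p.2) ^ (2 - p.1)) * u ^ (2 - p.1)) u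

lemma sin_eq_sinc (x : ℝ) : Real.sin x = x * Real.sinc x := by
  by_cases h : x = 0
  · simp [h]
  · rw [Real.sinc_of_ne_zero h]; field_simp

lemma Seg_eq (k : ℕ) (β Δ y : ℝ) (h0 : 0 < Δ) (h1 : Δ < 1) (hy : 0 < y) :
    Seg k β Δ y = (-1) ^ k * bPar β Δ * y ^ (Δ - 3 - k) * ∫ u in Ioi (0 : ℝ), segF k β (Δ, y) u := by
  have hstep1 : Seg k β Δ y = ∫ s in (0 : ℝ)..(y / 2), (-1) ^ k * (s ^ k *
      Real.exp (-(y * s) + aPar β Δ * s ^ (2 - Δ)) * Real.sin (bPar β Δ * s ^ (2 - Δ))) := by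
    have e1 : Complex.I * (∫ v in (0 : ℝ)..(-(y / 2)), WW k β Δ y ((v : ℂ) * Complex.I)) =
        ∫ s in (0 : ℝ)..(y / 2), -(Complex.I * WW k β Δ y (((-s : ℝ) : ℂ) * Complex.I)) := by
      have := intervalIntegral.integral_comp_neg (a := 0) (b := y / 2)
        (fun v : ℝ => WW k β Δ y ((v : ℂ) * Complex.I))
      rw [intervalIntegral.integral_neg, intervalIntegral.integral_const_mul, this,
        neg_zero, intervalIntegral.integral_symm 0 (-(y/2))]
      simp
    rw [Seg, e1]
    have hIntg : IntervalIntegrable (fun s : ℝ => -(Complex.I * WW k β Δ y (((-s : ℝ) : ℂ) * Complex.I)))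
        volume 0 (y / 2) := by
      apply Continuous.intervalIntegrable
      apply Continuous.neg
      apply Continuous.mul continuous_const
      rw [continuous_iff_continuousAt]
      intro s
      exact ContinuousAt.comp (f := fun s : ℝ => (((-s : ℝ) : ℂ) * Complex.I))
        (continuousAt_WW k β Δ y (by linarith) _ (by simp)) (by fun_prop)
    have := Complex.reCLM.intervalIntegral_comp_comm hIntg
    simp only [Complex.reCLM_apply] at this
    rw [← this]
    apply intervalIntegral.integral_congr_ae
    filter_upwards with s hs
    rw [uIoc_of_le (by linarith)] at hs
    exact WW_axis k β Δ y s h0 h1 hs.1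
  have hstep2 := intervalIntegral.integral_comp_div (a := 0) (b := y ^ 2 / 2) (c := y)
    (fun s : ℝ => (-1) ^ k * (s ^ k *
      Real.exp (-(y * s) + aPar β Δ * s ^ (2 - Δ)) * Real.sin (bPar β Δ * s ^ (2 - Δ)))) hy.ne'
  have hb : y ^ 2 / 2 / y = y / 2 := by field_simp
  rw [hb, zero_div, smul_eq_mul, ← hstep1] at hstep2
  have hstep3 : ∫ u in Ioi (0 : ℝ), segF k β (Δ, y) u = ∫ u in (0 : ℝ)..(y ^ 2 / 2),
      u ^ k * Real.exp (-u + aPar β Δ * (u / y) ^ (2 - Δ)) *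
        Real.sinc (bPar β Δ * (u / y) ^ (2 - Δ)) * u ^ (2 - Δ) := by
    unfold segF
    rw [setIntegral_indicator measurableSet_Iic, Ioi_inter_Iic,
      intervalIntegral.integral_of_le (by positivity)]
  have hS : Seg k β Δ y = y⁻¹ * (y * Seg k β Δ y) := by field_simp
  rw [hS, ← hstep2, hstep3, ← intervalIntegral.integral_const_mul, ← intervalIntegral.integral_const_mul]
  apply intervalIntegral.integral_congr_ae
  filter_upwards with u hu
  rw [uIoc_of_le (by positivity)] at hu
  have hu0 : 0 < u := hu.1
  rw [sin_eq_sinc]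
  have e2 : y * (u / y) = u := by field_simp
  have e3 : y ^ (Δ - 3 - (k : ℝ)) = y⁻¹ * (y ^ k)⁻¹ * y ^ (-(2 - Δ)) := by
    rw [← Real.rpow_natCast, ← Real.rpow_neg hy.le, ← Real.rpow_neg_one, ← Real.rpow_add hy,
      ← Real.rpow_add hy]
    congr 1; ring
  have e4 : (u / y) ^ (2 - Δ) = u ^ (2 - Δ) * y ^ (-(2 - Δ)) := by
    rw [Real.div_rpow hu0.le hy.le, Real.rpow_neg hy.le]; rfl
  rw [e2, e3, div_pow]
  generalize hX : Real.sinc (bPar β Δ * (u / y) ^ (2 - Δ)) = X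
  generalize hZ : Real.exp (-u + aPar β Δ * (u / y) ^ (2 - Δ)) = Z
  rw [e4]
  ring

lemma integrable_poly_exp (k : ℕ) {b : ℝ} (hb : 0 < b) :
    IntegrableOn (fun u : ℝ => u ^ k * Real.exp (-(b * u))) (Ioi 0) := by
  have := integrableOn_rpow_mul_exp_neg_mul_rpow (p := 1) (s := (k : ℝ)) (b := b)
    (by have : (0:ℝ) ≤ k := Nat.cast_nonneg k
        linarith) one_pos hb
  refine this.congr_fun ?_ measurableSet_Ioi
  intro t ht
  simp

lemma aPar_tendsto (β : ℝ) : Tendsto (fun p : ℝ × ℝ => aPar β p.1) LL (𝓝 1) := by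
  have h : ContinuousAt (fun Δ => aPar β Δ) 0 := by
    unfold aPar
    have : ContinuousAt (fun Δ : ℝ => Real.tan (Real.pi * Δ / 2)) 0 := by
      apply ContinuousAt.comp (g := Real.tan)
      · exact Real.continuousAt_tan.mpr (by simp)
      · fun_prop
    fun_prop
  have h2 : Tendsto (fun Δ => aPar β Δ) (𝓝 0) (𝓝 1) := by
    have := h.tendsto
    simpa [aPar] using this
  exact h2.comp LL_fst

lemma bPar_tendsto (β : ℝ) : Tendsto (fun p : ℝ × ℝ => bPar β p.1) LL (𝓝 0) := by
  have h : ContinuousAt (fun Δ => bPar β Δ) 0 := by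
    unfold bPar
    fun_prop
  have h2 : Tendsto (fun Δ => bPar β Δ) (𝓝 0) (𝓝 0) := by
    have := h.tendsto
    simpa [bPar] using this
  exact h2.comp LL_fst

lemma tan_tendsto (β : ℝ) : Tendsto (fun p : ℝ × ℝ => |β * Real.tan (Real.pi * p.1 / 2)|) LL (𝓝 0) := by
  have h : ContinuousAt (fun Δ : ℝ => |β * Real.tan (Real.pi * Δ / 2)|) 0 := by
    have : ContinuousAt (fun Δ : ℝ => Real.tan (Real.pi * Δ / 2)) 0 := by
      apply ContinuousAt.comp (g := Real.tan)
      · exact Real.continuousAt_tan.mpr (by simp)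
      · fun_prop
    fun_prop
  have h2 : Tendsto (fun Δ : ℝ => |β * Real.tan (Real.pi * Δ / 2)|) (𝓝 0) (𝓝 0) := by
    have := h.tendsto
    simpa using this
  exact h2.comp LL_fst

lemma rpow_le_sq_add_one (s Δ : ℝ) (hs : 0 ≤ s) (h0 : 0 ≤ Δ) (h1 : Δ ≤ 1) : s ^ (2 - Δ) ≤ s ^ 2 + 1 := by
  rcases le_total s 1 with h | h
  · have := Real.rpow_le_one hs h (by linarith : 0 ≤ 2 - Δ)
    nlinarith
  · have := Real.rpow_le_rpow_of_exponent_le h (by linarith : 2 - Δ ≤ 2)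
    rw [Real.rpow_two] at this
    linarith

lemma segF_tendsto (k : ℕ) (β : ℝ) :
    Tendsto (fun p : ℝ × ℝ => ∫ u in Ioi (0 : ℝ), segF k β p u) LL (𝓝 ((k + 2).factorial : ℝ)) := by
  have hval : ∫ u in Ioi (0 : ℝ), u ^ k * Real.exp (-u) * u ^ (2 : ℝ) = ((k + 2).factorial : ℝ) := by
    rw [← Real.Gamma_nat_eq_factorial, Real.Gamma_eq_integral (by positivity)]
    apply setIntegral_congr_fun measurableSet_Ioi
    intro u hu
    have hu : 0 < u := hu
    have : u ^ (((k + 2 : ℕ) : ℝ) + 1 - 1) = u ^ (k + 2) := by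
      rw [add_sub_cancel_right, Real.rpow_natCast]
    simp only [this, Real.rpow_two]; ring
  rw [← hval]
  apply tendsto_integral_filter_of_dominated_convergence
    (fun u : ℝ => Real.exp (3 / 2) * (u ^ k * Real.exp (-(1 / 4 * u)) + u ^ (k + 2) * Real.exp (-(1 / 4 * u))))
  · refine Eventually.of_forall fun p => ?_
    unfold segF
    apply Measurable.aestronglyMeasurable
    apply Measurable.indicator _ measurableSet_Iic
    have := Real.continuous_sinc.measurable
    fun_prop
  · have ha : ∀ᶠ p : ℝ × ℝ in LL, aPar β p.1 < 3 / 2 := (aPar_tendsto β).eventually_lt_const (by norm_num)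
    filter_upwards [LL_pos, LL_lt one_pos, LL_gt 1, ha] with p h0 h1 hy ha
    filter_upwards [ae_restrict_mem measurableSet_Ioi] with u hu
    have hu : 0 < u := hu
    have hy0 : 0 < p.2 := by linarith
    unfold segF
    rw [indicator_apply]
    split_ifs with hmem
    · have hmem : u ≤ p.2 ^ 2 / 2 := hmem
      have hw := rpow_le_sq_add_one (u / p.2) p.1 (by positivity) h0.le h1.le
      have hw0 : 0 ≤ (u / p.2) ^ (2 - p.1) := by positivity
      have hw2 : (u / p.2) ^ 2 ≤ u / 2 := by
        rw [div_pow, div_le_iff₀ (by positivity)]; nlinarith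
      have hexp : Real.exp (-u + aPar β p.1 * (u / p.2) ^ (2 - p.1)) ≤ Real.exp (3 / 2) * Real.exp (-(1 / 4 * u)) := by
        rw [← Real.exp_add]
        apply Real.exp_le_exp.mpr
        nlinarith
      have hup := rpow_le_sq_add_one u p.1 hu.le h0.le h1.le
      have hup0 : 0 ≤ u ^ (2 - p.1) := by positivity
      rw [norm_mul, norm_mul, norm_mul, Real.norm_of_nonneg hup0, Real.norm_of_nonneg (Real.exp_pos _).le,
        Real.norm_of_nonneg (by positivity : (0:ℝ) ≤ u ^ k), Real.norm_eq_abs]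
      have hs := Real.abs_sinc_le_one (bPar β p.1 * (u / p.2) ^ (2 - p.1))
      calc _ ≤ u ^ k * (Real.exp (3 / 2) * Real.exp (-(1 / 4 * u))) * 1 * (u ^ 2 + 1) := by gcongr
        _ = _ := by ring
    · rw [norm_zero]; positivity
  · exact ((integrable_poly_exp k (by norm_num)).add (integrable_poly_exp (k + 2) (by norm_num))).const_mul _
  · filter_upwards [ae_restrict_mem measurableSet_Ioi] with u hu
    have hu : 0 < u := hu
    have hD : Tendsto (fun p : ℝ × ℝ => 2 - p.1) LL (𝓝 2) := by
      simpa using (tendsto_const_nhds (x := (2 : ℝ))).sub LL_fst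
    have hw : Tendsto (fun p : ℝ × ℝ => (u / p.2) ^ (2 - p.1)) LL (𝓝 0) := by
      have h1 : Tendsto (fun p : ℝ × ℝ => u / p.2) LL (𝓝 0) := LL_snd.const_div_atTop u
      have := h1.rpow hD (Or.inr (by norm_num))
      simpa using this
    have hlim : Tendsto (fun p : ℝ × ℝ => u ^ k * Real.exp (-u + aPar β p.1 * (u / p.2) ^ (2 - p.1)) *
        Real.sinc (bPar β p.1 * (u / p.2) ^ (2 - p.1)) * u ^ (2 - p.1)) LL
        (𝓝 (u ^ k * Real.exp (-u + 1 * 0) * Real.sinc (0 * 0) * u ^ (2 : ℝ))) := by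
      apply Tendsto.mul
      · apply Tendsto.mul
        · apply Tendsto.mul tendsto_const_nhds
          exact (Real.continuous_exp.tendsto _).comp (tendsto_const_nhds.add ((aPar_tendsto β).mul hw))
        · exact (Real.continuous_sinc.tendsto _).comp ((bPar_tendsto β).mul hw)
      · exact tendsto_const_nhds.rpow hD (Or.inl hu.ne')
    simp only [mul_zero, add_zero, Real.sinc_zero, mul_one] at hlim
    refine hlim.congr' ?_
    have hm : ∀ᶠ p : ℝ × ℝ in LL, u ≤ p.2 ^ 2 / 2 := by
      filter_upwards [LL_gt 1, LL_gt (2 * u)] with p h1 h2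
      nlinarith
    filter_upwards [hm] with p hp
    unfold segF
    rw [indicator_of_mem]
    exact hp

/-- main term of the segment -/
noncomputable def AA (k : ℕ) (β Δ y : ℝ) : ℝ :=
  (-1) ^ k * (((k + 2).factorial : ℝ) / 2) * ((1 + β) * Δ * y ^ (Δ - 3 - k))

lemma Seg_tendsto (k : ℕ) (β : ℝ) (hβ : -1 < β) :
    Tendsto (fun p : ℝ × ℝ => (1 / Real.pi) * Seg k β p.1 p.2 / AA k β p.1 p.2) LL (𝓝 1) := by
  have hsinc : Tendsto (fun p : ℝ × ℝ => Real.sinc (Real.pi * p.1 / 2)) LL (𝓝 1) := by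
    have h : Tendsto (fun p : ℝ × ℝ => Real.pi * p.1 / 2) LL (𝓝 0) := by
      simpa using (LL_fst.const_mul Real.pi).div_const 2
    have := (Real.continuous_sinc.tendsto 0).comp h
    simpa [Function.comp_def] using this
  have h := (hsinc.mul (segF_tendsto k β)).div_const ((k + 2).factorial : ℝ)
  rw [one_mul, div_self (by positivity)] at h
  refine h.congr' ?_
  filter_upwards [LL_pos, LL_lt one_pos, LL_gt 1] with p h0 h1 hy
  rw [Seg_eq k β p.1 p.2 h0 h1 (by linarith), AA, bPar, sin_eq_sinc]
  have hp : p.2 ^ (p.1 - 3 - (k : ℝ)) ≠ 0 := (Real.rpow_pos_of_pos (by linarith) _).ne'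
  have h2 : (1 + β) ≠ 0 := by linarith
  have h3 : ((-1 : ℝ)) ^ k ≠ 0 := by simp
  have h4 : ((k + 2).factorial : ℝ) ≠ 0 := by positivity
  have h5 := Real.pi_pos.ne'
  have h6 := h0.ne'
  field_simp

open MeasureTheory Filter Set Topology Real

/-- The region where the Gaussian part may matter. -/
def SI : Set (ℝ × ℝ) := {p | p.2 ^ 2 ≤ 8 * Real.log (1 / p.1)}

/-- main term of the ray -/
noncomputable def BB (k : ℕ) (y : ℝ) : ℝ := (-(y / 2)) ^ k * normalDensity y

lemma poly_exp_tendsto (n : ℕ) {b : ℝ} (hb : 0 < b) :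
    Tendsto (fun y : ℝ => y ^ n * Real.exp (-(b * y))) atTop (𝓝 0) := by
  have h := Real.tendsto_pow_mul_exp_neg_atTop_nhds_zero n
  have hc : Tendsto (fun N : ℝ => b * N) atTop atTop := tendsto_id.const_mul_atTop hb
  have h4 := (h.comp hc).const_mul ((b⁻¹) ^ n)
  simp only [mul_zero] at h4
  refine h4.congr ?_
  intro N
  simp only [Function.comp]
  rw [← mul_assoc, ← mul_pow, inv_mul_cancel_left₀ hb.ne']

lemma poly_exp_sq_tendsto (n : ℕ) {b : ℝ} (hb : 0 < b) :
    Tendsto (fun y : ℝ => y ^ n * Real.exp (-(b * y ^ 2))) atTop (𝓝 0) := by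
  refine squeeze_zero' ?_ ?_ (poly_exp_tendsto n hb)
  · filter_upwards [eventually_ge_atTop 0] with y hy
    positivity
  · filter_upwards [eventually_ge_atTop 1] with y hy
    have : y ≤ y ^ 2 := by nlinarith
    gcongr

lemma SI_le {p : ℝ × ℝ} (h0 : 0 < p.1) (h : p ∈ SI) : p.1 ≤ Real.exp (-(1 / 8 * p.2 ^ 2)) := by
  have h : p.2 ^ 2 ≤ 8 * Real.log (1 / p.1) := h
  rw [one_div, Real.log_inv] at h
  rw [← Real.log_le_iff_le_exp h0]; linarith

lemma SI_gt {p : ℝ × ℝ} (h0 : 0 < p.1) (h : p ∉ SI) : Real.exp (-(1 / 8 * p.2 ^ 2)) < p.1 := by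
  have h : ¬ (p.2 ^ 2 ≤ 8 * Real.log (1 / p.1)) := h
  rw [one_div, Real.log_inv] at h
  rw [← Real.lt_log_iff_exp_lt h0]; linarith

lemma I_lim (n : ℕ) : Tendsto (fun p : ℝ × ℝ => p.1 * p.2 ^ n) (LL ⊓ 𝓟 SI) (𝓝 0) := by
  have h := ((poly_exp_sq_tendsto n (by norm_num : (0:ℝ) < 1 / 8)).comp LL_snd).mono_left
    (inf_le_left : LL ⊓ 𝓟 SI ≤ LL)
  refine squeeze_zero' ?_ ?_ h
  · filter_upwards [LL_pos.filter_mono inf_le_left, (LL_gt 0).filter_mono inf_le_left] with p h0 h1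
    positivity
  · filter_upwards [LL_pos.filter_mono inf_le_left, (LL_gt 0).filter_mono inf_le_left,
      mem_inf_of_right (mem_principal_self SI)] with p h0 h1 h2
    have := SI_le h0 h2
    simp only [Function.comp]
    rw [mul_comm]
    gcongr

lemma tan_le (β : ℝ) (hβ : |β| ≤ 1) :
    ∀ᶠ p : ℝ × ℝ in LL, |β * Real.tan (Real.pi * p.1 / 2)| ≤ 4 * p.1 := by
  have hc : ∀ᶠ p : ℝ × ℝ in LL, 1 / 2 < Real.cos (Real.pi * p.1 / 2) := by
    have h : Tendsto (fun p : ℝ × ℝ => Real.pi * p.1 / 2) LL (𝓝 0) := by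
      simpa using (LL_fst.const_mul Real.pi).div_const 2
    have := (Real.continuous_cos.tendsto 0).comp h
    rw [Real.cos_zero] at this
    exact this.eventually_const_lt (by norm_num)
  filter_upwards [LL_pos, LL_lt one_pos, hc] with p h0 h1 hc
  have hs : |Real.sin (Real.pi * p.1 / 2)| ≤ Real.pi * p.1 / 2 := by
    rw [abs_of_nonneg]
    · exact Real.sin_le (by positivity)
    · apply Real.sin_nonneg_of_nonneg_of_le_pi (by positivity)
      nlinarith [Real.pi_pos]
  have hpi := Real.pi_le_four
  rw [abs_mul, Real.tan_eq_sin_div_cos, abs_div, abs_of_pos (by linarith : 0 < Real.cos (Real.pi * p.1 / 2))]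
  have h2 : |Real.sin (Real.pi * p.1 / 2)| / Real.cos (Real.pi * p.1 / 2) ≤ 4 * p.1 := by
    rw [div_le_iff₀ (by linarith)]
    nlinarith
  calc _ ≤ 1 * (4 * p.1) := by
        apply mul_le_mul hβ h2 _ zero_le_one
        apply div_nonneg (abs_nonneg _); linarith
    _ = _ := one_mul _

/-- the exponent discrepancy on the ray -/
lemma exponent_bound (β Δ : ℝ) (z : ℂ) (h0 : 0 ≤ Δ) (hz1 : 1 ≤ ‖z‖)
    (hτ : |β * Real.tan (Real.pi * Δ / 2)| ≤ 4 * Δ) (hs : Δ * (‖z‖ + 4) ≤ 1) :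
    ‖z ^ 2 - cPar β Δ * z ^ (((2 - Δ : ℝ)) : ℂ)‖ ≤ ‖z‖ ^ 2 * (2 * (Δ * (‖z‖ + 4)) + 12 * Δ) := by
  have hz0 : z ≠ 0 := by
    intro h; rw [h] at hz1; simp at hz1; linarith
  set w : ℂ := -(Δ : ℂ) * Complex.log z with hw
  have hpow : z ^ (((2 - Δ : ℝ)) : ℂ) = z ^ 2 * Complex.exp w := by
    have : (((2 - Δ : ℝ)) : ℂ) = (2 : ℂ) + (-(Δ : ℂ)) := by push_cast; ring
    rw [this, Complex.cpow_add _ _ hz0, Complex.cpow_ofNat, Complex.cpow_def_of_ne_zero hz0 (-(Δ : ℂ)), hw]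
    congr 2; ring
  have hlog : ‖Complex.log z‖ ≤ ‖z‖ + 4 := by
    have h1 := Complex.norm_le_abs_re_add_abs_im (Complex.log z)
    rw [Complex.log_re, Complex.log_im, abs_of_nonneg (Real.log_nonneg hz1)] at h1
    have h2 := Complex.abs_arg_le_pi z
    have h3 := Real.log_le_self (by linarith : 0 ≤ ‖z‖)
    linarith [Real.pi_le_four]
  have hwn : ‖w‖ ≤ Δ * (‖z‖ + 4) := by
    rw [hw, norm_mul, norm_neg, Complex.norm_real, Real.norm_of_nonneg h0]
    gcongr
  have he : ‖Complex.exp w - 1‖ ≤ 2 * ‖w‖ := Complex.norm_exp_sub_one_le (hwn.trans hs)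
  have he2 : ‖Complex.exp w‖ ≤ 3 := by
    have : Complex.exp w = (Complex.exp w - 1) + 1 := by ring
    rw [this]
    refine (norm_add_le _ _).trans ?_
    rw [norm_one]; linarith [hwn.trans hs]
  have hc : ‖cPar β Δ - 1‖ ≤ 4 * Δ := by
    rw [cPar, add_sub_cancel_left, norm_mul, Complex.norm_I, mul_one, Complex.norm_real, Real.norm_eq_abs]
    exact hτ
  have heq : z ^ 2 - cPar β Δ * z ^ (((2 - Δ : ℝ)) : ℂ) =
      z ^ 2 * (-(Complex.exp w - 1) - (cPar β Δ - 1) * Complex.exp w) := by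
    rw [hpow]; ring
  rw [heq, norm_mul, norm_pow]
  gcongr
  refine (norm_sub_le _ _).trans ?_
  rw [norm_neg, norm_mul]
  have : ‖cPar β Δ - 1‖ * ‖Complex.exp w‖ ≤ 4 * Δ * 3 := by gcongr
  linarith

/-- normalized ray integrand -/
noncomputable def rayF (k : ℕ) (β : ℝ) (p : ℝ × ℝ) (u : ℝ) : ℂ :=
  (((((-(p.2 / 2)) ^ k * Real.exp (-(p.2 ^ 2) / 4))⁻¹ : ℝ)) : ℂ) *
    WW k β p.1 p.2 ((u : ℂ) + ((-(p.2 / 2) : ℝ) : ℂ) * Complex.I)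

lemma rayF_eq (k : ℕ) (β : ℝ) (p : ℝ × ℝ) (u : ℝ) (hy : p.2 ≠ 0) :
    rayF k β p u = (1 + ((2 * u / p.2 : ℝ) : ℂ) * Complex.I) ^ k *
      Complex.exp (-((u ^ 2 : ℝ) : ℂ) + (((u : ℂ) + ((-(p.2 / 2) : ℝ) : ℂ) * Complex.I) ^ 2 -
        cPar β p.1 * ((u : ℂ) + ((-(p.2 / 2) : ℝ) : ℂ) * Complex.I) ^ (((2 - p.1 : ℝ)) : ℂ))) := by
  set z : ℂ := ((u : ℂ) + ((-(p.2 / 2) : ℝ) : ℂ) * Complex.I) with hz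
  have hyc : (p.2 : ℂ) ≠ 0 := by exact_mod_cast hy
  have h1 : -(Complex.I * z) = ((-(p.2 / 2) : ℝ) : ℂ) * (1 + ((2 * u / p.2 : ℝ) : ℂ) * Complex.I) := by
    rw [hz]; push_cast; field_simp
    linear_combination (p.2 : ℂ) * Complex.I_sq
  have h2 : EE β p.1 p.2 z = ((Real.exp (-(p.2 ^ 2) / 4) : ℝ) : ℂ) *
      Complex.exp (-((u ^ 2 : ℝ) : ℂ) + (z ^ 2 - cPar β p.1 * z ^ (((2 - p.1 : ℝ)) : ℂ))) := by
    rw [EE, Complex.ofReal_exp, ← Complex.exp_add]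
    congr 1
    have : z ^ 2 = (u : ℂ) ^ 2 - (p.2 : ℂ) ^ 2 / 4 - (u : ℂ) * (p.2 : ℂ) * Complex.I := by
      rw [hz]; push_cast
      linear_combination ((p.2 : ℂ) ^ 2 / 4) * Complex.I_sq
    have h3 : Complex.I * z * (p.2 : ℂ) = (u : ℂ) * (p.2 : ℂ) * Complex.I + (p.2 : ℂ) ^ 2 / 2 := by
      rw [hz]; push_cast
      linear_combination (-(p.2 : ℂ) ^ 2 / 2) * Complex.I_sq
    rw [this, h3]; push_cast; ring
  rw [rayF, WW, h1, h2, mul_pow]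
  have h4 : (((-(p.2 / 2) : ℝ) : ℂ)) ^ k ≠ 0 := by
    apply pow_ne_zero
    rw [Complex.ofReal_ne_zero]
    intro h; apply hy; linarith
  have h5 : ((Real.exp (-(p.2 ^ 2) / 4) : ℝ) : ℂ) ≠ 0 := by
    rw [Complex.ofReal_ne_zero]; exact (Real.exp_pos _).ne'
  rw [Complex.ofReal_inv, Complex.ofReal_mul, Complex.ofReal_pow]
  generalize (((-(p.2 / 2) : ℝ) : ℂ)) ^ k = X at *
  generalize ((Real.exp (-(p.2 ^ 2) / 4) : ℝ) : ℂ) = Y at *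
  field_simp

lemma rayF_tendsto (k : ℕ) (β : ℝ) (hβ : |β| ≤ 1) :
    Tendsto (fun p : ℝ × ℝ => ∫ u in Ioi (0 : ℝ), rayF k β p u) (LL ⊓ 𝓟 SI)
      (𝓝 (((Real.sqrt Real.pi / 2 : ℝ)) : ℂ)) := by
  have hval : ∫ u in Ioi (0 : ℝ), ((Real.exp (-(u ^ 2)) : ℝ) : ℂ) = ((Real.sqrt Real.pi / 2 : ℝ) : ℂ) := by
    rw [integral_complex_ofReal]
    have := integral_gaussian_Ioi 1
    simp only [neg_mul, one_mul, div_one] at this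
    rw [this]
  rw [← hval]
  have hle : LL ⊓ 𝓟 SI ≤ LL := inf_le_left
  have hτ := (tan_le β hβ).filter_mono hle
  apply tendsto_integral_filter_of_dominated_convergence
    (fun u : ℝ => Real.exp 1 * ((k.factorial : ℝ) * Real.exp 1 * 8 ^ k) * Real.exp (-(1 / 8 * u)))
  · filter_upwards [(LL_lt one_pos).filter_mono hle] with p h1
    unfold rayF
    exact (aesm_ray k β p.1 p.2 h1.le).const_mul _
  · have e1 := (I_lim 1).eventually_lt_const (by norm_num : (0:ℝ) < 1 / 2)
    have e2 := (I_lim 2).eventually_lt_const (by norm_num : (0:ℝ) < 1)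
    filter_upwards [LL_pos.filter_mono hle, (LL_lt (by norm_num : (0:ℝ) < 1 / 8)).filter_mono hle,
      (LL_gt 2).filter_mono hle, hτ, e1, e2] with p h0 h1 hy hτ e1 e2
    filter_upwards [ae_restrict_mem measurableSet_Ioi] with u hu
    have hu : 0 < u := hu
    have hy0 : 0 < p.2 := by linarith
    have hn := norm_ray k β p.1 p.2 u h0.le (by linarith) hy.le hu.le (by linarith)
    set τ := |β * Real.tan (Real.pi * p.1 / 2)| with hτd
    have hκ : 1 / 8 ≤ p.2 ^ (-p.1) / 4 := by
      have : 1 / 2 ≤ p.2 ^ (-p.1) := by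
        rw [Real.rpow_def_of_pos hy0]
        have a1 := Real.add_one_le_exp (Real.log p.2 * -p.1)
        have a2 := Real.log_le_self hy0.le
        have a3 : Real.log p.2 * p.1 ≤ p.2 * p.1 := by gcongr
        linarith
      linarith
    have hκ2 : (p.2 ^ (-p.1) / 4)⁻¹ ≤ 8 := by
      rw [inv_le_comm₀ (by linarith) (by norm_num)]; linarith
    have hκ3 : 0 ≤ (p.2 ^ (-p.1) / 4)⁻¹ := by positivity
    have hR : 0 < (p.2 / 2) ^ k * Real.exp (-(p.2 ^ 2) / 4) := by positivity
    have hτe : τ * p.2 ^ 2 / 4 ≤ 1 := by nlinarith [sq_nonneg p.2]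
    rw [rayF, norm_mul, Complex.norm_real, norm_inv, norm_mul, norm_pow, norm_neg,
      Real.norm_of_nonneg (by linarith : 0 ≤ p.2 / 2), Real.norm_of_nonneg (Real.exp_pos _).le,
      inv_mul_le_iff₀ hR]
    refine hn.trans ?_
    rw [Real.exp_add]
    calc _ ≤ (p.2 / 2) ^ k * (Real.exp (-p.2 ^ 2 / 4) * Real.exp 1) *
          ((k.factorial : ℝ) * Real.exp 1 * 8 ^ k * Real.exp (-(1 / 8 * u))) := by gcongr
      _ = _ := by ring
  · apply Integrable.const_mul
    have := exp_neg_integrableOn_Ioi 0 (by norm_num : (0:ℝ) < 1 / 8)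
    simp only [neg_mul] at this
    exact this
  · filter_upwards [ae_restrict_mem measurableSet_Ioi] with u hu
    have hu : 0 < u := hu
    have hD : Tendsto (fun p : ℝ × ℝ => ((u : ℂ) + ((-(p.2 / 2) : ℝ) : ℂ) * Complex.I) ^ 2 -
        cPar β p.1 * ((u : ℂ) + ((-(p.2 / 2) : ℝ) : ℂ) * Complex.I) ^ (((2 - p.1 : ℝ)) : ℂ))
        (LL ⊓ 𝓟 SI) (𝓝 0) := by
      have hb : Tendsto (fun p : ℝ × ℝ => 2 * (p.1 * p.2 ^ 3) + 20 * (p.1 * p.2 ^ 2)) (LL ⊓ 𝓟 SI) (𝓝 0) := by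
        simpa using ((I_lim 3).const_mul 2).add ((I_lim 2).const_mul 20)
      refine squeeze_zero_norm' ?_ hb
      have e1 := (I_lim 1).eventually_lt_const (by norm_num : (0:ℝ) < 1 / 2)
      filter_upwards [LL_pos.filter_mono hle, (LL_lt (by norm_num : (0:ℝ) < 1 / 8)).filter_mono hle,
        (LL_gt 2).filter_mono hle, (LL_gt (2 * u)).filter_mono hle, hτ, e1] with p h0 h1 hy hyu hτ e1
      set z : ℂ := ((u : ℂ) + ((-(p.2 / 2) : ℝ) : ℂ) * Complex.I) with hz
      have hzim : z.im = -(p.2 / 2) := by simp [hz]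
      have hz1 : 1 ≤ ‖z‖ := by
        have := Complex.abs_im_le_norm z
        rw [hzim, abs_neg, abs_of_nonneg (by linarith)] at this
        linarith
      have hzle : ‖z‖ ≤ p.2 := (norm_le_aux u (p.2 / 2) hu.le (by linarith)).trans (by linarith)
      refine (exponent_bound β p.1 z h0.le hz1 hτ ?_).trans ?_
      · have : p.1 * (‖z‖ + 4) ≤ p.1 * (p.2 + 4) := by gcongr
        nlinarith
      · calc _ ≤ p.2 ^ 2 * (2 * (p.1 * (p.2 + 4)) + 12 * p.1) := by gcongr
          _ = _ := by ring
    have hW : Tendsto (fun p : ℝ × ℝ => 1 + ((2 * u / p.2 : ℝ) : ℂ) * Complex.I) (LL ⊓ 𝓟 SI) (𝓝 1) := by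
      have h1 : Tendsto (fun p : ℝ × ℝ => 2 * u / p.2) (LL ⊓ 𝓟 SI) (𝓝 0) :=
        (LL_snd.mono_left hle).const_div_atTop _
      have h2 := (Complex.continuous_ofReal.tendsto 0).comp h1
      have h3 := (h2.mul_const Complex.I).const_add 1
      simpa [Function.comp_def] using h3
    have hlim := (hW.pow k).mul ((Complex.continuous_exp.tendsto _).comp
      (hD.const_add (-((u ^ 2 : ℝ) : ℂ))))
    have hlast : (1 : ℂ) ^ k * Complex.exp (-((u ^ 2 : ℝ) : ℂ) + 0) = ((Real.exp (-(u ^ 2)) : ℝ) : ℂ) := by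
      rw [one_pow, one_mul, add_zero]; push_cast; rfl
    rw [hlast] at hlim
    refine hlim.congr' ?_
    filter_upwards [(LL_gt 2).filter_mono hle] with p hy
    rw [rayF_eq k β p u (by linarith)]
    rfl

lemma Ray_I (k : ℕ) (β : ℝ) (hβ : |β| ≤ 1) :
    Tendsto (fun p : ℝ × ℝ => (1 / Real.pi) * (Ray k β p.1 p.2).re / BB k p.2) (LL ⊓ 𝓟 SI) (𝓝 1) := by
  have h := (Complex.continuous_re.tendsto _).comp (rayF_tendsto k β hβ)
  rw [Complex.ofReal_re] at h
  have h2 := h.const_mul (2 / Real.sqrt Real.pi)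
  have hsp : 0 < Real.sqrt Real.pi := Real.sqrt_pos.mpr Real.pi_pos
  have e : 2 / Real.sqrt Real.pi * (Real.sqrt Real.pi / 2) = 1 := by field_simp
  rw [e] at h2
  refine h2.congr' ?_
  filter_upwards [(LL_gt 2).filter_mono (inf_le_left : LL ⊓ 𝓟 SI ≤ LL)] with p hy
  have hR : ∫ u in Ioi (0 : ℝ), rayF k β p u =
      (((((-(p.2 / 2)) ^ k * Real.exp (-(p.2 ^ 2) / 4))⁻¹ : ℝ)) : ℂ) * Ray k β p.1 p.2 := by
    unfold rayF Ray
    rw [integral_const_mul]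
  simp only [Function.comp]
  rw [hR, Complex.re_ofReal_mul, BB, normalDensity]
  have h3 : (-(p.2 / 2)) ^ k ≠ 0 := pow_ne_zero _ (by linarith)
  have h4 := (Real.exp_pos (-(p.2 ^ 2) / 4)).ne'
  have h5 := Real.pi_pos.ne'
  have h6 : Real.pi = Real.sqrt Real.pi * Real.sqrt Real.pi := (Real.mul_self_sqrt Real.pi_pos.le).symm
  generalize (-(p.2 / 2)) ^ k = X at *
  generalize Real.exp (-(p.2 ^ 2) / 4) = Y at *
  have h7 : (1 / Real.pi) = 1 / (Real.sqrt Real.pi * Real.sqrt Real.pi) := by rw [← h6]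
  rw [h7]
  field_simp

lemma II_lim (k n : ℕ) (β C : ℝ) (hβ : -1 < β) (X : ℝ × ℝ → ℝ)
    (hX : ∀ᶠ p in LL ⊓ 𝓟 SIᶜ, |X p| ≤ C * p.2 ^ n * Real.exp (-(3 / 16 * p.2 ^ 2))) :
    Tendsto (fun p : ℝ × ℝ => X p / AA k β p.1 p.2) (LL ⊓ 𝓟 SIᶜ) (𝓝 0) := by
  have hle : LL ⊓ 𝓟 SIᶜ ≤ LL := inf_le_left
  set D : ℝ := (((k + 2).factorial : ℝ) / 2) * (1 + β) with hD
  have hDpos : 0 < D := by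
    have : 0 < 1 + β := by linarith
    positivity
  have h := (((poly_exp_sq_tendsto (n + (3 + k)) (by norm_num : (0:ℝ) < 1 / 16)).comp LL_snd).mono_left
    hle).const_mul (C / D)
  rw [mul_zero] at h
  refine squeeze_zero_norm' ?_ h
  filter_upwards [LL_pos.filter_mono hle, (LL_gt 1).filter_mono hle, hX,
      mem_inf_of_right (mem_principal_self SIᶜ)] with p h0 hy hX hp
  have hy0 : 0 < p.2 := by linarith
  have hgt := SI_gt h0 hp
  have hAA : ‖AA k β p.1 p.2‖ = D * p.1 * p.2 ^ (p.1 - 3 - (k : ℝ)) := by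
    have h1 : 0 < 1 + β := by linarith
    have h2 : 0 < p.2 ^ (p.1 - 3 - (k : ℝ)) := Real.rpow_pos_of_pos hy0 _
    rw [AA, norm_mul, norm_mul, norm_pow, norm_neg, norm_one, one_pow, one_mul,
      Real.norm_of_nonneg (by positivity), Real.norm_of_nonneg (by positivity), hD]
    ring
  have hrp : (p.2 ^ (3 + k))⁻¹ ≤ p.2 ^ (p.1 - 3 - (k : ℝ)) := by
    rw [← Real.rpow_natCast, ← Real.rpow_neg hy0.le]
    apply Real.rpow_le_rpow_of_exponent_le hy.le
    push_cast; linarith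
  have hlow : D * Real.exp (-(1 / 8 * p.2 ^ 2)) * (p.2 ^ (3 + k))⁻¹ ≤ ‖AA k β p.1 p.2‖ := by
    rw [hAA]; gcongr
  have hlowpos : 0 < D * Real.exp (-(1 / 8 * p.2 ^ 2)) * (p.2 ^ (3 + k))⁻¹ := by positivity
  rw [norm_div, Real.norm_eq_abs (X p), div_le_iff₀ (hlowpos.trans_le hlow)]
  refine hX.trans ?_
  simp only [Function.comp]
  have hC : 0 ≤ C := by
    by_contra hc
    push Not at hc
    have : C * p.2 ^ n * Real.exp (-(3 / 16 * p.2 ^ 2)) < 0 := by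
      have h1 : 0 < p.2 ^ n * Real.exp (-(3 / 16 * p.2 ^ 2)) := by positivity
      nlinarith
    linarith [abs_nonneg (X p)]
  have he : Real.exp (-(3 / 16 * p.2 ^ 2)) = Real.exp (-(1 / 16 * p.2 ^ 2)) * Real.exp (-(1 / 8 * p.2 ^ 2)) := by
    rw [← Real.exp_add]; congr 1; ring
  calc _ = C / D * (p.2 ^ (n + (3 + k)) * Real.exp (-(1 / 16 * p.2 ^ 2))) *
        (D * Real.exp (-(1 / 8 * p.2 ^ 2)) * (p.2 ^ (3 + k))⁻¹) := by
          rw [he, pow_add]; field_simp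
    _ ≤ _ := by gcongr

lemma Ray_II (k : ℕ) (β : ℝ) (hβ : -1 < β) (hβ2 : β < 1) :
    Tendsto (fun p : ℝ × ℝ => (1 / Real.pi) * (Ray k β p.1 p.2).re / AA k β p.1 p.2) (LL ⊓ 𝓟 SIᶜ) (𝓝 0) := by
  have hle : LL ⊓ 𝓟 SIᶜ ≤ LL := inf_le_left
  have hτ := (tan_le β (abs_le.mpr ⟨hβ.le, hβ2.le⟩)).filter_mono hle
  apply II_lim k (k + (k + 1)) β ((k.factorial : ℝ) * Real.exp 1 * 4 ^ (k + 1)) hβ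
  filter_upwards [LL_pos.filter_mono hle, (LL_lt (by norm_num : (0:ℝ) < 1 / 16)).filter_mono hle,
    (LL_gt 2).filter_mono hle, hτ] with p h0 h1 hy hτ
  have hn := norm_Ray k β p.1 p.2 h0.le (by linarith) hy.le (by linarith)
  have hy0 : 0 < p.2 := by linarith
  set τ := |β * Real.tan (Real.pi * p.1 / 2)| with hτd
  have hκ : (p.2 ^ (-p.1) / 4)⁻¹ ≤ 4 * p.2 := by
    rw [inv_div, Real.rpow_neg hy0.le, div_inv_eq_mul]
    have : p.2 ^ p.1 ≤ p.2 ^ (1 : ℝ) := Real.rpow_le_rpow_of_exponent_le (by linarith) (by linarith)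
    rw [Real.rpow_one] at this
    linarith
  have hκ3 : 0 ≤ (p.2 ^ (-p.1) / 4)⁻¹ := by positivity
  have hpi : |1 / Real.pi| ≤ 1 := by
    rw [abs_of_pos (by positivity), div_le_one Real.pi_pos]; linarith [Real.pi_gt_three]
  rw [abs_mul]
  calc _ ≤ 1 * ‖Ray k β p.1 p.2‖ := by
        gcongr
        exact Complex.abs_re_le_norm _
    _ ≤ 1 * ((p.2 / 2) ^ k * Real.exp (-(p.2 ^ 2) / 4 + τ * p.2 ^ 2 / 4) *
        ((k.factorial : ℝ) * Real.exp 1 * ((p.2 ^ (-p.1) / 4)⁻¹) ^ (k + 1))) := by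
        gcongr
    _ ≤ 1 * (p.2 ^ k * Real.exp (-(3 / 16 * p.2 ^ 2)) *
        ((k.factorial : ℝ) * Real.exp 1 * (4 * p.2) ^ (k + 1))) := by
        gcongr
        · linarith
        · nlinarith [sq_nonneg p.2]
    _ = _ := by rw [mul_pow, pow_add]; ring

lemma BB_II (k : ℕ) (β : ℝ) (hβ : -1 < β) :
    Tendsto (fun p : ℝ × ℝ => BB k p.2 / AA k β p.1 p.2) (LL ⊓ 𝓟 SIᶜ) (𝓝 0) := by
  have hle : LL ⊓ 𝓟 SIᶜ ≤ LL := inf_le_left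
  apply II_lim k k β 1 hβ (fun p => BB k p.2)
  filter_upwards [(LL_gt 2).filter_mono hle] with p hy
  have hy0 : 0 < p.2 := by linarith
  have hs : 1 ≤ Real.sqrt Real.pi := by
    rw [Real.one_le_sqrt]; linarith [Real.pi_gt_three]
  have h1 : 1 / (2 * Real.sqrt Real.pi) ≤ 1 := by
    rw [div_le_one (by linarith)]; linarith
  rw [BB, normalDensity, abs_mul, abs_pow, abs_neg, abs_of_pos (by linarith : 0 < p.2 / 2),
    abs_of_nonneg (by positivity)]
  calc _ ≤ p.2 ^ k * (1 * Real.exp (-(3 / 16 * p.2 ^ 2))) := by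
        gcongr
        · linarith
        · nlinarith [sq_nonneg p.2]
    _ = _ := by ring

open MeasureTheory Filter Set Topology Real

lemma AA_abs (k : ℕ) (β Δ y : ℝ) : ∃ a : ℝ, AA k β Δ y = (-1) ^ k * a ∧
    (-1 < β → 0 < Δ → 0 < y → 0 < a) := by
  refine ⟨(((k + 2).factorial : ℝ) / 2) * ((1 + β) * Δ * y ^ (Δ - 3 - k)), ?_, ?_⟩
  · rw [AA]; ring
  · intro h1 h2 h3
    have : 0 < 1 + β := by linarith
    have : 0 < y ^ (Δ - 3 - (k : ℝ)) := Real.rpow_pos_of_pos h3 _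
    positivity

lemma normalDensity_pos (y : ℝ) : 0 < normalDensity y := by
  have := Real.sqrt_pos.mpr Real.pi_pos
  unfold normalDensity; positivity

lemma BB_abs (k : ℕ) (y : ℝ) : ∃ b : ℝ, BB k y = (-1) ^ k * b ∧ (0 < y → 0 < b) := by
  refine ⟨(y / 2) ^ k * normalDensity y, ?_, ?_⟩
  · rw [BB, neg_pow]; ring
  · intro h
    have := normalDensity_pos y
    positivity

lemma ratio_ineq (s A B S R X Y : ℝ) (hs : |s| = 1) (hA : 0 < A) (hB : 0 < B)
    (hS : |S / (s * A) - 1| ≤ X)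
    (hR : |R - s * B| ≤ Y * (A + B)) :
    |(S + R) / (s * A + s * B) - 1| ≤ X + Y := by
  have hs0 : s ≠ 0 := by intro h; rw [h] at hs; simp at hs
  have hsum : |s * A + s * B| = A + B := by
    rw [← mul_add, abs_mul, hs, one_mul, abs_of_pos (by linarith)]
  have hne : s * A + s * B ≠ 0 := by rw [← mul_add]; exact mul_ne_zero hs0 (by linarith)
  have hX : 0 ≤ X := (abs_nonneg _).trans hS
  have h1 : (S + R) / (s * A + s * B) - 1 = ((S - s * A) + (R - s * B)) / (s * A + s * B) := by
    field_simp; ring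
  have h2 : |S - s * A| ≤ X * A := by
    have : S - s * A = (S / (s * A) - 1) * (s * A) := by field_simp
    rw [this, abs_mul, abs_mul, hs, one_mul, abs_of_pos hA]
    gcongr
  rw [h1, abs_div, hsum, div_le_iff₀ (by linarith)]
  refine (abs_add_le _ _).trans ?_
  nlinarith

lemma main_tendsto (k : ℕ) (β : ℝ) (hβ : -1 < β) (hβ2 : β < 1) :
    Tendsto (fun p : ℝ × ℝ => (1 / Real.pi) * (JJ k β p.1 p.2).re / (AA k β p.1 p.2 + BB k p.2)) LL (𝓝 1) := by
  have habs : |β| ≤ 1 := abs_le.mpr ⟨hβ.le, hβ2.le⟩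
  have hS := Seg_tendsto k β hβ
  have hdec : ∀ᶠ p : ℝ × ℝ in LL, (1 / Real.pi) * (JJ k β p.1 p.2).re =
      (1 / Real.pi) * Seg k β p.1 p.2 + (1 / Real.pi) * (Ray k β p.1 p.2).re := by
    filter_upwards [LL_pos, LL_lt one_pos, LL_gt 2,
      (tan_tendsto β).eventually_lt_const (by norm_num : (0:ℝ) < 1 / 2)] with p h0 h1 hy hτ
    rw [contour k β p.1 p.2 h0.le h1 hy.le hτ.le, Complex.add_re, Seg]; ring
  rw [tendsto_iff_norm_sub_tendsto_zero]
  have hs1 : |((-1 : ℝ)) ^ k| = 1 := by simp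
  have hS0 : Tendsto (fun p : ℝ × ℝ => |(1 / Real.pi) * Seg k β p.1 p.2 / AA k β p.1 p.2 - 1|) LL (𝓝 0) :=
    tendsto_iff_norm_sub_tendsto_zero.mp hS
  have hI : Tendsto (fun p : ℝ × ℝ => ‖(1 / Real.pi) * (JJ k β p.1 p.2).re /
      (AA k β p.1 p.2 + BB k p.2) - 1‖) (LL ⊓ 𝓟 SI) (𝓝 0) := by
    have hle : LL ⊓ 𝓟 SI ≤ LL := inf_le_left
    have hR : Tendsto (fun p : ℝ × ℝ => |(1 / Real.pi) * (Ray k β p.1 p.2).re / BB k p.2 - 1|)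
      (LL ⊓ 𝓟 SI) (𝓝 0) := tendsto_iff_norm_sub_tendsto_zero.mp (Ray_I k β habs)
    have hsum := (hS0.mono_left hle).add hR
    rw [add_zero] at hsum
    refine squeeze_zero' (Eventually.of_forall fun p => norm_nonneg _) ?_ hsum
    filter_upwards [hdec.filter_mono hle, LL_pos.filter_mono hle, (LL_gt 2).filter_mono hle] with p hd h0 hy
    obtain ⟨a, ha, hapos⟩ := AA_abs k β p.1 p.2
    obtain ⟨b, hb, hbpos⟩ := BB_abs k p.2
    have hapos := hapos hβ h0 (by linarith)
    have hbpos := hbpos (by linarith)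
    rw [hd, Real.norm_eq_abs, ha, hb]
    apply ratio_ineq _ _ _ _ _ _ _ hs1 hapos hbpos le_rfl
    have hne : ((-1 : ℝ)) ^ k ≠ 0 := by simp
    generalize (1 / Real.pi) * (Ray k β p.1 p.2).re = R
    have : R - (-1) ^ k * b = (R / ((-1) ^ k * b) - 1) * ((-1) ^ k * b) := by field_simp
    rw [this, abs_mul]
    apply mul_le_mul_of_nonneg_left _ (abs_nonneg _)
    rw [abs_mul, hs1, one_mul, abs_of_pos hbpos]; linarith
  have hII : Tendsto (fun p : ℝ × ℝ => ‖(1 / Real.pi) * (JJ k β p.1 p.2).re /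
      (AA k β p.1 p.2 + BB k p.2) - 1‖) (LL ⊓ 𝓟 SIᶜ) (𝓝 0) := by
    have hle : LL ⊓ 𝓟 SIᶜ ≤ LL := inf_le_left
    have hR := (Ray_II k β hβ hβ2).abs
    have hB := (BB_II k β hβ).abs
    have hsum := (hS0.mono_left hle).add (hR.add hB)
    simp only [abs_zero, add_zero] at hsum
    refine squeeze_zero' (Eventually.of_forall fun p => norm_nonneg _) ?_ hsum
    filter_upwards [hdec.filter_mono hle, LL_pos.filter_mono hle, (LL_gt 2).filter_mono hle] with p hd h0 hy
    obtain ⟨a, ha, hapos⟩ := AA_abs k β p.1 p.2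
    obtain ⟨b, hb, hbpos⟩ := BB_abs k p.2
    have hapos := hapos hβ h0 (by linarith)
    have hbpos := hbpos (by linarith)
    rw [hd, Real.norm_eq_abs, ha, hb]
    apply ratio_ineq _ _ _ _ _ _ _ hs1 hapos hbpos le_rfl
    generalize (1 / Real.pi) * (Ray k β p.1 p.2).re = R
    rw [abs_div, abs_div, abs_mul, abs_mul, hs1, one_mul, one_mul, abs_of_pos hapos, abs_of_pos hbpos]
    calc |R - (-1) ^ k * b| ≤ |R| + |(-1) ^ k * b| := abs_sub _ _
      _ = (|R| / a + b / a) * a := by rw [abs_mul, hs1, one_mul, abs_of_pos hbpos]; field_simp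
      _ ≤ _ := by gcongr; linarith
  have := hI.sup hII
  rwa [← inf_sup_left, sup_principal, union_compl_self, principal_univ, inf_top_eq] at this

lemma ratio_tendsto (β : ℝ) (hβ : -1 < β) (hβ2 : β < 1) :
    Tendsto (fun p : ℝ × ℝ => ((1 / Real.pi) * (JJ 1 β p.1 p.2).re / (AA 1 β p.1 p.2 + BB 1 p.2)) /
      ((1 / Real.pi) * (JJ 0 β p.1 p.2).re / (AA 0 β p.1 p.2 + BB 0 p.2))) LL (𝓝 1) := by
  have := (main_tendsto 1 β hβ hβ2).div (main_tendsto 0 β hβ hβ2) one_ne_zero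
  rwa [div_one] at this

lemma ratio_eps (β : ℝ) (hβ : -1 < β) (hβ2 : β < 1) (ε : ℝ) (hε : 0 < ε) :
    ∃ Δ₁ > (0 : ℝ), ∃ Y > (0 : ℝ), ∀ Δ y : ℝ, 0 < Δ → Δ < Δ₁ → Y < y →
      |((1 / Real.pi) * (JJ 1 β Δ y).re / (AA 1 β Δ y + BB 1 y)) /
      ((1 / Real.pi) * (JJ 0 β Δ y).re / (AA 0 β Δ y + BB 0 y)) - 1| < ε := by
  have h := (tendsto_iff_norm_sub_tendsto_zero.mp (ratio_tendsto β hβ hβ2)).eventually_lt_const hε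
  rw [Filter.Eventually, mem_prod_iff] at h
  obtain ⟨s, hs, t, ht, hst⟩ := h
  rw [mem_nhdsGT_iff_exists_Ioo_subset] at hs
  obtain ⟨Δ₁, hΔ₁, hsub⟩ := hs
  obtain ⟨Y, hY⟩ := mem_atTop_sets.mp ht
  refine ⟨Δ₁, hΔ₁, max Y 1, by positivity, ?_⟩
  intro Δ y h0 h1 hy
  have := hst (mk_mem_prod (hsub ⟨h0, h1⟩) (hY y ((le_max_left _ _).trans hy.le)))
  exact this

lemma g_pos (β Δ x : ℝ) (hx : 0 < x - zetaPar (2 - Δ) β) :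
    gApprox (2 - Δ) β x = AA 0 β Δ (x - zetaPar (2 - Δ) β) + BB 0 (x - zetaPar (2 - Δ) β) ∧
    gApprox' (2 - Δ) β x = AA 1 β Δ (x - zetaPar (2 - Δ) β) + BB 1 (x - zetaPar (2 - Δ) β) := by
  unfold gApprox gApprox' F1 F2 F1' F2' AA BB
  generalize x - zetaPar (2 - Δ) β = y at *
  rw [Real.sign_of_pos hx, abs_of_pos hx]
  constructor
  · norm_num [Nat.factorial]; ring
  · have : Δ - 3 - ((1 : ℕ) : ℝ) = 2 - (2 - Δ) - 4 := by push_cast; ring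
    rw [this]
    norm_num [Nat.factorial]; ring

lemma g_neg (β Δ x : ℝ) (hx : x - zetaPar (2 - Δ) β < 0) :
    gApprox (2 - Δ) β x = AA 0 (-β) Δ (-(x - zetaPar (2 - Δ) β)) + BB 0 (-(x - zetaPar (2 - Δ) β)) ∧
    gApprox' (2 - Δ) β x = -(AA 1 (-β) Δ (-(x - zetaPar (2 - Δ) β)) + BB 1 (-(x - zetaPar (2 - Δ) β))) := by
  unfold gApprox gApprox' F1 F2 F1' F2' AA BB normalDensity
  generalize x - zetaPar (2 - Δ) β = y at *
  rw [Real.sign_of_neg hx, abs_of_neg hx]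
  constructor
  · norm_num [Nat.factorial]; ring
  · have : Δ - 3 - ((1 : ℕ) : ℝ) = 2 - (2 - Δ) - 4 := by push_cast; ring
    rw [this]
    norm_num [Nat.factorial]; ring

lemma score_bound (β : ℝ) (hβ : -1 < β) (hβ2 : β < 1) (ε : ℝ) (hε : 0 < ε) :
    ∃ Δ₁ > (0 : ℝ), ∃ Y > (0 : ℝ), ∀ Δ x : ℝ, 0 < Δ → Δ < Δ₁ → Y < |x - zetaPar (2 - Δ) β| →
      |(-deriv (stableDensity (2 - Δ) β) x / stableDensity (2 - Δ) β x) /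
            gMu (2 - Δ) β x - 1| < ε := by
  obtain ⟨Δ₁, h1, Y₁, hY1, H1⟩ := ratio_eps β hβ hβ2 ε hε
  obtain ⟨Δ₂, h2, Y₂, hY2, H2⟩ := ratio_eps (-β) (by linarith) (by linarith) ε hε
  refine ⟨min 1 (min Δ₁ Δ₂), by positivity, max Y₁ Y₂, by positivity, ?_⟩
  intro Δ x h0 hΔ hy
  have hd1 : Δ < 1 := hΔ.trans_le (min_le_left _ _)
  have hd2 : Δ < Δ₁ := hΔ.trans_le ((min_le_right _ _).trans (min_le_left _ _))
  have hd3 : Δ < Δ₂ := hΔ.trans_le ((min_le_right _ _).trans (min_le_right _ _))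
  rw [deriv_stableDensity β Δ x hd1, stableDensity_eq, gMu]
  rcases lt_trichotomy (x - zetaPar (2 - Δ) β) 0 with hs | hs | hs
  · obtain ⟨e1, e2⟩ := g_neg β Δ x hs
    rw [e1, e2]
    rw [abs_of_neg hs] at hy
    have := H2 Δ (-(x - zetaPar (2 - Δ) β)) h0 hd3 ((le_max_right _ _).trans_lt hy)
    have j0 := JJ_neg_re 0 β Δ (-(x - zetaPar (2 - Δ) β))
    have j1 := JJ_neg_re 1 β Δ (-(x - zetaPar (2 - Δ) β))
    rw [neg_neg] at j0 j1
    rw [j0, j1]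
    convert this using 3
    simp only [div_eq_mul_inv, mul_inv, inv_inv, pow_zero, pow_one, neg_neg]
    ring
  · rw [hs, abs_zero] at hy
    have := (le_max_left Y₁ Y₂).trans_lt hy
    linarith
  · obtain ⟨e1, e2⟩ := g_pos β Δ x hs
    rw [e1, e2]
    rw [abs_of_pos hs] at hy
    have := H1 Δ (x - zetaPar (2 - Δ) β) h0 hd2 ((le_max_left _ _).trans_lt hy)
    convert this using 3
    simp only [div_eq_mul_inv, mul_inv, inv_inv]
    generalize AA 1 β Δ (x - zetaPar (2 - Δ) β) + BB 1 (x - zetaPar (2 - Δ) β) = G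
    rw [inv_neg]
    ring

open MeasureTheory Filter Set Topology Real

lemma F2_bounds (β Δ x : ℝ) (h0 : 0 < Δ) (h1 : Δ < 1)
    (hy : 1 ≤ |x - zetaPar (2 - Δ) β|) (hβ : |β| < 1) :
    F2 (2 - Δ) β x ≤ 2 * Δ ∧
    (1 - |β|) * Δ * (|x - zetaPar (2 - Δ) β| ^ 3)⁻¹ ≤ F2 (2 - Δ) β x := by
  unfold F2
  set y := x - zetaPar (2 - Δ) β with hyd
  have hy0 : 0 < |y| := by linarith
  have hs : |β * Real.sign y| ≤ |β| := by
    rw [abs_mul]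
    have : |Real.sign y| ≤ 1 := by
      rcases Real.sign_apply_eq y with h | h | h <;> rw [h] <;> simp
    nlinarith [abs_nonneg β]
  obtain ⟨hs1, hs2⟩ := abs_le.mp hs
  have hD : 2 - (2 - Δ) = Δ := by ring
  rw [hD]
  have hr1 : |y| ^ (Δ - 3) ≤ 1 := Real.rpow_le_one_of_one_le_of_nonpos hy (by linarith)
  have hr0 : 0 < |y| ^ (Δ - 3) := Real.rpow_pos_of_pos hy0 _
  have hr2 : (|y| ^ 3)⁻¹ ≤ |y| ^ (Δ - 3) := by
    rw [← Real.rpow_natCast, ← Real.rpow_neg hy0.le]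
    apply Real.rpow_le_rpow_of_exponent_le hy
    push_cast; linarith
  constructor
  · calc (1 + β * Real.sign y) * Δ * |y| ^ (Δ - 3) ≤ 2 * Δ * 1 := by
          gcongr; linarith
      _ = _ := mul_one _
  · have h3 : 0 ≤ (1 + β * Real.sign y) * Δ := mul_nonneg (by linarith) h0.le
    exact mul_le_mul (mul_le_mul_of_nonneg_right (by linarith) h0.le) hr2 (by positivity) h3

lemma gMu_eq (β Δ x : ℝ) (hy : x - zetaPar (2 - Δ) β ≠ 0) :
    gMu (2 - Δ) β x = ((x - zetaPar (2 - Δ) β) / 2 * F1 (2 - Δ) β x +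
      3 / (x - zetaPar (2 - Δ) β) * F2 (2 - Δ) β x) / (F1 (2 - Δ) β x + F2 (2 - Δ) β x) := by
  have h : F2' (2 - Δ) β x = -(3 / (x - zetaPar (2 - Δ) β) * F2 (2 - Δ) β x) := by
    unfold F2' F2
    set y := x - zetaPar (2 - Δ) β with hyd
    have hy0 : 0 < |y| := abs_pos.mpr hy
    have e1 : |y| ^ (2 - (2 - Δ) - 4) = |y| ^ (2 - (2 - Δ) - 3) * |y|⁻¹ := by
      rw [← Real.rpow_neg_one, ← Real.rpow_add hy0]; congr 1; ring
    have e2 : Real.sign y * |y|⁻¹ = 1 / y := by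
      rcases lt_or_gt_of_ne hy with h | h
      · rw [Real.sign_of_neg h, abs_of_neg h]; field_simp
      · rw [Real.sign_of_pos h, abs_of_pos h]; field_simp
    rw [e1]
    linear_combination (-3 * (1 + β * Real.sign y) * (2 - (2 - Δ)) * |y| ^ (2 - (2 - Δ) - 3)) * e2
  rw [gMu, gApprox, gApprox', h]
  congr 1
  unfold F1' F1
  ring

lemma F1_eq (β Δ x : ℝ) : F1 (2 - Δ) β x =
    1 / (2 * Real.sqrt Real.pi) * Real.exp (-((x - zetaPar (2 - Δ) β) ^ 2) / 4) := rfl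

lemma sqrt_pi_bounds : 1 ≤ Real.sqrt Real.pi ∧ Real.sqrt Real.pi ≤ 2 := by
  constructor
  · rw [Real.one_le_sqrt]; linarith [Real.pi_gt_three]
  · rw [Real.sqrt_le_left (by norm_num)]; linarith [Real.pi_le_four]

lemma F1_bounds (β Δ x : ℝ) :
    1 / 4 * Real.exp (-((x - zetaPar (2 - Δ) β) ^ 2) / 4) ≤ F1 (2 - Δ) β x ∧
    F1 (2 - Δ) β x ≤ Real.exp (-((x - zetaPar (2 - Δ) β) ^ 2) / 4) := by
  obtain ⟨h1, h2⟩ := sqrt_pi_bounds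
  rw [F1_eq]
  have he := Real.exp_pos (-((x - zetaPar (2 - Δ) β) ^ 2) / 4)
  constructor
  · gcongr; linarith
  · have : 1 / (2 * Real.sqrt Real.pi) ≤ 1 := by
      rw [div_le_one (by linarith)]; linarith
    nlinarith

lemma F2_pos (β Δ x : ℝ) (h0 : 0 < Δ) (h1 : Δ < 1)
    (hy : 1 ≤ |x - zetaPar (2 - Δ) β|) (hβ : |β| < 1) : 0 < F2 (2 - Δ) β x := by
  refine lt_of_lt_of_le ?_ (F2_bounds β Δ x h0 h1 hy hβ).2
  have : 0 < 1 - |β| := by linarith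
  positivity

lemma F1_pos (β Δ x : ℝ) : 0 < F1 (2 - Δ) β x := normalDensity_pos _

lemma ne_of_abs {y : ℝ} (hy : 1 ≤ |y|) : y ≠ 0 := by
  intro h; rw [h] at hy; simp at hy; linarith

lemma sq_of_abs {y : ℝ} (hy : 1 ≤ |y|) : 1 ≤ y ^ 2 := by
  rw [← sq_abs]; nlinarith

lemma partC (β Δ x : ℝ) (h0 : 0 < Δ) (h1 : Δ < 1)
    (hy : 1 ≤ |x - zetaPar (2 - Δ) β|) (hβ : |β| < 1) :
    |gMu (2 - Δ) β x| ≤ 4 * |x - zetaPar (2 - Δ) β| := by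
  have p1 := F1_pos β Δ x
  have p2 := F2_pos β Δ x h0 h1 hy hβ
  rw [gMu_eq β Δ x (ne_of_abs hy)]
  generalize x - zetaPar (2 - Δ) β = y at *
  rw [abs_div, abs_of_pos (add_pos p1 p2), div_le_iff₀ (add_pos p1 p2)]
  refine (abs_add_le _ _).trans ?_
  rw [abs_mul, abs_mul, abs_div, abs_div, abs_of_pos p1, abs_of_pos p2]
  have : |(3 : ℝ)| / |y| ≤ 3 * |y| := by
    rw [div_le_iff₀ (by linarith)]; norm_num; nlinarith
  have h2 : |(2 : ℝ)| = 2 := by norm_num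
  rw [h2]
  have := mul_le_mul_of_nonneg_right this p2.le
  nlinarith

lemma rpow_eq_exp_log {Δ : ℝ} (h0 : 0 < Δ) (e : ℝ) : Δ ^ e = Real.exp (-(e * Real.log (1 / Δ))) := by
  rw [Real.rpow_def_of_pos h0, one_div, Real.log_inv]; congr 1; ring

lemma partA (β δ : ℝ) (hβ : |β| < 1) (hδ : 0 < δ) :
    ∃ e > δ / 2, ∀ Δ x : ℝ, 0 < Δ → Δ < 1 → 1 ≤ |x - zetaPar (2 - Δ) β| →
      |x - zetaPar (2 - Δ) β| ≤ (2 - δ) * Real.sqrt (Real.log (1 / Δ)) →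
      |gMu (2 - Δ) β x / ((x - zetaPar (2 - Δ) β) / 2) - 1| ≤ 48 * Δ ^ e := by
  by_cases hδ2 : δ < 2
  swap
  · refine ⟨δ, by linarith, ?_⟩
    intro Δ x h0 h1 hy hle
    exfalso
    have : (2 - δ) * Real.sqrt (Real.log (1 / Δ)) ≤ 0 :=
      mul_nonpos_of_nonpos_of_nonneg (by linarith) (Real.sqrt_nonneg _)
    linarith
  refine ⟨δ - δ ^ 2 / 4, by nlinarith, ?_⟩
  intro Δ x h0 h1 hy hle
  have p1 := F1_pos β Δ x
  have p2 := F2_pos β Δ x h0 h1 hy hβ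
  have b1 := (F1_bounds β Δ x).1
  have b2 := (F2_bounds β Δ x h0 h1 hy hβ).1
  rw [gMu_eq β Δ x (ne_of_abs hy)]
  generalize x - zetaPar (2 - Δ) β = y at *
  have hy0 := ne_of_abs hy
  have hy2 := sq_of_abs hy
  have hL : 0 < Real.log (1 / Δ) := Real.log_pos (by rw [lt_div_iff₀ h0]; linarith)
  have hysq : y ^ 2 ≤ (2 - δ) ^ 2 * Real.log (1 / Δ) := by
    rw [← sq_abs y]
    calc |y| ^ 2 ≤ ((2 - δ) * Real.sqrt (Real.log (1 / Δ))) ^ 2 := by gcongr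
      _ = _ := by rw [mul_pow, Real.sq_sqrt hL.le]
  have hE : Δ ^ (1 - (δ - δ ^ 2 / 4)) ≤ Real.exp (-(y ^ 2) / 4) := by
    rw [rpow_eq_exp_log h0]
    apply Real.exp_le_exp.mpr
    nlinarith
  have hmul : Δ ^ (1 - (δ - δ ^ 2 / 4)) * Δ ^ (δ - δ ^ 2 / 4) = Δ := by
    rw [← Real.rpow_add h0]; simp
  have hp : 0 < Δ ^ (δ - δ ^ 2 / 4) := Real.rpow_pos_of_pos h0 _
  generalize Δ ^ (δ - δ ^ 2 / 4) = P at *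
  generalize F1 (2 - Δ) β x = A at *
  generalize F2 (2 - Δ) β x = B at *
  have hq : B ≤ 8 * P * A := by
    have h3 : Δ ^ (1 - (δ - δ ^ 2 / 4)) ≤ 4 * A := by linarith
    have h4 := mul_le_mul_of_nonneg_right h3 hp.le
    rw [hmul] at h4; linarith
  have heq : (y / 2 * A + 3 / y * B) / (A + B) / (y / 2) - 1 = B * (6 / y ^ 2 - 1) / (A + B) := by
    have : A + B ≠ 0 := (add_pos p1 p2).ne'
    field_simp; ring
  have h6 : |6 / y ^ 2 - 1| ≤ 6 := by
    have h7 : 6 / y ^ 2 ≤ 6 := by rw [div_le_iff₀ (by linarith)]; linarith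
    have h8 : 0 < 6 / y ^ 2 := by positivity
    rw [abs_le]; constructor <;> linarith
  rw [heq, abs_div, abs_mul, abs_of_pos p2, abs_of_pos (add_pos p1 p2), div_le_iff₀ (add_pos p1 p2)]
  calc B * |6 / y ^ 2 - 1| ≤ 8 * P * A * 6 := by gcongr
    _ = 48 * P * A := by ring
    _ ≤ _ := by gcongr; linarith

lemma partB (β δ : ℝ) (hβ : |β| < 1) (hδ : 0 < δ) :
    ∃ e > δ / 2, ∃ C > (0 : ℝ), ∀ Δ x : ℝ, 0 < Δ → Δ < 1 → 1 ≤ |x - zetaPar (2 - Δ) β| →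
      (2 + δ) * Real.sqrt (Real.log (1 / Δ)) ≤ |x - zetaPar (2 - Δ) β| →
      |gMu (2 - Δ) β x / (3 / (x - zetaPar (2 - Δ) β)) - 1| ≤ C * Δ ^ e := by
  set q : ℝ := (1 + δ / 4) / (1 + δ / 2) with hq
  have hq1 : q < 1 := by rw [hq, div_lt_one (by linarith)]; linarith
  have hq0 : 0 < q := by positivity
  set m : ℝ := (1 - q) / 4 with hm
  have hm0 : 0 < m := by rw [hm]; linarith
  have hb0 : 0 < 1 - |β| := by linarith
  refine ⟨3 * δ / 4 + δ ^ 2 / 8, by nlinarith, 6 / m ^ 3 / (1 - |β|), by positivity, ?_⟩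
  intro Δ x h0 h1 hy hle
  have p1 := F1_pos β Δ x
  have p2 := F2_pos β Δ x h0 h1 hy hβ
  have b1 := (F1_bounds β Δ x).2
  have b2 := (F2_bounds β Δ x h0 h1 hy hβ).2
  rw [gMu_eq β Δ x (ne_of_abs hy)]
  generalize x - zetaPar (2 - Δ) β = y at *
  have hy0 := ne_of_abs hy
  have hy2 := sq_of_abs hy
  have hL : 0 < Real.log (1 / Δ) := Real.log_pos (by rw [lt_div_iff₀ h0]; linarith)
  have hysq : (2 + δ) ^ 2 * Real.log (1 / Δ) ≤ y ^ 2 := by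
    rw [← sq_abs y]
    calc _ = ((2 + δ) * Real.sqrt (Real.log (1 / Δ))) ^ 2 := by rw [mul_pow, Real.sq_sqrt hL.le]
      _ ≤ |y| ^ 2 := by gcongr
  have hE : Real.exp (-(q * y ^ 2 / 4)) ≤ Δ * Δ ^ (3 * δ / 4 + δ ^ 2 / 8) := by
    have : Δ * Δ ^ (3 * δ / 4 + δ ^ 2 / 8) = Δ ^ (1 + (3 * δ / 4 + δ ^ 2 / 8)) := by
      rw [Real.rpow_add h0 1 (3 * δ / 4 + δ ^ 2 / 8), Real.rpow_one]
    rw [this, rpow_eq_exp_log h0]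
    apply Real.exp_le_exp.mpr
    have h3 : q * (2 + δ) ^ 2 / 4 = 1 + (3 * δ / 4 + δ ^ 2 / 8) := by
      rw [hq]; field_simp; ring
    have h4 := mul_le_mul_of_nonneg_left hysq hq0.le
    rw [← h3]; linarith
  have hpoly : |y| ^ 5 * Real.exp (-(m * y ^ 2)) ≤ 6 / m ^ 3 := by
    have h3 := Real.pow_div_factorial_le_exp (m * y ^ 2) (by positivity) 3
    have h4 : |y| ^ 5 ≤ (y ^ 2) ^ 3 := by
      rw [← sq_abs, ← pow_mul]
      exact pow_le_pow_right₀ hy (by norm_num)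
    have h5 : ((3 : ℕ).factorial : ℝ) = 6 := by norm_num [Nat.factorial]
    rw [h5, div_le_iff₀ (by norm_num), mul_pow] at h3
    rw [Real.exp_neg, ← div_eq_mul_inv, div_le_iff₀ (Real.exp_pos _), div_mul_eq_mul_div,
      le_div_iff₀ (by positivity)]
    calc |y| ^ 5 * m ^ 3 ≤ (y ^ 2) ^ 3 * m ^ 3 := by gcongr
      _ ≤ _ := by linarith
  have hsplit : Real.exp (-(y ^ 2) / 4) = Real.exp (-(m * y ^ 2)) * Real.exp (-(q * y ^ 2 / 4)) := by
    rw [← Real.exp_add]; congr 1; rw [hm]; ring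
  have hp : 0 < Δ ^ (3 * δ / 4 + δ ^ 2 / 8) := Real.rpow_pos_of_pos h0 _
  generalize Δ ^ (3 * δ / 4 + δ ^ 2 / 8) = P at *
  generalize F1 (2 - Δ) β x = A at *
  generalize F2 (2 - Δ) β x = B at *
  have hya : 0 < |y| := by linarith
  have key : A * |y| ^ 2 ≤ 6 / m ^ 3 / (1 - |β|) * P * B := by
    calc A * |y| ^ 2 ≤ (Real.exp (-(m * y ^ 2)) * (Δ * P)) * |y| ^ 2 := by
          gcongr
          rw [hsplit] at b1
          exact b1.trans (by gcongr)
      _ = (|y| ^ 5 * Real.exp (-(m * y ^ 2))) * P * (Δ * (|y| ^ 3)⁻¹) := by field_simp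
      _ ≤ 6 / m ^ 3 * P * (Δ * (|y| ^ 3)⁻¹) := by gcongr
      _ = 6 / m ^ 3 / (1 - |β|) * P * ((1 - |β|) * Δ * (|y| ^ 3)⁻¹) := by field_simp
      _ ≤ _ := by gcongr
  have heq : (y / 2 * A + 3 / y * B) / (A + B) / (3 / y) - 1 = A * (y ^ 2 / 6 - 1) / (A + B) := by
    have : A + B ≠ 0 := (add_pos p1 p2).ne'
    field_simp; ring
  have h6 : |y ^ 2 / 6 - 1| ≤ |y| ^ 2 := by
    rw [sq_abs, abs_le]; constructor <;> linarith
  rw [heq, abs_div, abs_mul, abs_of_pos p1, abs_of_pos (add_pos p1 p2), div_le_iff₀ (add_pos p1 p2)]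
  calc A * |y ^ 2 / 6 - 1| ≤ A * |y| ^ 2 := by gcongr
    _ ≤ 6 / m ^ 3 / (1 - |β|) * P * B := key
    _ ≤ _ := by gcongr; linarith

lemma zeta_small (β : ℝ) : ∃ Δ₁ > (0 : ℝ), ∀ Δ : ℝ, 0 < Δ → Δ < Δ₁ → |zetaPar (2 - Δ) β| ≤ 1 := by
  have h : ContinuousAt (fun Δ : ℝ => |β * Real.tan (Real.pi * Δ / 2)|) 0 := by
    have : ContinuousAt (fun Δ : ℝ => Real.tan (Real.pi * Δ / 2)) 0 := by
      apply ContinuousAt.comp (g := Real.tan)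
      · exact Real.continuousAt_tan.mpr (by simp)
      · fun_prop
    fun_prop
  have h2 : Tendsto (fun Δ : ℝ => |β * Real.tan (Real.pi * Δ / 2)|) (𝓝 0) (𝓝 0) := by
    have := h.tendsto
    simpa using this
  have h3 := h2.eventually_lt_const one_pos
  rw [Metric.eventually_nhds_iff] at h3
  obtain ⟨η, hη, H⟩ := h3
  refine ⟨η, hη, ?_⟩
  intro Δ h0 h1
  rw [zetaPar_eq]
  apply le_of_lt
  apply H
  rw [Real.dist_eq, sub_zero, abs_of_pos h0]; exact h1

lemma rate_tendsto (C e d : ℝ) (h : d < e) :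
    Tendsto (fun Δ : ℝ => |C * Δ ^ e| / Δ ^ d) (𝓝[>] 0) (𝓝 0) := by
  have h1 : Tendsto (fun Δ : ℝ => |C| * Δ ^ (e - d)) (𝓝[>] 0) (𝓝 0) := by
    have h2 : Tendsto (fun Δ : ℝ => Δ ^ (e - d)) (𝓝 0) (𝓝 0) := by
      have := (Real.continuousAt_rpow_const 0 (e - d) (Or.inr (by linarith))).tendsto
      rwa [Real.zero_rpow (by linarith)] at this
    have := (h2.const_mul |C|).mono_left (nhdsWithin_le_nhds (s := Ioi (0:ℝ)))
    rwa [mul_zero] at this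
  refine h1.congr' ?_
  filter_upwards [self_mem_nhdsWithin] with Δ hΔ
  have hΔ : 0 < Δ := hΔ
  rw [abs_mul, abs_of_pos (Real.rpow_pos_of_pos hΔ e), Real.rpow_sub hΔ]; ring

theorem location_score_approximation (β : ℝ) (hβ : β ∈ Set.Ioo (-1 : ℝ) 1)
    (ε : ℝ) (hε : 0 < ε) :
    ∃ Δ₀ > (0 : ℝ), ∃ x₀ > (0 : ℝ),
      (∀ Δ : ℝ, 0 < Δ → Δ < Δ₀ → ∀ x : ℝ, x₀ < |x| →
        |(-deriv (stableDensity (2 - Δ) β) x / stableDensity (2 - Δ) β x) /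
            gMu (2 - Δ) β x - 1| < ε) ∧
      (∀ δ : ℝ, 0 < δ → ∃ r : ℝ → ℝ, (∀ Δ : ℝ, 0 ≤ r Δ) ∧
        Filter.Tendsto (fun Δ : ℝ => r Δ / Δ ^ (δ / 2)) (nhdsWithin 0 (Set.Ioi 0)) (nhds 0) ∧
        (∀ Δ : ℝ, 0 < Δ → Δ < Δ₀ → ∀ x : ℝ, x₀ < |x| →
          (|x - zetaPar (2 - Δ) β| ≤ (2 - δ) * Real.sqrt (Real.log (1 / Δ)) →
            |gMu (2 - Δ) β x / ((x - zetaPar (2 - Δ) β) / 2) - 1| ≤ r Δ) ∧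
          ((2 + δ) * Real.sqrt (Real.log (1 / Δ)) ≤ |x - zetaPar (2 - Δ) β| →
            |gMu (2 - Δ) β x / (3 / (x - zetaPar (2 - Δ) β)) - 1| ≤ r Δ)) ∧
        ∃ c > (0 : ℝ), ∀ Δ : ℝ, 0 < Δ → Δ < Δ₀ → ∀ x : ℝ, x₀ < |x| →
          (2 - δ) * Real.sqrt (Real.log (1 / Δ)) ≤ |x - zetaPar (2 - Δ) β| →
          |x - zetaPar (2 - Δ) β| ≤ (2 + δ) * Real.sqrt (Real.log (1 / Δ)) →
          |gMu (2 - Δ) β x| ≤ c * |x|) := by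
  have habs : |β| < 1 := abs_lt.mpr hβ
  obtain ⟨Δ₁, h1, Y, hY, H1⟩ := score_bound β hβ.1 hβ.2 ε hε
  obtain ⟨Δ₂, h2, H2⟩ := zeta_small β
  have hsmall : ∀ Δ : ℝ, 0 < Δ → Δ < min 1 (min Δ₁ Δ₂) → ∀ x : ℝ, Y + 2 < |x| →
      Δ < 1 ∧ Y + 1 < |x - zetaPar (2 - Δ) β| ∧ |x - zetaPar (2 - Δ) β| ≤ 2 * |x| := by
    intro Δ h0 hΔ x hx
    have hz := H2 Δ h0 (hΔ.trans_le ((min_le_right _ _).trans (min_le_right _ _)))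
    refine ⟨hΔ.trans_le (min_le_left _ _), ?_, ?_⟩
    · have := abs_sub_abs_le_abs_sub x (zetaPar (2 - Δ) β)
      linarith
    · have := abs_sub x (zetaPar (2 - Δ) β)
      linarith
  refine ⟨min 1 (min Δ₁ Δ₂), by positivity, Y + 2, by positivity, ?_, ?_⟩
  · intro Δ h0 hΔ x hx
    obtain ⟨a, b, c⟩ := hsmall Δ h0 hΔ x hx
    exact H1 Δ x h0 (hΔ.trans_le ((min_le_right _ _).trans (min_le_left _ _))) (by linarith)
  · intro δ hδ
    obtain ⟨e1, he1, HA⟩ := partA β δ habs hδ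
    obtain ⟨e2, he2, C, hC, HB⟩ := partB β δ habs hδ
    refine ⟨fun Δ => |48 * Δ ^ e1| + |C * Δ ^ e2|, fun Δ => by positivity, ?_, ?_, 8, by norm_num, ?_⟩
    · have := (rate_tendsto 48 e1 (δ / 2) he1).add (rate_tendsto C e2 (δ / 2) he2)
      rw [add_zero] at this
      refine this.congr ?_
      intro Δ
      rw [add_div]
    · intro Δ h0 hΔ x hx
      obtain ⟨a, b, c⟩ := hsmall Δ h0 hΔ x hx
      constructor
      · intro h
        refine (HA Δ x h0 a (by linarith) h).trans ((le_abs_self _).trans ?_)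
        exact le_add_of_nonneg_right (abs_nonneg _)
      · intro h
        refine (HB Δ x h0 a (by linarith) h).trans ((le_abs_self _).trans ?_)
        exact le_add_of_nonneg_left (abs_nonneg _)
    · intro Δ h0 hΔ x hx _ _
      obtain ⟨a, b, c⟩ := hsmall Δ h0 hΔ x hx
      have := partC β Δ x h0 a (by linarith) habs
      linarith
end

section
/- Fix β ∈ (−1,1). There exist x₀ > 0, Δ₀ > 0 and C > 0 such that for all α = 2−Δ with 0 < Δ < Δ₀ and all real x with |x| ≥ x₀, writing y = x−ζ and β* = β·sgn(y): | f_α(x;α,β) + (1+β*)/|y|^{1+α} | ≤ C·|y|^{−1−α}·( Δ·(1+log|y|) + 1/|y| + (1+log|y|)/|y|^α ), where f_α(x;α,β) denotes the partial derivative of the density f(x;α,β) with respect to α. -/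
open MeasureTheory Filter Set Topology Real

/-- Partial derivative of the stable density with respect to α. -/
noncomputable def fAlpha (α β x : ℝ) : ℝ := deriv (fun a : ℝ => stableDensity a β x) α

/-- Partial derivative of the stable density with respect to β. -/
noncomputable def fBeta (α β x : ℝ) : ℝ := deriv (fun b : ℝ => stableDensity α b x) β

/-- Derivative of the stable density in x. -/
noncomputable def fX (α β x : ℝ) : ℝ := deriv (stableDensity α β) x

/-- The scale score numerator f_σ = −f − x·f′. -/
noncomputable def fSig (α β x : ℝ) : ℝ := -stableDensity α β x - x * fX α β x


namespace StableAux

lemma expint (c : ℝ) (hc : 0 < c) (n : ℕ) :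
    IntegrableOn (fun u : ℝ => Real.exp (-(c * u)) * (1 + u ^ n)) (Ioi 0) := by
  have h1 := integrableOn_rpow_mul_exp_neg_mul_rpow (p := 1) (s := 0) (b := c)
    (by norm_num) one_pos hc
  have h2 := integrableOn_rpow_mul_exp_neg_mul_rpow (p := 1) (s := (n : ℝ)) (b := c)
    (by have : (0 : ℝ) ≤ n := n.cast_nonneg
        linarith) one_pos hc
  have h := h1.add h2
  refine h.congr_fun (fun u hu => ?_) measurableSet_Ioi
  simp only [Pi.add_apply, Real.rpow_zero, Real.rpow_one, Real.rpow_natCast]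
  rw [neg_mul]
  ring

lemma cov {E : Type*} [NormedAddCommGroup E] [NormedSpace ℝ E] (g : ℝ → E) :
    ∫ u in Ioi (0 : ℝ), g u = ∫ s : ℝ, Real.exp s • g (Real.exp s) := by
  have h := integral_image_eq_integral_abs_deriv_smul (s := univ) (f := Real.exp)
    (f' := Real.exp) MeasurableSet.univ
    (fun x _ => (Real.hasDerivAt_exp x).hasDerivWithinAt) (Real.exp_injective.injOn) g
  rw [image_univ, Real.range_exp] at h
  simpa [abs_of_pos (Real.exp_pos _)] using h

lemma cov_int {E : Type*} [NormedAddCommGroup E] [NormedSpace ℝ E] (g : ℝ → E) :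
    IntegrableOn g (Ioi (0 : ℝ)) ↔ Integrable (fun s : ℝ => Real.exp s • g (Real.exp s)) := by
  have h := integrableOn_image_iff_integrableOn_abs_deriv_smul (s := univ) (f := Real.exp)
    (f' := Real.exp) MeasurableSet.univ
    (fun x _ => (Real.hasDerivAt_exp x).hasDerivWithinAt) (Real.exp_injective.injOn) g
  rw [image_univ, Real.range_exp] at h
  simpa [abs_of_pos (Real.exp_pos _)] using h

/-- Dominating function on horizontal lines. -/
noncomputable def Bd (c s : ℝ) : ℝ :=
  Real.exp s * (Real.exp (-(c * Real.exp s)) * (1 + (Real.exp s) ^ 3))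

lemma Bd_int (c : ℝ) (hc : 0 < c) : Integrable (Bd c) :=
  (cov_int _).1 (expint c hc 3)

lemma Bd_atBot (c : ℝ) : Tendsto (Bd c) atBot (𝓝 0) := by
  have h : Continuous (fun u : ℝ => u * (Real.exp (-(c * u)) * (1 + u ^ 3))) := by fun_prop
  have h2 := (h.tendsto 0).comp Real.tendsto_exp_atBot
  simpa [Bd, Function.comp_def] using! h2

lemma Bd_atTop (c : ℝ) (hc : 0 < c) : Tendsto (Bd c) atTop (𝓝 0) := by
  have h1 := tendsto_rpow_mul_exp_neg_mul_atTop_nhds_zero 1 c hc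
  have h4 := tendsto_rpow_mul_exp_neg_mul_atTop_nhds_zero 4 c hc
  have h := (h1.add h4).comp Real.tendsto_exp_atTop
  rw [add_zero] at h
  refine h.congr (fun s => ?_)
  simp only [Bd, Function.comp_apply, Real.rpow_one]
  rw [show (4 : ℝ) = ((4 : ℕ) : ℝ) by norm_num, Real.rpow_natCast, neg_mul]
  ring

lemma shift (h : ℂ → ℂ) (hd : Differentiable ℂ h) (a b : ℝ) (hab : a ≤ b) (M c : ℝ)
    (hc : 0 < c)
    (hb : ∀ s τ : ℝ, a ≤ τ → τ ≤ b → ‖h (s + τ * Complex.I)‖ ≤ M * Bd c s) :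
    Integrable (fun s : ℝ => h (s + a * Complex.I)) ∧
    Integrable (fun s : ℝ => h (s + b * Complex.I)) ∧
    ∫ s : ℝ, h (s + a * Complex.I) = ∫ s : ℝ, h (s + b * Complex.I) := by
  have hcont : Continuous h := hd.continuous
  have hI : ∀ τ : ℝ, a ≤ τ → τ ≤ b → Integrable (fun s : ℝ => h (s + τ * Complex.I)) := by
    intro τ h1 h2
    refine ((Bd_int c hc).const_mul M).mono' ?_ (ae_of_all _ fun s => hb s τ h1 h2)
    exact (by fun_prop : Continuous (fun s : ℝ => h (s + τ * Complex.I))).aestronglyMeasurable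
  refine ⟨hI a le_rfl hab, hI b hab le_rfl, ?_⟩
  have hT : Tendsto (fun R : ℝ => (-R)) atTop atBot := tendsto_neg_atTop_atBot
  have t1 := intervalIntegral_tendsto_integral (hI a le_rfl hab) hT tendsto_id
  have t2 := intervalIntegral_tendsto_integral (hI b hab le_rfl) hT tendsto_id
  have hv : ∀ s : ℝ, ‖∫ y : ℝ in a..b, h (s + y * Complex.I)‖ ≤ M * Bd c s * |b - a| := by
    intro s
    refine intervalIntegral.norm_integral_le_of_norm_le_const (fun y hy => ?_)
    rw [uIoc_of_le hab] at hy
    exact hb s y hy.1.le hy.2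
  have t3 : Tendsto (fun R : ℝ => ∫ y : ℝ in a..b, h ((R : ℝ) + y * Complex.I)) atTop (𝓝 0) := by
    refine squeeze_zero_norm (fun R => hv R) ?_
    simpa using ((Bd_atTop c hc).const_mul M).mul_const (|b - a|)
  have t4 : Tendsto (fun R : ℝ => ∫ y : ℝ in a..b, h (((-R : ℝ) : ℂ) + y * Complex.I)) atTop
      (𝓝 0) := by
    refine squeeze_zero_norm (fun R => hv (-R)) ?_
    simpa using! (((Bd_atBot c).comp hT).const_mul M).mul_const (|b - a|)
  have key := ((t1.sub t2).add (t3.const_smul Complex.I)).sub (t4.const_smul Complex.I)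
  have hz : ∀ R : ℝ, (((∫ x : ℝ in (-R)..R, h (x + a * Complex.I)) -
      (∫ x : ℝ in (-R)..R, h (x + b * Complex.I))) +
      Complex.I • (∫ y : ℝ in a..b, h ((R : ℝ) + y * Complex.I))) -
      Complex.I • (∫ y : ℝ in a..b, h (((-R : ℝ) : ℂ) + y * Complex.I)) = 0 := by
    intro R
    have := Complex.integral_boundary_rect_eq_zero_of_differentiableOn h
      ⟨-R, a⟩ ⟨R, b⟩ hd.differentiableOn
    simpa using this
  have key2 := tendsto_nhds_unique key (tendsto_const_nhds.congr (fun R => (hz R).symm))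
  simp only [smul_zero, add_zero, sub_zero] at key2
  exact sub_eq_zero.1 key2

lemma exp_sub_one_le (w : ℂ) (hw : 0 ≤ w.re) : ‖Complex.exp (-w) - 1‖ ≤ 2 * ‖w‖ := by
  by_cases h : ‖w‖ ≤ 1
  · have := Complex.norm_exp_sub_one_le (x := -w) (by simpa using h)
    simpa using this
  · have h1 : ‖Complex.exp (-w)‖ ≤ 1 := by
      rw [Complex.norm_exp]; simpa using hw
    have h2 := norm_sub_le (Complex.exp (-w)) 1
    rw [norm_one] at h2
    push Not at h
    linarith

lemma rpow_log_le (p v : ℝ) (h1 : 1 ≤ p) (h4 : p ≤ 4) (hv : 0 < v) :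
    v ^ p * (1 + |Real.log v|) ≤ 2 * (1 + v ^ 5) := by
  rcases le_total v 1 with h | h
  · have e1 : v ^ p ≤ v := by
      simpa using Real.rpow_le_rpow_of_exponent_ge hv h h1
    have e2 := (Real.abs_log_mul_self_lt v hv h).le
    rw [abs_mul, abs_of_pos hv] at e2
    have e3 : v ^ p * (1 + |Real.log v|) ≤ v * (1 + |Real.log v|) := by gcongr
    have e4 : 0 < v ^ 5 := by positivity
    nlinarith
  · have e1 : v ^ p ≤ v ^ 4 := by
      rw [← Real.rpow_natCast]; exact Real.rpow_le_rpow_of_exponent_le h (by simpa using h4)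
    have e2 : |Real.log v| ≤ v := by
      rw [abs_of_nonneg (Real.log_nonneg h)]; linarith [Real.log_le_sub_one_of_pos hv]
    have e3 : v ^ p * (1 + |Real.log v|) ≤ v ^ 4 * (1 + v) := by gcongr
    have e4 : v ^ 4 ≤ v ^ 5 := pow_le_pow_right₀ h (by norm_num)
    nlinarith

/-- Constant for the Gamma-type integrals. -/
noncomputable def KK : ℝ := ∫ v in Ioi (0 : ℝ), 2 * (Real.exp (-(1 / 8 * v)) * (1 + v ^ 5))

lemma KK_nonneg : 0 ≤ KK := by
  refine setIntegral_nonneg measurableSet_Ioi (fun v hv => ?_)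
  have : (0 : ℝ) < v := hv
  positivity

lemma log_int (p y : ℝ) (h1 : 1 ≤ p) (h4 : p ≤ 4) (hy : 1 ≤ y) :
    IntegrableOn (fun u : ℝ => Real.exp (-(1 / 8 * (y * u))) * (u ^ p * (1 + |Real.log u|))) (Ioi 0)
    ∧ ∫ u in Ioi (0 : ℝ), Real.exp (-(1 / 8 * (y * u))) * (u ^ p * (1 + |Real.log u|)) ≤
      KK * y ^ (-(p + 1)) * (1 + Real.log y) := by
  have hy0 : 0 < y := by linarith
  have hly := Real.log_nonneg hy
  have hI5 : IntegrableOn (fun v : ℝ => 2 * (Real.exp (-(1 / 8 * v)) * (1 + v ^ 5))) (Ioi 0) :=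
    (expint (1 / 8) (by norm_num) 5).const_mul 2
  have hI5' := (integrableOn_Ioi_comp_mul_left_iff
    (fun v : ℝ => 2 * (Real.exp (-(1 / 8 * v)) * (1 + v ^ 5))) 0 hy0).2
    (by rw [mul_zero]; exact hI5)
  have hK := integral_comp_mul_left_Ioi
    (fun v : ℝ => 2 * (Real.exp (-(1 / 8 * v)) * (1 + v ^ 5))) 0 hy0
  rw [mul_zero] at hK
  change _ = y⁻¹ • KK at hK
  have hb : ∀ u ∈ Ioi (0 : ℝ),
      Real.exp (-(1 / 8 * (y * u))) * (u ^ p * (1 + |Real.log u|)) ≤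
      (y ^ (-p) * (1 + Real.log y)) *
        (2 * (Real.exp (-(1 / 8 * (y * u))) * (1 + (y * u) ^ 5))) := by
    intro u hu
    have hu : 0 < u := hu
    have hv : 0 < y * u := by positivity
    have e0 := rpow_log_le p (y * u) h1 h4 hv
    have e1 : u ^ p = y ^ (-p) * (y * u) ^ p := by
      rw [Real.mul_rpow hy0.le hu.le, ← mul_assoc, ← Real.rpow_add hy0]; simp
    have e2 : 1 + |Real.log u| ≤ (1 + Real.log y) * (1 + |Real.log (y * u)|) := by
      have : Real.log u = Real.log (y * u) - Real.log y := by
        rw [Real.log_mul hy0.ne' hu.ne']; ring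
      have h3 : |Real.log u| ≤ |Real.log (y * u)| + Real.log y := by
        rw [this]; exact (abs_sub _ _).trans (by rw [abs_of_nonneg hly])
      nlinarith [mul_nonneg hly (abs_nonneg (Real.log (y * u)))]
    calc _ ≤ Real.exp (-(1 / 8 * (y * u))) * ((y ^ (-p) * (y * u) ^ p) *
          ((1 + Real.log y) * (1 + |Real.log (y * u)|))) := by
            rw [e1]; gcongr
      _ = (y ^ (-p) * (1 + Real.log y)) * (Real.exp (-(1 / 8 * (y * u))) *
          ((y * u) ^ p * (1 + |Real.log (y * u)|))) := by ring
      _ ≤ (y ^ (-p) * (1 + Real.log y)) * (Real.exp (-(1 / 8 * (y * u))) *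
          (2 * (1 + (y * u) ^ 5))) := by gcongr
      _ = _ := by ring
  have hI : IntegrableOn (fun u : ℝ => Real.exp (-(1 / 8 * (y * u))) *
      (u ^ p * (1 + |Real.log u|))) (Ioi 0) := by
    refine Integrable.mono' (hI5'.const_mul (y ^ (-p) * (1 + Real.log y))) ?_ ?_
    · exact Measurable.aestronglyMeasurable (by fun_prop)
    · refine (ae_restrict_iff' measurableSet_Ioi).2 (ae_of_all _ fun u hu => ?_)
      have hu0 : (0 : ℝ) < u := hu
      rw [Real.norm_of_nonneg (by positivity)]
      exact hb u hu
  refine ⟨hI, ?_⟩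
  have := setIntegral_mono_on hI (hI5'.const_mul (y ^ (-p) * (1 + Real.log y)))
    measurableSet_Ioi hb
  refine this.trans_eq ?_
  rw [integral_const_mul, hK, neg_add, Real.rpow_add hy0, Real.rpow_neg_one, smul_eq_mul]
  ring

lemma pow_int (p y : ℝ) (h1 : 1 ≤ p) (h4 : p ≤ 4) (hy : 1 ≤ y) :
    IntegrableOn (fun u : ℝ => Real.exp (-(1 / 8 * (y * u))) * u ^ p) (Ioi 0)
    ∧ ∫ u in Ioi (0 : ℝ), Real.exp (-(1 / 8 * (y * u))) * u ^ p ≤ KK * y ^ (-(p + 1)) := by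
  have hy0 : 0 < y := by linarith
  have hI5 : IntegrableOn (fun v : ℝ => 2 * (Real.exp (-(1 / 8 * v)) * (1 + v ^ 5))) (Ioi 0) :=
    (expint (1 / 8) (by norm_num) 5).const_mul 2
  have hI5' := (integrableOn_Ioi_comp_mul_left_iff
    (fun v : ℝ => 2 * (Real.exp (-(1 / 8 * v)) * (1 + v ^ 5))) 0 hy0).2
    (by rw [mul_zero]; exact hI5)
  have hK := integral_comp_mul_left_Ioi
    (fun v : ℝ => 2 * (Real.exp (-(1 / 8 * v)) * (1 + v ^ 5))) 0 hy0
  rw [mul_zero] at hK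
  change _ = y⁻¹ • KK at hK
  have hb : ∀ u ∈ Ioi (0 : ℝ), Real.exp (-(1 / 8 * (y * u))) * u ^ p ≤
      y ^ (-p) * (2 * (Real.exp (-(1 / 8 * (y * u))) * (1 + (y * u) ^ 5))) := by
    intro u hu
    have hu : 0 < u := hu
    have hv : 0 < y * u := by positivity
    have e0 := rpow_log_le p (y * u) h1 h4 hv
    have e00 : (y * u) ^ p ≤ 2 * (1 + (y * u) ^ 5) := by
      refine le_trans ?_ e0
      nlinarith [mul_nonneg (Real.rpow_pos_of_pos hv p).le (abs_nonneg (Real.log (y * u)))]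
    have e1 : u ^ p = y ^ (-p) * (y * u) ^ p := by
      rw [Real.mul_rpow hy0.le hu.le, ← mul_assoc, ← Real.rpow_add hy0]; simp
    calc _ = y ^ (-p) * (Real.exp (-(1 / 8 * (y * u))) * (y * u) ^ p) := by
            rw [e1]; ring
      _ ≤ y ^ (-p) * (Real.exp (-(1 / 8 * (y * u))) * (2 * (1 + (y * u) ^ 5))) := by gcongr
      _ = _ := by ring
  have hI : IntegrableOn (fun u : ℝ => Real.exp (-(1 / 8 * (y * u))) * u ^ p) (Ioi 0) := by
    refine Integrable.mono' (hI5'.const_mul (y ^ (-p))) ?_ ?_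
    · exact Measurable.aestronglyMeasurable (by fun_prop)
    · refine (ae_restrict_iff' measurableSet_Ioi).2 (ae_of_all _ fun u hu => ?_)
      have hu0 : (0 : ℝ) < u := hu
      rw [Real.norm_of_nonneg (by positivity)]
      exact hb u hu
  refine ⟨hI, ?_⟩
  have := setIntegral_mono_on hI (hI5'.const_mul (y ^ (-p))) measurableSet_Ioi hb
  refine this.trans_eq ?_
  rw [integral_const_mul, hK, neg_add, Real.rpow_add hy0, Real.rpow_neg_one, smul_eq_mul]
  ring

/-- Polynomial-logarithmic factor in the variable `z = log t`. -/
noncomputable def PP (α ζ q : ℝ) (z : ℂ) : ℂ :=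
  Complex.I * q * (Complex.exp z - Complex.exp (α * z)) -
    (1 + Complex.I * ζ) * z * Complex.exp (α * z)

/-- Undamped integrand. -/
noncomputable def Hm (α ζ q y : ℝ) (z : ℂ) : ℂ :=
  Complex.exp z * Complex.exp (-(Complex.I * y * Complex.exp z)) * PP α ζ q z

/-- Full integrand. -/
noncomputable def HH (α ζ q y : ℝ) (z : ℂ) : ℂ :=
  Hm α ζ q y z * Complex.exp (-((1 + Complex.I * ζ) * Complex.exp (α * z)))

lemma PP_diff (α ζ q : ℝ) : Differentiable ℂ (PP α ζ q) := by
  unfold PP; fun_prop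

lemma Hm_diff (α ζ q y : ℝ) : Differentiable ℂ (Hm α ζ q y) := by
  have := PP_diff α ζ q
  unfold Hm; fun_prop

lemma HH_diff (α ζ q y : ℝ) : Differentiable ℂ (HH α ζ q y) := by
  have := Hm_diff α ζ q y
  unfold HH; fun_prop

lemma norm_exp1 (s τ : ℝ) : ‖Complex.exp (s + τ * Complex.I)‖ = Real.exp s := by
  rw [Complex.norm_exp]; simp

lemma exp_alpha (α s τ : ℝ) : Complex.exp (α * (s + τ * Complex.I)) =
    ((Real.exp (α * s) * Real.cos (α * τ) : ℝ) : ℂ) +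
    ((Real.exp (α * s) * Real.sin (α * τ) : ℝ) : ℂ) * Complex.I := by
  rw [show (α : ℂ) * (s + τ * Complex.I) = ((α * s : ℝ) : ℂ) + ((α * τ : ℝ) : ℂ) * Complex.I by
    push_cast; ring, Complex.exp_add, Complex.exp_mul_I]
  push_cast; ring

lemma exp_one' (s τ : ℝ) : Complex.exp (s + τ * Complex.I) =
    ((Real.exp s * Real.cos τ : ℝ) : ℂ) + ((Real.exp s * Real.sin τ : ℝ) : ℂ) * Complex.I := by
  have := exp_alpha 1 s τ
  simpa using this

lemma norm_exp2 (α s τ : ℝ) : ‖Complex.exp (α * (s + τ * Complex.I))‖ = Real.exp (α * s) := by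
  rw [Complex.norm_exp]; simp

lemma norm_osc (y s τ : ℝ) : ‖Complex.exp (-(Complex.I * y * Complex.exp (s + τ * Complex.I)))‖ =
    Real.exp (y * Real.exp s * Real.sin τ) := by
  rw [Complex.norm_exp, exp_one', mul_assoc y]
  congr 1
  generalize Real.exp s * Real.cos τ = a
  generalize Real.exp s * Real.sin τ = b
  simp

lemma re_damp (α ζ s τ : ℝ) : ((1 + Complex.I * ζ) * Complex.exp (α * (s + τ * Complex.I))).re =
    Real.exp (α * s) * (Real.cos (α * τ) - ζ * Real.sin (α * τ)) := by
  rw [exp_alpha, show Real.exp (α * s) * (Real.cos (α * τ) - ζ * Real.sin (α * τ)) =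
    Real.exp (α * s) * Real.cos (α * τ) - ζ * (Real.exp (α * s) * Real.sin (α * τ)) by ring]
  generalize Real.exp (α * s) * Real.cos (α * τ) = a
  generalize Real.exp (α * s) * Real.sin (α * τ) = b
  simp

lemma norm_one_add (ζ : ℝ) (h : |ζ| ≤ 1) : ‖1 + Complex.I * (ζ : ℂ)‖ ≤ 2 := by
  refine (norm_add_le _ _).trans ?_
  simp
  linarith

lemma PP_bound (α ζ q s τ : ℝ) (hζ : |ζ| ≤ 1) (hq : |q| ≤ 4) (hτ : |τ| ≤ 2) :
    ‖PP α ζ q (s + τ * Complex.I)‖ ≤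
      8 * (Real.exp s + Real.exp (α * s) * (1 + |s|)) := by
  have e1 : ‖Complex.I * (q : ℂ) * (Complex.exp (s + τ * Complex.I) -
      Complex.exp (α * (s + τ * Complex.I)))‖ ≤ 4 * (Real.exp s + Real.exp (α * s)) := by
    rw [norm_mul]
    have := norm_sub_le (Complex.exp (s + τ * Complex.I)) (Complex.exp (α * (s + τ * Complex.I)))
    rw [norm_exp1, norm_exp2] at this
    have h2 : ‖Complex.I * (q : ℂ)‖ ≤ 4 := by simpa using hq
    gcongr
  have e2 : ‖(1 + Complex.I * (ζ : ℂ)) * (s + τ * Complex.I) *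
      Complex.exp (α * (s + τ * Complex.I))‖ ≤ 2 * (|s| + 2) * Real.exp (α * s) := by
    rw [norm_mul, norm_mul, norm_exp2]
    have h1 := norm_one_add ζ hζ
    have h2 : ‖(s : ℂ) + τ * Complex.I‖ ≤ |s| + 2 := by
      refine (norm_add_le _ _).trans ?_
      simp
      exact hτ
    gcongr
  have h := (norm_sub_le _ _).trans (add_le_add e1 e2)
  refine h.trans ?_
  have := Real.exp_pos s
  have := mul_nonneg (Real.exp_pos (α * s)).le (abs_nonneg s)
  nlinarith

lemma exp_abs_le (α s : ℝ) (h1 : 1 ≤ α) (h2 : α ≤ 2) :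
    Real.exp (α * s) * (1 + |s|) ≤ 2 * (1 + (Real.exp s) ^ 3) := by
  have hpos := Real.exp_pos s
  rcases le_total s 0 with h | h
  · have e1 : Real.exp (α * s) ≤ Real.exp s := Real.exp_le_exp.2 (by nlinarith)
    have e3 : Real.exp s * (1 + |s|) ≤ 1 := by
      rw [abs_of_nonpos h]
      have := Real.add_one_le_exp (-s)
      calc Real.exp s * (1 + -s) ≤ Real.exp s * Real.exp (-s) := by gcongr; linarith
        _ = 1 := by rw [← Real.exp_add]; simp
    have e4 : Real.exp (α * s) * (1 + |s|) ≤ Real.exp s * (1 + |s|) := by gcongr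
    have : 0 < (Real.exp s) ^ 3 := by positivity
    linarith
  · rw [abs_of_nonneg h]
    have e1 : Real.exp (α * s) ≤ (Real.exp s) ^ 2 := by
      rw [← Real.exp_nat_mul]; exact Real.exp_le_exp.2 (by push_cast; nlinarith)
    have e2 : 1 + s ≤ Real.exp s := by linarith [Real.add_one_le_exp s]
    calc _ ≤ (Real.exp s) ^ 2 * Real.exp s := by gcongr
      _ ≤ _ := by nlinarith [pow_pos hpos 3]

lemma PP_bound2 (α ζ q s τ : ℝ) (h1 : 1 ≤ α) (h2 : α ≤ 2) (hζ : |ζ| ≤ 1) (hq : |q| ≤ 4)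
    (hτ : |τ| ≤ 2) :
    ‖PP α ζ q (s + τ * Complex.I)‖ ≤ 24 * (1 + (Real.exp s) ^ 3) := by
  have h := PP_bound α ζ q s τ hζ hq hτ
  have e := exp_abs_le α s h1 h2
  have hpos := Real.exp_pos s
  have : Real.exp s ≤ 1 + (Real.exp s) ^ 3 := by
    nlinarith [sq_nonneg (Real.exp s - 1), mul_nonneg hpos.le (sq_nonneg (Real.exp s - 1))]
  linarith

lemma Hm_norm (α ζ q y s τ : ℝ) : ‖Hm α ζ q y (s + τ * Complex.I)‖ =
    Real.exp s * Real.exp (y * Real.exp s * Real.sin τ) * ‖PP α ζ q (s + τ * Complex.I)‖ := by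
  rw [Hm, norm_mul, norm_mul, norm_exp1, norm_osc]

lemma quarter_sin : (1 : ℝ) / 8 ≤ Real.sin (1 / 4) := by
  have := Real.sin_gt_sub_cube (x := 1 / 4) (by norm_num)
  norm_num at this ⊢
  linarith

lemma damp_re (α ζ s τ : ℝ) (h1 : 1 ≤ α) (h2 : α ≤ 2) (hζ : |ζ| ≤ 1 / 4)
    (hτ : |τ| ≤ 1 / 4) :
    1 / 2 * Real.exp (α * s) ≤
      ((1 + Complex.I * ζ) * Complex.exp (α * (s + τ * Complex.I))).re := by
  rw [re_damp, mul_comm]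
  have hat : |α * τ| ≤ 1 / 2 := by
    rw [abs_mul, abs_of_nonneg (by linarith : (0 : ℝ) ≤ α)]
    nlinarith [abs_nonneg τ]
  have hc := Real.one_sub_sq_div_two_le_cos (x := α * τ)
  have hsq : (α * τ) ^ 2 ≤ (1 / 2) ^ 2 := sq_le_sq' (by linarith [neg_le_of_abs_le hat])
    (le_of_abs_le hat)
  have hzs : |ζ * Real.sin (α * τ)| ≤ 1 / 4 := by
    rw [abs_mul]
    nlinarith [Real.abs_sin_le_one (α * τ), abs_nonneg ζ, abs_nonneg (Real.sin (α * τ))]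
  have := le_of_abs_le hzs
  gcongr
  nlinarith

lemma shift1 (α ζ q y : ℝ) (h1 : 1 ≤ α) (h2 : α ≤ 2) (hζ : |ζ| ≤ 1 / 4) (hq : |q| ≤ 4)
    (hy : 1 ≤ y) :
    Integrable (fun s : ℝ => HH α ζ q y (s + ((-(1 / 4) : ℝ) : ℂ) * Complex.I)) ∧
    ∫ s : ℝ, HH α ζ q y (s + ((-(1 / 4) : ℝ) : ℂ) * Complex.I) = ∫ s : ℝ, HH α ζ q y s := by
  have h := shift (HH α ζ q y) (HH_diff α ζ q y) (-(1 / 4)) 0 (by norm_num) (48) (1 / 2)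
    (by norm_num) ?_
  · refine ⟨h.1, h.2.2.trans ?_⟩
    simp
  · intro s τ ha hb
    have hτ : |τ| ≤ 1 / 4 := abs_le.2 ⟨ha, by linarith⟩
    rw [HH, norm_mul, Hm_norm, Complex.norm_exp, Complex.neg_re]
    have e1 : Real.exp (y * Real.exp s * Real.sin τ) ≤ 1 := by
      rw [Real.exp_le_one_iff]
      have : Real.sin τ ≤ 0 := Real.sin_nonpos_of_nonpos_of_neg_pi_le hb
        (by linarith [Real.pi_gt_three])
      have : 0 < y * Real.exp s := by positivity
      nlinarith
    have e2 := PP_bound2 α ζ q s τ h1 h2 (by linarith) hq (by linarith)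
    have e3 := damp_re α ζ s τ h1 h2 hζ hτ
    have e4 : Real.exp s - 1 ≤ Real.exp (α * s) := by
      rcases le_total s 0 with h | h
      · have := Real.exp_le_one_iff.2 h
        linarith [Real.exp_pos (α * s)]
      · have : Real.exp s ≤ Real.exp (α * s) := Real.exp_le_exp.2 (by nlinarith)
        linarith
    have e5 : Real.exp (-((1 + Complex.I * ζ) * Complex.exp (α * (s + τ * Complex.I))).re) ≤
        2 * Real.exp (-(1 / 2 * Real.exp s)) := by
      have : Real.exp (-((1 + Complex.I * ζ) * Complex.exp (α * (s + τ * Complex.I))).re) ≤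
        Real.exp (1 / 2 + -(1 / 2 * Real.exp s)) := Real.exp_le_exp.2 (by linarith)
      rw [Real.exp_add] at this
      refine this.trans ?_
      gcongr
      have h4 : Real.exp (1 / 2) ^ 2 ≤ 2 ^ 2 := by
        rw [← Real.exp_nat_mul]
        norm_num
        linarith [Real.exp_one_lt_d9]
      exact le_of_sq_le_sq h4 (by norm_num)
    calc _ ≤ Real.exp s * 1 * (24 * (1 + (Real.exp s) ^ 3)) *
          (2 * Real.exp (-(1 / 2 * Real.exp s))) := by gcongr
      _ = _ := by rw [Bd]; ring

lemma shift2 (α ζ q y : ℝ) (h1 : 1 ≤ α) (h2 : α ≤ 2) (hζ : |ζ| ≤ 1 / 4) (hq : |q| ≤ 4)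
    (hy : 1 ≤ y) :
    Integrable (fun s : ℝ => Hm α ζ q y (s + ((-(Real.pi / 2) : ℝ) : ℂ) * Complex.I)) ∧
    Integrable (fun s : ℝ => Hm α ζ q y (s + ((-(1 / 4) : ℝ) : ℂ) * Complex.I)) ∧
    ∫ s : ℝ, Hm α ζ q y (s + ((-(Real.pi / 2) : ℝ) : ℂ) * Complex.I) =
      ∫ s : ℝ, Hm α ζ q y (s + ((-(1 / 4) : ℝ) : ℂ) * Complex.I) := by
  have hpi3 := Real.pi_gt_three
  have hpi4 := Real.pi_lt_four
  refine shift (Hm α ζ q y) (Hm_diff α ζ q y) (-(Real.pi / 2)) (-(1 / 4)) (by linarith) 24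
    (1 / 8 * y) (by positivity) ?_
  intro s τ ha hb
  rw [Hm_norm]
  have hτ : |τ| ≤ 2 := abs_le.2 ⟨by linarith, by linarith⟩
  have e2 := PP_bound2 α ζ q s τ h1 h2 (by linarith) hq hτ
  have e1 : Real.exp (y * Real.exp s * Real.sin τ) ≤ Real.exp (-(1 / 8 * y * Real.exp s)) := by
    apply Real.exp_le_exp.2
    have h3 : Real.sin τ ≤ Real.sin (-(1 / 4)) :=
      Real.sin_le_sin_of_le_of_le_pi_div_two (by linarith) (by linarith) hb
    rw [Real.sin_neg] at h3
    have h4 := quarter_sin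
    have : 0 < y * Real.exp s := by positivity
    nlinarith
  calc _ ≤ Real.exp s * Real.exp (-(1 / 8 * y * Real.exp s)) * (24 * (1 + (Real.exp s) ^ 3)) := by
        gcongr
    _ = _ := by rw [Bd]; ring

/-- The remainder estimate on the rotated ray. -/
lemma remainder (α ζ q y : ℝ) (h1 : 1 ≤ α) (h2 : α ≤ 2) (hζ : |ζ| ≤ 1 / 4) (hq : |q| ≤ 4)
    (hy : 1 ≤ y) :
    ‖(∫ s : ℝ, HH α ζ q y s) -
      ∫ s : ℝ, Hm α ζ q y (s + ((-(Real.pi / 2) : ℝ) : ℂ) * Complex.I)‖ ≤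
    32 * KK * (y ^ (-(α + 1 + 1)) + y ^ (-(2 * α + 1)) * (1 + Real.log y)) := by
  obtain ⟨i1, s1⟩ := shift1 α ζ q y h1 h2 hζ hq hy
  obtain ⟨-, i2, s2⟩ := shift2 α ζ q y h1 h2 hζ hq hy
  rw [← s1, s2, ← integral_sub i1 i2]
  obtain ⟨j1, b1⟩ := pow_int (α + 1) y (by linarith) (by linarith) hy
  obtain ⟨j2, b2⟩ := log_int (2 * α) y (by linarith) (by linarith) hy
  have j3 := (j1.add j2).const_mul 32
  have hcov := cov (fun u : ℝ => 32 * (Real.exp (-(1 / 8 * (y * u))) * u ^ (α + 1) +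
    Real.exp (-(1 / 8 * (y * u))) * (u ^ (2 * α) * (1 + |Real.log u|))))
  have hpt : ∀ s : ℝ, ‖HH α ζ q y (s + ((-(1 / 4) : ℝ) : ℂ) * Complex.I) -
      Hm α ζ q y (s + ((-(1 / 4) : ℝ) : ℂ) * Complex.I)‖ ≤
      Real.exp s • (32 * (Real.exp (-(1 / 8 * (y * Real.exp s))) * Real.exp s ^ (α + 1) +
      Real.exp (-(1 / 8 * (y * Real.exp s))) *
        (Real.exp s ^ (2 * α) * (1 + |Real.log (Real.exp s)|)))) := by
    intro s
    have hq4 : |(-(1 / 4) : ℝ)| ≤ 1 / 4 := by rw [abs_neg, abs_of_pos] <;> norm_num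
    have e0 := damp_re α ζ s (-(1 / 4)) h1 h2 hζ hq4
    have e1 := exp_sub_one_le ((1 + Complex.I * ζ) *
      Complex.exp (α * (s + ((-(1 / 4) : ℝ) : ℂ) * Complex.I))) (by
        linarith [Real.exp_pos (α * s)])
    rw [norm_mul (1 + Complex.I * (ζ : ℂ)), norm_exp2] at e1
    have e2 := norm_one_add ζ (by linarith)
    have e3 := PP_bound α ζ q s (-(1 / 4)) (by linarith) hq (by linarith)
    have e4 : Real.exp (y * Real.exp s * Real.sin (-(1 / 4))) ≤
        Real.exp (-(1 / 8 * (y * Real.exp s))) := by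
      apply Real.exp_le_exp.2
      rw [Real.sin_neg]
      have h4 := quarter_sin
      have : 0 < y * Real.exp s := by positivity
      nlinarith
    have e5 : HH α ζ q y (s + ((-(1 / 4) : ℝ) : ℂ) * Complex.I) -
      Hm α ζ q y (s + ((-(1 / 4) : ℝ) : ℂ) * Complex.I) =
      Hm α ζ q y (s + ((-(1 / 4) : ℝ) : ℂ) * Complex.I) *
      (Complex.exp (-((1 + Complex.I * ζ) *
      Complex.exp (α * (s + ((-(1 / 4) : ℝ) : ℂ) * Complex.I)))) - 1) := by
      rw [HH]; ring
    rw [e5, norm_mul, Hm_norm]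
    have e6 : Real.exp s ^ (α + 1) = Real.exp (α * s) * Real.exp s := by
      rw [← Real.exp_mul, ← Real.exp_add]; congr 1; ring
    have e7 : Real.exp s ^ (2 * α) = Real.exp (α * s) * Real.exp (α * s) := by
      rw [← Real.exp_mul, ← Real.exp_add]; congr 1; ring
    rw [e6, e7, Real.log_exp, smul_eq_mul]
    calc _ ≤ Real.exp s * Real.exp (-(1 / 8 * (y * Real.exp s))) *
        (8 * (Real.exp s + Real.exp (α * s) * (1 + |s|))) * (2 * (2 * Real.exp (α * s))) := by
          gcongr
          exact e1.trans (by gcongr)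
      _ = _ := by ring
  refine (norm_integral_le_of_norm_le ((cov_int _).1 j3) (ae_of_all _ hpt)).trans ?_
  refine le_trans (le_of_eq hcov.symm) ?_
  rw [integral_const_mul, integral_add j1 j2]
  have := add_le_add b1 b2
  nlinarith

lemma Hm_re (α ζ q y s : ℝ) :
    (Hm α ζ q y (s + ((-(Real.pi / 2) : ℝ) : ℂ) * Complex.I)).re =
    Real.exp s * (Real.exp (-(y * Real.exp s)) * Real.exp s ^ α *
      ((q * Real.cos (Real.pi * (2 - α) / 2) - Real.pi / 2 * (Real.cos (Real.pi * (2 - α) / 2)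
        - ζ * Real.sin (Real.pi * (2 - α) / 2))) +
       (ζ * Real.cos (Real.pi * (2 - α) / 2) + Real.sin (Real.pi * (2 - α) / 2)) *
        Real.log (Real.exp s))) := by
  have hc : Real.cos (α * -(Real.pi / 2)) = -Real.cos (Real.pi * (2 - α) / 2) := by
    rw [show α * -(Real.pi / 2) = Real.pi * (2 - α) / 2 - Real.pi by ring, Real.cos_sub_pi]
  have hs : Real.sin (α * -(Real.pi / 2)) = -Real.sin (Real.pi * (2 - α) / 2) := by
    rw [show α * -(Real.pi / 2) = Real.pi * (2 - α) / 2 - Real.pi by ring, Real.sin_sub_pi]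
  rw [Hm, PP, exp_alpha, exp_one', hc, hs, Real.cos_neg, Real.sin_neg, Real.cos_pi_div_two,
    Real.sin_pi_div_two, Real.log_exp, ← Real.exp_mul]
  have e1 : Complex.exp (-(Complex.I * y * (((Real.exp s * 0 : ℝ) : ℂ) +
      ((Real.exp s * -1 : ℝ) : ℂ) * Complex.I))) = ((Real.exp (-(y * Real.exp s)) : ℝ) : ℂ) := by
    rw [Complex.ofReal_exp]
    congr 1
    push_cast
    linear_combination (y : ℂ) * Complex.exp s * Complex.I_sq
  rw [e1, mul_comm s α]
  generalize Real.exp (-(y * Real.exp s)) = a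
  generalize Real.exp s = b
  generalize Real.exp (α * s) = w
  generalize Real.cos (Real.pi * (2 - α) / 2) = c
  generalize Real.sin (Real.pi * (2 - α) / 2) = d
  simp [-Complex.ofReal_div]
  ring

lemma exp_eighth (y u : ℝ) (hy : 1 ≤ y) (hu : 0 < u) :
    Real.exp (-(y * u)) ≤ Real.exp (-(1 / 8 * (y * u))) := by
  apply Real.exp_le_exp.2
  have : 0 < y * u := by positivity
  linarith

lemma main_term (α ζ q y A E : ℝ) (h1 : 1 ≤ α) (h2 : α ≤ 2) (hζ : |ζ| ≤ 1 / 4) (hq : |q| ≤ 4)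
    (hy : 1 ≤ y)
    (hA : A = q * Real.cos (Real.pi * (2 - α) / 2) - Real.pi / 2 * (Real.cos (Real.pi * (2 - α) / 2)
        - ζ * Real.sin (Real.pi * (2 - α) / 2)))
    (hE : E = ζ * Real.cos (Real.pi * (2 - α) / 2) + Real.sin (Real.pi * (2 - α) / 2)) :
    |(∫ s : ℝ, Hm α ζ q y (s + ((-(Real.pi / 2) : ℝ) : ℂ) * Complex.I)).re -
      A * (Real.Gamma (α + 1) * y ^ (-(α + 1)))| ≤
      |E| * (KK * y ^ (-(α + 1)) * (1 + Real.log y)) := by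
  have hy0 : 0 < y := by linarith
  obtain ⟨i1, -⟩ := shift2 α ζ q y h1 h2 hζ hq hy
  have hre : (∫ s : ℝ, Hm α ζ q y (s + ((-(Real.pi / 2) : ℝ) : ℂ) * Complex.I)).re =
      ∫ s : ℝ, (Hm α ζ q y (s + ((-(Real.pi / 2) : ℝ) : ℂ) * Complex.I)).re :=
    (integral_re i1).symm
  simp_rw [Hm_re, ← hA, ← hE] at hre
  have hcov := cov (fun u : ℝ => Real.exp (-(y * u)) * u ^ α * (A + E * Real.log u))
  simp_rw [smul_eq_mul] at hcov
  rw [hre, ← hcov]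
  obtain ⟨j1, -⟩ := pow_int α y h1 (by linarith) hy
  obtain ⟨j2, b2⟩ := log_int α y h1 (by linarith) hy
  have k1 : IntegrableOn (fun u : ℝ => Real.exp (-(y * u)) * u ^ α) (Ioi 0) := by
    refine Integrable.mono' j1 (Measurable.aestronglyMeasurable (by fun_prop)) ?_
    refine (ae_restrict_iff' measurableSet_Ioi).2 (ae_of_all _ fun u hu => ?_)
    have hu0 : (0 : ℝ) < u := hu
    rw [Real.norm_of_nonneg (by positivity)]
    have := exp_eighth y u hy hu0
    gcongr
  have hb : ∀ u ∈ Ioi (0 : ℝ), ‖Real.exp (-(y * u)) * u ^ α * Real.log u‖ ≤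
      Real.exp (-(1 / 8 * (y * u))) * (u ^ α * (1 + |Real.log u|)) := by
    intro u hu
    have hu0 : (0 : ℝ) < u := hu
    rw [norm_mul, Real.norm_of_nonneg (by positivity : 0 ≤ Real.exp (-(y * u)) * u ^ α),
      Real.norm_eq_abs, mul_assoc]
    have := exp_eighth y u hy hu0
    gcongr
    linarith
  have hb' := (ae_restrict_iff' (μ := volume) measurableSet_Ioi).2 (ae_of_all _ hb)
  have k2 : IntegrableOn (fun u : ℝ => Real.exp (-(y * u)) * u ^ α * Real.log u) (Ioi 0) :=
    Integrable.mono' j2 (Measurable.aestronglyMeasurable (by fun_prop)) hb'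
  have hG : ∫ u in Ioi (0 : ℝ), Real.exp (-(y * u)) * u ^ α =
      Real.Gamma (α + 1) * y ^ (-(α + 1)) := by
    have := Real.integral_rpow_mul_exp_neg_mul_Ioi (a := α + 1) (r := y) (by linarith) hy0
    rw [add_sub_cancel_right] at this
    simp_rw [mul_comm (Real.exp _)]
    rw [this, one_div, Real.inv_rpow hy0.le, Real.rpow_neg hy0.le, mul_comm]
  have hsplit : ∫ u in Ioi (0 : ℝ), Real.exp (-(y * u)) * u ^ α * (A + E * Real.log u) =
      A * (∫ u in Ioi (0 : ℝ), Real.exp (-(y * u)) * u ^ α) +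
      E * ∫ u in Ioi (0 : ℝ), Real.exp (-(y * u)) * u ^ α * Real.log u := by
    rw [← integral_const_mul, ← integral_const_mul, ← integral_add (k1.const_mul A)
      (k2.const_mul E)]
    congr 1
    ext u
    ring
  rw [hsplit, hG, add_sub_cancel_left, abs_mul]
  gcongr
  exact (norm_integral_le_of_norm_le j2 hb').trans b2

lemma tan_bound (Δ : ℝ) (h0 : 0 < Δ) (h1 : Δ < 1 / 16) :
    |Real.tan (Real.pi * (2 - Δ) / 2)| ≤ 4 * Δ ∧ Real.cos (Real.pi * (2 - Δ) / 2) ≠ 0 := by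
  have hpi3 := Real.pi_gt_three
  have hpi4 := Real.pi_lt_four
  have e : Real.pi * (2 - Δ) / 2 = Real.pi - Real.pi * Δ / 2 := by ring
  have hd0 : 0 < Real.pi * Δ / 2 := by positivity
  have hd1 : Real.pi * Δ / 2 ≤ 2 * Δ := by nlinarith
  have hc : 1 / 2 ≤ Real.cos (Real.pi * Δ / 2) := by
    have := Real.one_sub_sq_div_two_le_cos (x := Real.pi * Δ / 2)
    nlinarith
  have hs := Real.sin_le hd0.le
  have hs0 : 0 ≤ Real.sin (Real.pi * Δ / 2) :=
    Real.sin_nonneg_of_nonneg_of_le_pi hd0.le (by linarith)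
  rw [e, Real.tan_pi_sub, Real.cos_pi_sub, abs_neg]
  refine ⟨?_, by linarith⟩
  rw [Real.tan_eq_sin_div_cos, abs_of_nonneg (by positivity), div_le_iff₀ (by linarith)]
  nlinarith

/-- Derivative of the shift parameter. -/
noncomputable def zetaD (α β : ℝ) : ℝ :=
  -β * (Real.pi / 2) * (1 + Real.tan (Real.pi * α / 2) ^ 2)

lemma zeta_bounds (β Δ : ℝ) (hβ : |β| ≤ 1) (h0 : 0 < Δ) (h1 : Δ < 1 / 16) :
    |zetaPar (2 - Δ) β| ≤ 4 * Δ ∧ |zetaD (2 - Δ) β| ≤ 4 ∧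
    |zetaD (2 - Δ) β + β * (Real.pi / 2)| ≤ 8 * Δ ∧
    HasDerivAt (fun a => zetaPar a β) (zetaD (2 - Δ) β) (2 - Δ) := by
  obtain ⟨ht, hc⟩ := tan_bound Δ h0 h1
  have hpi3 := Real.pi_gt_three
  have hpi4 := Real.pi_lt_four
  have hsq : Real.tan (Real.pi * (2 - Δ) / 2) ^ 2 ≤ 4 * Δ := by
    rw [← sq_abs]
    nlinarith [abs_nonneg (Real.tan (Real.pi * (2 - Δ) / 2))]
  have hsq0 := sq_nonneg (Real.tan (Real.pi * (2 - Δ) / 2))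
  have habs : ∀ c : ℝ, 0 ≤ c → |β * c| ≤ c := fun c h => by
    rw [abs_mul, abs_of_nonneg h]; nlinarith
  refine ⟨?_, ?_, ?_, ?_⟩
  · rw [zetaPar, abs_mul, abs_neg]
    nlinarith [abs_nonneg (Real.tan (Real.pi * (2 - Δ) / 2)), abs_nonneg β]
  · have := habs (Real.pi / 2 * (1 + Real.tan (Real.pi * (2 - Δ) / 2) ^ 2)) (by positivity)
    rw [zetaD, show -β * (Real.pi / 2) * (1 + Real.tan (Real.pi * (2 - Δ) / 2) ^ 2) =
      -(β * (Real.pi / 2 * (1 + Real.tan (Real.pi * (2 - Δ) / 2) ^ 2))) by ring, abs_neg]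
    nlinarith
  · have := habs (Real.pi / 2 * Real.tan (Real.pi * (2 - Δ) / 2) ^ 2) (by positivity)
    rw [zetaD, show -β * (Real.pi / 2) * (1 + Real.tan (Real.pi * (2 - Δ) / 2) ^ 2) +
      β * (Real.pi / 2) =
      -(β * (Real.pi / 2 * Real.tan (Real.pi * (2 - Δ) / 2) ^ 2)) by ring, abs_neg]
    nlinarith
  · have hl : HasDerivAt (fun a : ℝ => Real.pi * a / 2) (Real.pi / 2) (2 - Δ) := by
      simpa using ((hasDerivAt_id (2 - Δ)).const_mul Real.pi).div_const 2
    have h := ((Real.hasDerivAt_tan hc).comp (2 - Δ) hl).const_mul (-β)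
    refine h.congr_deriv ?_
    rw [zetaD, Real.tan_eq_sin_div_cos]
    have := Real.sin_sq_add_cos_sq (Real.pi * (2 - Δ) / 2)
    field_simp
    linear_combination β * this

/-- Integrand of the inversion formula, rewritten. -/
noncomputable def Phi (β x a t : ℝ) : ℂ :=
  Complex.exp (-(Complex.I * t * ((x - zetaPar a β : ℝ) : ℂ)) -
    ((t ^ a : ℝ) : ℂ) * (1 + Complex.I * ((zetaPar a β : ℝ) : ℂ)))

/-- Its derivative in the index. -/
noncomputable def PhiD (β x a t : ℝ) : ℂ :=
  Phi β x a t * (Complex.I * t * ((zetaD a β : ℝ) : ℂ) -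
    (((t ^ a * Real.log t : ℝ) : ℂ) * (1 + Complex.I * ((zetaPar a β : ℝ) : ℂ)) +
      ((t ^ a : ℝ) : ℂ) * (Complex.I * ((zetaD a β : ℝ) : ℂ))))

lemma density_eq (a β x : ℝ) :
    stableDensity a β x = (1 / Real.pi) * (∫ t in Ioi (0 : ℝ), Phi β x a t).re := by
  rw [stableDensity]
  congr 2
  refine setIntegral_congr_fun measurableSet_Ioi (fun t ht => ?_)
  have ht0 : (0 : ℝ) < t := ht
  have e : ((t ^ a : ℝ) : ℂ) * ((t ^ (1 - a) : ℝ) : ℂ) = t := by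
    rw [← Complex.ofReal_mul, ← Real.rpow_add ht0]; simp
  rw [Phi, ← Complex.exp_add]
  simp only [zetaPar]
  congr 1
  generalize Real.tan (Real.pi * a / 2) = T
  push_cast
  linear_combination (-(Complex.I * β * (T : ℂ))) * e

lemma Phi_norm (β x a t : ℝ) : ‖Phi β x a t‖ = Real.exp (-(t ^ a)) := by
  rw [Phi, Complex.norm_exp]
  congr 1
  generalize t ^ a = w
  generalize x - zetaPar a β = y
  simp

lemma Phi_bound (β x a t : ℝ) (h1 : 1 ≤ a) (ht : 0 < t) :
    ‖Phi β x a t‖ ≤ 3 * Real.exp (-(1 * t)) := by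
  rw [Phi_norm]
  have e : t - 1 ≤ t ^ a := by
    rcases le_total t 1 with h | h
    · linarith [Real.rpow_pos_of_pos ht a]
    · have := Real.rpow_le_rpow_of_exponent_le h h1
      rw [Real.rpow_one] at this
      linarith
  calc Real.exp (-(t ^ a)) ≤ Real.exp (1 + -(1 * t)) := Real.exp_le_exp.2 (by linarith)
    _ = Real.exp 1 * Real.exp (-(1 * t)) := Real.exp_add _ _
    _ ≤ _ := by gcongr; linarith [Real.exp_one_lt_d9]

lemma PhiD_eq (β x a s : ℝ) :
    Real.exp s • PhiD β x a (Real.exp s) =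
      HH a (zetaPar a β) (zetaD a β) (x - zetaPar a β) s := by
  rw [PhiD, Phi, HH, Hm, PP, ← Real.exp_mul, Real.log_exp, mul_comm s a, Complex.real_smul]
  push_cast
  rw [sub_eq_add_neg (-(Complex.I * Complex.exp s * ((x : ℂ) - zetaPar a β))), Complex.exp_add]
  rw [show -(Complex.I * Complex.exp (s : ℂ) * ((x : ℂ) - zetaPar a β)) =
    -(Complex.I * ((x : ℂ) - zetaPar a β) * Complex.exp (s : ℂ)) by ring,
    show -(Complex.exp ((a : ℂ) * s) * (1 + Complex.I * (zetaPar a β : ℂ))) =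
    -((1 + Complex.I * (zetaPar a β : ℂ)) * Complex.exp ((a : ℂ) * s)) by ring]
  ring

lemma PhiD_norm (β x Δ t : ℝ) (hβ : |β| ≤ 1) (h0 : 0 < Δ) (h1 : Δ < 1 / 16) (ht : 0 < t) :
    ‖PhiD β x (2 - Δ) t‖ ≤ 72 * (Real.exp (-(1 * t)) * (1 + t ^ 3)) := by
  obtain ⟨hz, hq, -, -⟩ := zeta_bounds β Δ hβ h0 h1
  have hP := PP_bound2 (2 - Δ) (zetaPar (2 - Δ) β) (zetaD (2 - Δ) β) (Real.log t) 0
    (by linarith) (by linarith) (by linarith) hq (by norm_num)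
  have e : PhiD β x (2 - Δ) t = Phi β x (2 - Δ) t *
      PP (2 - Δ) (zetaPar (2 - Δ) β) (zetaD (2 - Δ) β)
      (((Real.log t : ℝ) : ℂ) + ((0 : ℝ) : ℂ) * Complex.I) := by
    have h3 : (t : ℂ) = Complex.exp ((Real.log t : ℝ) : ℂ) := by
      rw [← Complex.ofReal_exp, Real.exp_log ht]
    have h4 : ((t ^ (2 - Δ) : ℝ) : ℂ) =
        Complex.exp (((2 - Δ : ℝ) : ℂ) * ((Real.log t : ℝ) : ℂ)) := by
      rw [← Complex.ofReal_mul, ← Complex.ofReal_exp, Real.rpow_def_of_pos ht, mul_comm]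
    rw [PhiD, PP, Complex.ofReal_zero, zero_mul, add_zero, ← h3, ← h4, Complex.ofReal_mul]
    ring
  rw [e, norm_mul]
  rw [Real.exp_log ht] at hP
  calc _ ≤ (3 * Real.exp (-(1 * t))) * (24 * (1 + t ^ 3)) := by
        gcongr
        exact Phi_bound β x _ t (by linarith) ht
    _ = _ := by ring

lemma Phi_deriv (β x Δ t : ℝ) (hβ : |β| ≤ 1) (h0 : 0 < Δ) (h1 : Δ < 1 / 16) (ht : 0 < t) :
    HasDerivAt (fun a => Phi β x a t) (PhiD β x (2 - Δ) t) (2 - Δ) := by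
  obtain ⟨-, -, -, hd⟩ := zeta_bounds β Δ hβ h0 h1
  have hdc := hd.ofReal_comp
  have hp : HasDerivAt (fun a : ℝ => ((t ^ a : ℝ) : ℂ))
      ((t ^ (2 - Δ) * Real.log t : ℝ) : ℂ) (2 - Δ) := by
    have := (Real.hasStrictDerivAt_const_rpow ht (2 - Δ)).hasDerivAt
    exact this.ofReal_comp
  have hx : HasDerivAt (fun a : ℝ => ((x - zetaPar a β : ℝ) : ℂ))
      ((-zetaD (2 - Δ) β : ℝ) : ℂ) (2 - Δ) := (hd.const_sub x).ofReal_comp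
  have h := (((hx.const_mul (Complex.I * t)).neg).sub
    (hp.mul ((hdc.const_mul Complex.I).const_add 1))).cexp
  refine h.congr_deriv ?_
  rw [PhiD]
  simp only [Phi, Pi.sub_apply, Pi.neg_apply, Pi.mul_apply]
  push_cast
  ring

lemma fAlpha_eq (β x Δ : ℝ) (hβ : |β| ≤ 1) (h0 : 0 < Δ) (h1 : Δ < 1 / 16) :
    fAlpha (2 - Δ) β x = (1 / Real.pi) *
      (∫ s : ℝ, HH (2 - Δ) (zetaPar (2 - Δ) β) (zetaD (2 - Δ) β)
        (x - zetaPar (2 - Δ) β) s).re := by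
  have hbd : IntegrableOn (fun t : ℝ => 72 * (Real.exp (-(1 * t)) * (1 + t ^ 3))) (Ioi 0) :=
    (expint 1 one_pos 3).const_mul 72
  have hmeas : ∀ a : ℝ, Measurable (Phi β x a) := by
    intro a
    unfold Phi
    fun_prop
  have hmeasD : Measurable (PhiD β x (2 - Δ)) := by
    have := hmeas (2 - Δ)
    unfold PhiD
    fun_prop
  have key := (hasDerivAt_integral_of_dominated_loc_of_deriv_le (μ := volume.restrict (Ioi 0))
    (F := fun a t => Phi β x a t) (F' := fun a t => PhiD β x a t) (x₀ := 2 - Δ)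
    (s := Ioo (2 - 1 / 16) 2) (bound := fun t : ℝ => 72 * (Real.exp (-(1 * t)) * (1 + t ^ 3)))
    (Ioo_mem_nhds (by linarith) (by linarith))
    (Eventually.of_forall fun a => (hmeas a).aestronglyMeasurable)
    ?_ hmeasD.aestronglyMeasurable ?_ hbd ?_).2
  · have hre : HasDerivAt (fun a => (∫ t in Ioi (0 : ℝ), Phi β x a t).re)
        (∫ t in Ioi (0 : ℝ), PhiD β x (2 - Δ) t).re (2 - Δ) :=
      Complex.reCLM.hasFDerivAt.comp_hasDerivAt (2 - Δ) key
    have h := hre.const_mul (1 / Real.pi)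
    rw [fAlpha]
    simp_rw [density_eq]
    rw [h.deriv, cov]
    simp_rw [PhiD_eq]
  · refine Integrable.mono' hbd (hmeas _).aestronglyMeasurable ?_
    refine (ae_restrict_iff' measurableSet_Ioi).2 (ae_of_all _ fun t ht => ?_)
    have ht0 : (0 : ℝ) < t := ht
    refine (Phi_bound β x (2 - Δ) t (by linarith) ht0).trans ?_
    have e1 := Real.exp_pos (-(1 * t))
    have e2 : 0 < t ^ 3 := by positivity
    nlinarith [mul_pos e1 e2]
  · refine (ae_restrict_iff' measurableSet_Ioi).2 (ae_of_all _ fun t ht a ha => ?_)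
    have := PhiD_norm β x (2 - a) t hβ (by linarith [ha.2]) (by linarith [ha.1]) ht
    rwa [sub_sub_cancel] at this
  · refine (ae_restrict_iff' measurableSet_Ioi).2 (ae_of_all _ fun t ht a ha => ?_)
    have := Phi_deriv β x (2 - a) t hβ (by linarith [ha.2]) (by linarith [ha.1]) ht
    rwa [sub_sub_cancel] at this

lemma coeff_bounds (β Δ A E : ℝ) (hβ : |β| ≤ 1) (h0 : 0 < Δ) (h1 : Δ < 1 / 16)
    (hA : A = zetaD (2 - Δ) β * Real.cos (Real.pi * (2 - (2 - Δ)) / 2) -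
      Real.pi / 2 * (Real.cos (Real.pi * (2 - (2 - Δ)) / 2)
        - zetaPar (2 - Δ) β * Real.sin (Real.pi * (2 - (2 - Δ)) / 2)))
    (hE : E = zetaPar (2 - Δ) β * Real.cos (Real.pi * (2 - (2 - Δ)) / 2) +
      Real.sin (Real.pi * (2 - (2 - Δ)) / 2)) :
    |A + Real.pi / 2 * (1 + β)| ≤ 28 * Δ ∧ |E| ≤ 6 * Δ := by
  obtain ⟨hz, hq, hqz, -⟩ := zeta_bounds β Δ hβ h0 h1
  have hpi3 := Real.pi_gt_three
  have hpi4 := Real.pi_lt_four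
  rw [sub_sub_cancel] at hA hE
  have hd0 : 0 < Real.pi * Δ / 2 := by positivity
  have hd1 : Real.pi * Δ / 2 ≤ 2 * Δ := by nlinarith
  have hc := Real.one_sub_sq_div_two_le_cos (x := Real.pi * Δ / 2)
  have hc1 := Real.cos_le_one (Real.pi * Δ / 2)
  have hs := Real.sin_le hd0.le
  have hs0 : 0 ≤ Real.sin (Real.pi * Δ / 2) :=
    Real.sin_nonneg_of_nonneg_of_le_pi hd0.le (by linarith)
  have hs1 := Real.sin_le_one (Real.pi * Δ / 2)
  have hcc : 1 - Real.cos (Real.pi * Δ / 2) ≤ 2 * Δ := by nlinarith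
  generalize Real.cos (Real.pi * Δ / 2) = c at *
  generalize Real.sin (Real.pi * Δ / 2) = d at *
  have hc0 : 0 ≤ c := by linarith
  constructor
  · have e : A + Real.pi / 2 * (1 + β) = -(zetaD (2 - Δ) β * (1 - c)) +
        (zetaD (2 - Δ) β + β * (Real.pi / 2)) + Real.pi / 2 * (1 - c) +
        Real.pi / 2 * (zetaPar (2 - Δ) β * d) := by rw [hA]; ring
    have t1 : |-(zetaD (2 - Δ) β * (1 - c))| ≤ 4 * (2 * Δ) := by
      rw [abs_neg, abs_mul, abs_of_nonneg (by linarith : 0 ≤ 1 - c)]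
      gcongr
    have t2 : |Real.pi / 2 * (1 - c)| ≤ 2 * (2 * Δ) := by
      rw [abs_mul, abs_of_nonneg (by linarith : 0 ≤ 1 - c), abs_of_pos (by linarith)]
      gcongr
      linarith
    have t3 : |Real.pi / 2 * (zetaPar (2 - Δ) β * d)| ≤ 2 * (4 * Δ * 1) := by
      rw [abs_mul, abs_mul, abs_of_nonneg hs0, abs_of_pos (by linarith : 0 < Real.pi / 2)]
      gcongr
      linarith
    rw [e]
    refine (abs_add_le _ _).trans ?_
    refine (add_le_add (abs_add_le _ _) le_rfl).trans ?_
    refine (add_le_add (add_le_add (abs_add_le _ _) le_rfl) le_rfl).trans ?_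
    linarith
  · have t1 : |zetaPar (2 - Δ) β * c| ≤ 4 * Δ * 1 := by
      rw [abs_mul, abs_of_nonneg hc0]
      gcongr
    rw [hE]
    refine (abs_add_le _ _).trans ?_
    rw [abs_of_nonneg hs0]
    linarith

lemma Gamma_near : ∃ G > (0 : ℝ), ∃ Δ₁ > (0 : ℝ), ∀ Δ : ℝ, 0 < Δ → Δ < Δ₁ →
    |Real.Gamma (2 - Δ + 1) - 2| ≤ G * Δ := by
  have hd : DifferentiableAt ℝ Real.Gamma 3 := Real.differentiableAt_Gamma (fun m => by
    have : (0 : ℝ) ≤ m := m.cast_nonneg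
    linarith)
  have hG3 : Real.Gamma 3 = 2 := by
    rw [show (3 : ℝ) = ((2 : ℕ) : ℝ) + 1 by norm_num, Real.Gamma_nat_eq_factorial]
    norm_num [Nat.factorial]
  obtain ⟨G, hG, hb⟩ := hd.isBigO_sub.exists_pos
  rw [Asymptotics.isBigOWith_iff, Metric.eventually_nhds_iff] at hb
  obtain ⟨ε, hε, hb⟩ := hb
  refine ⟨G, hG, ε, hε, fun Δ h0 h1 => ?_⟩
  have := hb (y := 2 - Δ + 1) (by
    rw [Real.dist_eq, show 2 - Δ + 1 - 3 = -Δ by ring, abs_neg, abs_of_pos h0]; exact h1)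
  rw [hG3, show 2 - Δ + 1 - 3 = -Δ by ring, norm_neg, Real.norm_eq_abs, Real.norm_eq_abs,
    abs_of_pos h0] at this
  exact this

set_option maxHeartbeats 1000000 in
lemma pos_case : ∃ Δ₀ > (0 : ℝ), Δ₀ ≤ 1 / 16 ∧ ∃ C > (0 : ℝ), ∀ β : ℝ, |β| ≤ 1 →
    ∀ Δ : ℝ, 0 < Δ → Δ < Δ₀ → ∀ x y : ℝ, y = x - zetaPar (2 - Δ) β → 1 ≤ y →
    |fAlpha (2 - Δ) β x + (1 + β) / y ^ (1 + (2 - Δ))| ≤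
      C * y ^ (-(1 + (2 - Δ))) * (Δ * (1 + Real.log y) + 1 / y +
        (1 + Real.log y) / y ^ (2 - Δ)) := by
  obtain ⟨G, hG, Δ₁, hΔ₁, hGam⟩ := Gamma_near
  have hK := KK_nonneg
  refine ⟨min Δ₁ (1 / 16), lt_min hΔ₁ (by norm_num), min_le_right _ _,
    56 + 32 * G + 38 * KK, by positivity, ?_⟩
  intro β hβ Δ h0 hlt x y hy hy1
  have h1 : Δ < 1 / 16 := hlt.trans_le (min_le_right _ _)
  have hg := hGam Δ h0 (hlt.trans_le (min_le_left _ _))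
  have hy0 : 0 < y := by linarith
  have hL := Real.log_nonneg hy1
  obtain ⟨hz, hq, -, -⟩ := zeta_bounds β Δ hβ h0 h1
  have hz4 : |zetaPar (2 - Δ) β| ≤ 1 / 4 := by linarith
  have hf := fAlpha_eq β x Δ hβ h0 h1
  rw [← hy] at hf
  have hR := remainder (2 - Δ) (zetaPar (2 - Δ) β) (zetaD (2 - Δ) β) y (by linarith)
    (by linarith) hz4 hq hy1
  have hM := main_term (2 - Δ) (zetaPar (2 - Δ) β) (zetaD (2 - Δ) β) y _ _ (by linarith)
    (by linarith) hz4 hq hy1 rfl rfl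
  obtain ⟨cA, cE⟩ := coeff_bounds β Δ _ _ hβ h0 h1 rfl rfl
  have hR' := (Complex.abs_re_le_norm _).trans hR
  rw [Complex.sub_re] at hR'
  generalize (∫ s : ℝ, HH (2 - Δ) (zetaPar (2 - Δ) β) (zetaD (2 - Δ) β) y s).re = I1 at *
  generalize (∫ s : ℝ, Hm (2 - Δ) (zetaPar (2 - Δ) β) (zetaD (2 - Δ) β) y
    (s + ((-(Real.pi / 2) : ℝ) : ℂ) * Complex.I)).re = I2 at *
  generalize zetaD (2 - Δ) β * Real.cos (Real.pi * (2 - (2 - Δ)) / 2) -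
      Real.pi / 2 * (Real.cos (Real.pi * (2 - (2 - Δ)) / 2)
        - zetaPar (2 - Δ) β * Real.sin (Real.pi * (2 - (2 - Δ)) / 2)) = A at *
  generalize zetaPar (2 - Δ) β * Real.cos (Real.pi * (2 - (2 - Δ)) / 2) +
      Real.sin (Real.pi * (2 - (2 - Δ)) / 2) = E at *
  generalize Real.Gamma (2 - Δ + 1) = Ga at *
  have p1 : y ^ (-(2 - Δ + 1 + 1)) = y ^ (-(1 + (2 - Δ))) * (1 / y) := by
    rw [show -(2 - Δ + 1 + 1) = -(1 + (2 - Δ)) + (-1) by ring, Real.rpow_add hy0,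
      Real.rpow_neg_one, one_div]
  have p2 : y ^ (-(2 * (2 - Δ) + 1)) = y ^ (-(1 + (2 - Δ))) * (y ^ (2 - Δ))⁻¹ := by
    rw [show -(2 * (2 - Δ) + 1) = -(1 + (2 - Δ)) + (-(2 - Δ)) by ring, Real.rpow_add hy0,
      Real.rpow_neg hy0.le (2 - Δ)]
  have p3 : y ^ (-(2 - Δ + 1)) = y ^ (-(1 + (2 - Δ))) := by congr 1; ring
  have p4 : (1 + β) / y ^ (1 + (2 - Δ)) = (1 + β) * y ^ (-(1 + (2 - Δ))) := by
    rw [Real.rpow_neg hy0.le]; rfl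
  rw [p1, p2] at hR'
  rw [p3] at hM
  rw [hf, p4, div_eq_mul_inv (1 + Real.log y)]
  have hW : 0 < y ^ (-(1 + (2 - Δ))) := Real.rpow_pos_of_pos hy0 _
  have hV : 0 < (y ^ (2 - Δ))⁻¹ := inv_pos.2 (Real.rpow_pos_of_pos hy0 _)
  generalize y ^ (-(1 + (2 - Δ))) = W at *
  generalize (y ^ (2 - Δ))⁻¹ = V at *
  have hU : 0 < 1 / y := by positivity
  generalize 1 / y = U at *
  generalize Real.log y = L at *
  have hpi3 := Real.pi_gt_three
  have hpi4 := Real.pi_lt_four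
  have hpi0 := Real.pi_pos
  have hE2 : |E| * (KK * W * (1 + L)) ≤ 6 * Δ * (KK * W * (1 + L)) := by gcongr
  have hβ' := abs_le.1 hβ
  have hGa : |Ga| ≤ 2 + G := by
    have h2 : |Ga| ≤ |Ga - 2| + |(2 : ℝ)| := by simpa using abs_add_le (Ga - 2) 2
    have h3 : G * Δ ≤ G := by nlinarith
    rw [abs_two] at h2
    linarith
  have hAG : |A * Ga + Real.pi * (1 + β)| ≤ (56 + 32 * G) * Δ := by
    have e : A * Ga + Real.pi * (1 + β) = (A + Real.pi / 2 * (1 + β)) * Ga -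
      (Real.pi / 2 * (1 + β)) * (Ga - 2) := by ring
    rw [e]
    refine (abs_sub _ _).trans ?_
    rw [abs_mul, abs_mul]
    have t1 : |A + Real.pi / 2 * (1 + β)| * |Ga| ≤ 28 * Δ * (2 + G) := by gcongr
    have t2 : |Real.pi / 2 * (1 + β)| * |Ga - 2| ≤ 4 * (G * Δ) := by
      have : |Real.pi / 2 * (1 + β)| ≤ 4 := by
        rw [abs_of_nonneg (mul_nonneg (by linarith) (by linarith))]
        nlinarith
      gcongr
    linarith
  have hfin : |I1 + Real.pi * (1 + β) * W| ≤
      (56 + 32 * G + 38 * KK) * W * (Δ * (1 + L) + U + (1 + L) * V) := by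
    have e : I1 + Real.pi * (1 + β) * W = (I1 - I2) + (I2 - A * (Ga * W)) +
      (A * Ga + Real.pi * (1 + β)) * W := by ring
    have t3 : |(A * Ga + Real.pi * (1 + β)) * W| ≤ (56 + 32 * G) * Δ * W := by
      rw [abs_mul, abs_of_pos hW]; gcongr
    rw [e]
    refine (abs_add_le _ _).trans ?_
    refine (add_le_add (abs_add_le _ _) le_rfl).trans ?_
    refine (add_le_add (add_le_add hR' (hM.trans hE2)) t3).trans ?_
    have q1 : 0 ≤ (56 + 32 * G) * W * (Δ * L + U + (1 + L) * V) := by positivity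
    have q2 : 0 ≤ KK * W * (32 * (Δ * (1 + L)) + 6 * U + 6 * ((1 + L) * V)) := by positivity
    refine le_of_sub_nonneg ?_
    have q3 := add_nonneg q1 q2
    ring_nf at q3 ⊢
    linarith
  have hs : 1 / Real.pi * I1 + (1 + β) * W = 1 / Real.pi * (I1 + Real.pi * (1 + β) * W) := by
    field_simp
  rw [hs, abs_mul, abs_of_pos (by positivity : 0 < 1 / Real.pi)]
  have : 1 / Real.pi ≤ 1 := by rw [div_le_one hpi0]; linarith
  refine le_trans ?_ hfin
  exact mul_le_of_le_one_left (abs_nonneg _) this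

lemma zeta_neg (a β : ℝ) : zetaPar a (-β) = -zetaPar a β := by
  simp [zetaPar]

lemma density_neg (a β x : ℝ) : stableDensity a β x = stableDensity a (-β) (-x) := by
  rw [density_eq, density_eq]
  congr 1
  have : ∀ t : ℝ, Phi (-β) (-x) a t = (starRingEnd ℂ) (Phi β x a t) := by
    intro t
    rw [Phi, Phi, ← Complex.exp_conj, zeta_neg]
    congr 1
    simp only [map_sub, map_neg, map_mul, map_add, map_one, Complex.conj_I, Complex.conj_ofReal]
    push_cast
    ring
  simp_rw [this]
  rw [integral_conj, Complex.conj_re]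

lemma fAlpha_neg (a β x : ℝ) : fAlpha a β x = fAlpha a (-β) (-x) := by
  rw [fAlpha, fAlpha]
  congr 1
  ext b
  exact density_neg b β x

end StableAux

theorem fAlpha_asymptotic (β : ℝ) (hβ : β ∈ Set.Ioo (-1 : ℝ) 1) :
    ∃ x₀ > (0 : ℝ), ∃ Δ₀ > (0 : ℝ), ∃ C > (0 : ℝ),
      ∀ Δ : ℝ, 0 < Δ → Δ < Δ₀ → ∀ x : ℝ, x₀ ≤ |x| →
        |fAlpha (2 - Δ) β x +
            (1 + β * Real.sign (x - zetaPar (2 - Δ) β)) /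
              |x - zetaPar (2 - Δ) β| ^ (1 + (2 - Δ))| ≤
          C * |x - zetaPar (2 - Δ) β| ^ (-(1 + (2 - Δ))) *
            (Δ * (1 + Real.log |x - zetaPar (2 - Δ) β|) +
              1 / |x - zetaPar (2 - Δ) β| +
              (1 + Real.log |x - zetaPar (2 - Δ) β|) /
                |x - zetaPar (2 - Δ) β| ^ (2 - Δ)) := by
  obtain ⟨Δ₀, hΔ₀, hle, C, hC, h⟩ := StableAux.pos_case
  have hβ1 : |β| ≤ 1 := abs_le.2 ⟨hβ.1.le, hβ.2.le⟩
  refine ⟨2, by norm_num, Δ₀, hΔ₀, C, hC, ?_⟩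
  intro Δ h0 h1 x hx
  obtain ⟨hz, -⟩ := StableAux.zeta_bounds β Δ hβ1 h0 (by linarith)
  have hz' := abs_le.1 hz
  rcases le_total 0 x with hx0 | hx0
  · rw [abs_of_nonneg hx0] at hx
    have hy : 1 ≤ x - zetaPar (2 - Δ) β := by linarith
    have := h β hβ1 Δ h0 h1 x _ rfl hy
    rw [Real.sign_of_pos (by linarith), abs_of_pos (by linarith : 0 < x - zetaPar (2 - Δ) β),
      mul_one]
    exact this
  · rw [abs_of_nonpos hx0] at hx
    have hy : 1 ≤ -(x - zetaPar (2 - Δ) β) := by linarith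
    have := h (-β) (by rwa [abs_neg]) Δ h0 h1 (-x) (-(x - zetaPar (2 - Δ) β))
      (by rw [StableAux.zeta_neg]; ring) hy
    rw [Real.sign_of_neg (by linarith), abs_of_neg (by linarith : x - zetaPar (2 - Δ) β < 0),
      StableAux.fAlpha_neg, mul_neg_one]
    exact this
end
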